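/- arXiv:1705.00788 — 3 statements merged into one kernel-verified Lean document; each statement's English description precedes it below -/
import Mathlib

section
/- Let M be a finitely generated graded left D-module such that H^j_dR(M) is a finite-dimensional k-vector space for every 0 ≤ j ≤ n. Then for every i ≥ 0, the k-vector space Ext^i_D(M, E_D), computed in the category of left D-modules (which is k-linear since k is central in D), is finite-dimensional and dim_k Ext^i_D(M, E_D) = dim_k H^{n−i}_dR(M). -/
/-! Statement 11. -/

open MvPolynomial

set_option maxHeartbeats 2000000
set_option synthInstance.maxHeartbeats 1000000

/-- The multiplication operator `X_i : f ↦ x_i·f` on `R = k[x₁,…,xₙ]`. -/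
noncomputable def XopN (k : Type) [Field k] (n : ℕ) (i : Fin n) :
    Module.End k (MvPolynomial (Fin n) k) :=
  Algebra.lmul k (MvPolynomial (Fin n) k) (X i)

/-- The partial derivative operator `∂_i : f ↦ ∂f/∂x_i` on `R = k[x₁,…,xₙ]`. -/
noncomputable def pdOpN (k : Type) [Field k] (n : ℕ) (i : Fin n) :
    Module.End k (MvPolynomial (Fin n) k) :=
  (pderiv i : Derivation k (MvPolynomial (Fin n) k) (MvPolynomial (Fin n) k)).toLinearMap

/-- The Weyl algebra `D`, realized concretely as the `k`-subalgebra of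
`End_k(k[x₁,…,xₙ])` generated by the operators `X_i` and `∂_i`. -/
noncomputable def WeylN (k : Type) [Field k] (n : ℕ) : Type :=
  Algebra.adjoin k (Set.range (XopN k n) ∪ Set.range (pdOpN k n))

noncomputable instance (k : Type) [Field k] (n : ℕ) : Ring (WeylN k n) :=
  inferInstanceAs (Ring ↥(Algebra.adjoin k (Set.range (XopN k n) ∪ Set.range (pdOpN k n))))

noncomputable instance (k : Type) [Field k] (n : ℕ) : Algebra k (WeylN k n) :=
  inferInstanceAs (Algebra k ↥(Algebra.adjoin k (Set.range (XopN k n) ∪ Set.range (pdOpN k n))))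

/-- `X_i` as an element of the Weyl algebra. -/
noncomputable def XDi (k : Type) [Field k] (n : ℕ) (i : Fin n) : WeylN k n :=
  (⟨XopN k n i, Algebra.subset_adjoin (Or.inl ⟨i, rfl⟩)⟩ :
    ↥(Algebra.adjoin k (Set.range (XopN k n) ∪ Set.range (pdOpN k n))))

/-- `∂_i` as an element of the Weyl algebra. -/
noncomputable def pdDi (k : Type) [Field k] (n : ℕ) (i : Fin n) : WeylN k n :=
  (⟨pdOpN k n i, Algebra.subset_adjoin (Or.inr ⟨i, rfl⟩)⟩ :
    ↥(Algebra.adjoin k (Set.range (XopN k n) ∪ Set.range (pdOpN k n))))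

/-- `E_D = D/(D·X₁ + ⋯ + D·Xₙ)`, the quotient of `D` by the left ideal generated by
`X₁,…,Xₙ`; it is isomorphic to the top local cohomology module `H^n_{(x₁,…,xₙ)}(R)`. -/
noncomputable def EDcar (k : Type) [Field k] (n : ℕ) : Type :=
  WeylN k n ⧸ (Submodule.span (WeylN k n) (Set.range (XDi k n)))

noncomputable instance (k : Type) [Field k] (n : ℕ) : AddCommGroup (EDcar k n) :=
  inferInstanceAs (AddCommGroup
    (WeylN k n ⧸ (Submodule.span (WeylN k n) (Set.range (XDi k n)))))

noncomputable instance (k : Type) [Field k] (n : ℕ) : Module (WeylN k n) (EDcar k n) :=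
  inferInstanceAs (Module (WeylN k n)
    (WeylN k n ⧸ (Submodule.span (WeylN k n) (Set.range (XDi k n)))))

noncomputable instance (k : Type) [Field k] (n : ℕ) : Module k (EDcar k n) :=
  inferInstanceAs (Module k
    (WeylN k n ⧸ (Submodule.span (WeylN k n) (Set.range (XDi k n)))))

noncomputable instance (k : Type) [Field k] (n : ℕ) :
    SMulCommClass (WeylN k n) k (EDcar k n) :=
  inferInstanceAs (SMulCommClass (WeylN k n) k
    (WeylN k n ⧸ (Submodule.span (WeylN k n) (Set.range (XDi k n)))))

noncomputable instance (k : Type) [Field k] (n : ℕ) :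
    IsScalarTower k (WeylN k n) (EDcar k n) :=
  inferInstanceAs (IsScalarTower k (WeylN k n)
    (WeylN k n ⧸ (Submodule.span (WeylN k n) (Set.range (XDi k n)))))

/-- The action of `∂_i` on a left `D`-module `M`, as a `k`-linear endomorphism. -/
noncomputable def pdEnd (k : Type) [Field k] (n : ℕ) (M : Type) [AddCommGroup M] [Module k M]
    [Module (WeylN k n) M] [IsScalarTower k (WeylN k n) M] (i : Fin n) :
    Module.End k M where
  toFun m := pdDi k n i • m
  map_add' := smul_add _
  map_smul' c m := by
    simp only [RingHom.id_apply]
    rw [← algebraMap_smul (WeylN k n) c m, ← mul_smul, ← Algebra.commutes c (pdDi k n i),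
      mul_smul, algebraMap_smul]

section deRham

variable {k : Type} [Field k] {n : ℕ} {M : Type} [AddCommGroup M] [Module k M]

/-- The `i`-th term of the de Rham complex of `M` (a concrete realization of
`M ⊗ Λ^i(k^n)`, with the basis of `Λ^i(k^n)` indexed by `i`-element subsets of `Fin n`;
trivial for `i < 0` or `i > n`). -/
abbrev drT (k : Type) [Field k] (n : ℕ) (M : Type) [AddCommGroup M] [Module k M] (i : ℤ) :
    Type :=
  {s : Finset (Fin n) // (s.card : ℤ) = i} → M

/-- The de Rham differential, `m ⊗ ω ↦ Σ_j (∂_j·m) ⊗ (e_j ∧ ω)`. -/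
noncomputable def drD (pd : Fin n → Module.End k M) (i : ℤ) :
    drT k n M i →ₗ[k] drT k n M (i + 1) where
  toFun ω t := ∑ j ∈ t.1.attach,
    ((-1 : ℤ) ^ ((t.1.filter (fun a => a < j.1)).card)) •
      pd j.1 (ω ⟨t.1.erase j.1, by
        have hc := t.2
        have hpos : 0 < t.1.card := Finset.card_pos.mpr ⟨j.1, j.2⟩
        rw [Finset.card_erase_of_mem j.2]
        omega⟩)
  map_add' ω ω' := by
    funext t
    simp only [Pi.add_apply, map_add, smul_add]
    rw [Finset.sum_add_distrib]
  map_smul' c ω := by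
    funext t
    simp only [Pi.smul_apply, map_smul, RingHom.id_apply, Finset.smul_sum, smul_comm c]

/-- The boundaries in degree `i`: the image of the differential from degree `i-1`. -/
noncomputable def drBnd (pd : Fin n → Module.End k M) (i : ℤ) : Submodule k (drT k n M i) :=
  (show i - 1 + 1 = i by ring) ▸ LinearMap.range (drD pd (i - 1))

/-- The `i`-th de Rham cohomology of the `D`-module `(M, pd)`. -/
abbrev drH (pd : Fin n → Module.End k M) (i : ℤ) : Type :=
  ↥(LinearMap.ker (drD pd i)) ⧸
    Submodule.comap (LinearMap.ker (drD pd i)).subtype (drBnd pd i)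

end deRham

theorem XDi_commute (k : Type) [Field k] (n : ℕ) (i j : Fin n) :
    XDi k n i * XDi k n j = XDi k n j * XDi k n i := by
  apply Subtype.ext
  refine LinearMap.ext fun f : MvPolynomial (Fin n) k => ?_
  change X i * (X j * f) = X j * (X i * f)
  ring

theorem pdDi_mul_XDi (k : Type) [Field k] (n : ℕ) (i j : Fin n) :
    pdDi k n i * XDi k n j = XDi k n j * pdDi k n i + if i = j then 1 else 0 := by
  apply Subtype.ext
  have h : ∀ f : MvPolynomial (Fin n) k, pderiv i (X j * f) =
      X j * pderiv i f + (if i = j then (1 : Module.End k (MvPolynomial (Fin n) k)) else 0) f := by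
    intro f
    rw [Derivation.leibniz, pderiv_X]
    by_cases hij : i = j
    · subst hij; simp
    · simp [hij, Ne.symm hij]
  refine LinearMap.ext fun f : MvPolynomial (Fin n) k => ?_
  by_cases hij : i = j
  · have := h f
    simp only [hij, if_true] at this ⊢
    exact this
  · have := h f
    simp only [hij, if_false] at this ⊢
    exact this

theorem pdDi_commute (k : Type) [Field k] (n : ℕ) (i j : Fin n) :
    pdDi k n i * pdDi k n j = pdDi k n j * pdDi k n i := by
  apply Subtype.ext
  refine LinearMap.ext fun f : MvPolynomial (Fin n) k => ?_
  change pderiv i (pderiv j f) = pderiv j (pderiv i f)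
  have h : ⁅(pderiv i : Derivation k (MvPolynomial (Fin n) k) (MvPolynomial (Fin n) k)),
      pderiv (R := k) j⁆ = 0 := by
    apply MvPolynomial.derivation_ext
    intro l
    simp [Derivation.commutator_apply, pderiv_X, Pi.single_apply, apply_ite]
  have := congrArg (fun d => d f) h
  simpa [Derivation.commutator_apply, sub_eq_zero] using this

theorem weyl_induction {k : Type} [Field k] {n : ℕ} {p : WeylN k n → Prop} (h1 : p 1)
    (hadd : ∀ d e, p d → p e → p (d + e)) (hsmul : ∀ (c : k) d, p d → p (c • d))
    (hX : ∀ i d, p d → p (XDi k n i * d)) (hpd : ∀ i d, p d → p (pdDi k n i * d))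
    (d : WeylN k n) : p d := by
  suffices h : ∀ e, p e → p (d * e) by simpa using h 1 h1
  obtain ⟨d, hd⟩ := d
  induction hd using Algebra.adjoin_induction with
  | mem x hx =>
    rcases hx with ⟨i, rfl⟩ | ⟨i, rfl⟩
    · exact hX i
    · exact hpd i
  | algebraMap r =>
    intro e he
    have := hsmul r e he
    rwa [Algebra.smul_def] at this
  | add x y hx hy hx' hy' =>
    intro e he
    have hxy := add_mul (R := WeylN k n) ⟨x, hx⟩ ⟨y, hy⟩ e
    exact hxy ▸ hadd _ _ (hx' e he) (hy' e he)
  | mul x y hx hy hx' hy' =>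
    intro e he
    have hxy := mul_assoc (G := WeylN k n) ⟨x, hx⟩ ⟨y, hy⟩ e
    exact hxy ▸ hx' _ (hy' e he)

open IsMulCommutative in
/-- A commuting family in a `k`-algebra extends to an algebra map from the polynomial ring. -/
theorem exists_algHom_of_commute {k σ A : Type} [Field k] [Ring A] [Algebra k A] (t : σ → A)
    (ht : ∀ i j, t i * t j = t j * t i) :
    ∃ ψ : MvPolynomial σ k →ₐ[k] A, ∀ i, ψ (X i) = t i := by
  have := Algebra.isMulCommutative_adjoin k (s := Set.range t)
    (by rintro _ ⟨i, rfl⟩ _ ⟨j, rfl⟩; exact ht i j)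
  let f : MvPolynomial σ k →ₐ[k] Algebra.adjoin k (Set.range t) :=
    aeval fun i => ⟨t i, Algebra.subset_adjoin ⟨i, rfl⟩⟩
  refine ⟨(Algebra.adjoin k (Set.range t)).val.comp f, fun i => ?_⟩
  simp [f]

theorem MvPolynomial.eq_C_of_pderiv_eq_zero {k σ : Type} [Field k] [CharZero k]
    (q : MvPolynomial σ k) (h : ∀ i, pderiv i q = 0) : ∃ c, q = C c := by
  classical
  refine ⟨coeff 0 q, ?_⟩
  ext s
  rw [coeff_C]
  split_ifs with hs
  · rw [hs]
  · obtain ⟨i, hi⟩ : ∃ i, s i ≠ 0 := by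
      by_contra! hc
      exact hs (Finsupp.ext fun i => by simp [hc i])
    have h1 := congrArg (coeff (s - Finsupp.single i 1)) (h i)
    have h2 : s - Finsupp.single i 1 + Finsupp.single i 1 = s := by
      ext j
      by_cases hj : i = j
      · subst hj; simp; omega
      · simp [hj]
    rw [coeff_pderiv, h2, coeff_zero] at h1
    rcases mul_eq_zero.1 h1 with h1 | h1
    · exact h1
    · exfalso
      have : ((((s - Finsupp.single i 1 : σ →₀ ℕ) i + 1 : ℕ)) : k) = 0 := by push_cast; exact h1
      exact Nat.cast_ne_zero.2 (by omega) this

theorem MvPolynomial.totalDegree_pderiv_lt {k σ : Type} [Field k] (q : MvPolynomial σ k) (i : σ)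
    (h : q.totalDegree ≠ 0) : (pderiv i q).totalDegree < q.totalDegree := by
  classical
  have hle : ∀ s ∈ (pderiv i q).support, (s.sum fun _ e => e) < q.totalDegree := by
    intro s hs
    rw [mem_support_iff, coeff_pderiv] at hs
    have h1 := le_totalDegree (mem_support_iff.2 (left_ne_zero_of_mul hs))
    rw [Finsupp.sum_add_index' (by simp) (by simp)] at h1
    simp at h1
    omega
  rw [totalDegree, Finset.sup_lt_iff (by simpa using Nat.pos_of_ne_zero h)]
  exact hle

/-- In characteristic zero, a space of polynomials stable under all derivations and containing
no nonzero constant vanishes. -/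
theorem MvPolynomial.eq_zero_of_mem_of_pderiv_stable {k σ : Type} [Field k] [CharZero k]
    (W : Set (MvPolynomial σ k)) (hW : ∀ q ∈ W, ∀ i, pderiv i q ∈ W)
    (hC : ∀ c, C c ∈ W → c = 0) (q : MvPolynomial σ k) (hq : q ∈ W) : q = 0 := by
  induction hd : q.totalDegree using Nat.strong_induction_on generalizing q with
  | _ d ih =>
    subst hd
    obtain ⟨c, rfl⟩ : ∃ c, q = C c := by
      by_cases h0 : q.totalDegree = 0
      · exact ⟨_, totalDegree_eq_zero_iff_eq_C.1 h0⟩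
      · exact q.eq_C_of_pderiv_eq_zero fun i =>
          ih _ (totalDegree_pderiv_lt q i h0) _ (hW q hq i) rfl
    rw [hC c hq, C_0]

theorem exists_normalOrder (k : Type) [Field k] (n : ℕ) :
    ∃ φ : MvPolynomial (Fin n ⊕ Fin n) k →ₗ[k] WeylN k n, φ 1 = 1 ∧
      (∀ i q, φ (X (Sum.inl i) * q) = pdDi k n i * φ q) ∧
      (∀ i q, φ (X (Sum.inr i) * q) = φ q * XDi k n i) := by
  obtain ⟨ψ, hψ⟩ := exists_algHom_of_commute (k := k) (A := Module.End k (WeylN k n))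
    (Sum.elim (fun i => LinearMap.mulLeft k (pdDi k n i))
      (fun i => LinearMap.mulRight k (XDi k n i)))
    (by
      rintro (i | i) (j | j) <;> refine LinearMap.ext fun d => ?_ <;>
        simp only [Sum.elim_inl, Sum.elim_inr, Module.End.mul_apply, LinearMap.mulLeft_apply,
          LinearMap.mulRight_apply]
      · rw [← mul_assoc, pdDi_commute, mul_assoc]
      · rw [mul_assoc]
      · rw [mul_assoc]
      · rw [mul_assoc, XDi_commute, mul_assoc])
  refine ⟨LinearMap.applyₗ (1 : WeylN k n) ∘ₗ ψ.toLinearMap, ?_, fun i q => ?_, fun i q => ?_⟩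
  · simp
  · simp [hψ]
  · simp [hψ]

/-- The normal ordering map `ξ^b y^a ↦ ∂^b x^a`, with `ξ_i = X (inl i)` and `y_i = X (inr i)`. -/
noncomputable def normalOrder (k : Type) [Field k] (n : ℕ) :
    MvPolynomial (Fin n ⊕ Fin n) k →ₗ[k] WeylN k n :=
  (exists_normalOrder k n).choose

section

variable {k : Type} [Field k] {n : ℕ}

theorem normalOrder_one : normalOrder k n 1 = 1 := (exists_normalOrder k n).choose_spec.1

theorem normalOrder_X_inl_mul (i : Fin n) (q : MvPolynomial (Fin n ⊕ Fin n) k) :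
    normalOrder k n (X (Sum.inl i) * q) = pdDi k n i * normalOrder k n q :=
  (exists_normalOrder k n).choose_spec.2.1 i q

theorem normalOrder_X_inr_mul (i : Fin n) (q : MvPolynomial (Fin n ⊕ Fin n) k) :
    normalOrder k n (X (Sum.inr i) * q) = normalOrder k n q * XDi k n i :=
  (exists_normalOrder k n).choose_spec.2.2 i q

theorem normalOrder_C (c : k) : normalOrder k n (C c) = c • 1 := by
  rw [← mul_one (C c), ← smul_eq_C_mul, map_smul, normalOrder_one]

theorem XDi_mul_normalOrder (i : Fin n) (q : MvPolynomial (Fin n ⊕ Fin n) k) :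
    XDi k n i * normalOrder k n q =
      normalOrder k n (X (Sum.inr i) * q - pderiv (Sum.inl i) q) := by
  induction q using MvPolynomial.induction_on with
  | C c =>
    simp [normalOrder_C, normalOrder_X_inr_mul]
  | add p q hp hq =>
    simp only [map_add, map_sub, mul_add, hp, hq]
    abel
  | mul_X p s hp =>
    rcases s with j | j
    · rw [mul_comm p, normalOrder_X_inl_mul, ← mul_assoc,
        eq_sub_of_add_eq (pdDi_mul_XDi k n j i).symm, sub_mul, mul_assoc, hp,
        ← normalOrder_X_inl_mul]
      by_cases hij : j = i
      · subst hij
        simp only [if_true, one_mul, ← map_sub, Derivation.leibniz, pderiv_X_self, smul_eq_mul]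
        congr 1
        ring
      · have h1 : (Sum.inl j : Fin n ⊕ Fin n) ≠ Sum.inl i := by simpa using hij
        simp only [hij, if_false, zero_mul, sub_zero, Derivation.leibniz, pderiv_X_of_ne h1,
          smul_eq_mul]
        congr 1
        ring
    · rw [mul_comm p, normalOrder_X_inr_mul, ← mul_assoc, hp, ← normalOrder_X_inr_mul]
      have h1 : (Sum.inr j : Fin n ⊕ Fin n) ≠ Sum.inl i := by simp
      simp only [Derivation.leibniz, pderiv_X_of_ne h1, smul_eq_mul]
      congr 1
      ring

theorem normalOrder_mul_pdDi (i : Fin n) (q : MvPolynomial (Fin n ⊕ Fin n) k) :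
    normalOrder k n q * pdDi k n i =
      normalOrder k n (X (Sum.inl i) * q - pderiv (Sum.inr i) q) := by
  induction q using MvPolynomial.induction_on with
  | C c =>
    simp [normalOrder_C, normalOrder_X_inl_mul]
  | add p q hp hq =>
    simp only [map_add, map_sub, mul_add, add_mul, hp, hq]
    abel
  | mul_X p s hp =>
    rcases s with j | j
    · rw [mul_comm p, normalOrder_X_inl_mul, mul_assoc, hp, ← normalOrder_X_inl_mul]
      have h1 : (Sum.inl j : Fin n ⊕ Fin n) ≠ Sum.inr i := by simp
      simp only [Derivation.leibniz, pderiv_X_of_ne h1, smul_eq_mul]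
      congr 1
      ring
    · rw [mul_comm p, normalOrder_X_inr_mul, mul_assoc,
        eq_sub_of_add_eq (pdDi_mul_XDi k n i j).symm, mul_sub, ← mul_assoc, hp,
        ← normalOrder_X_inr_mul]
      by_cases hij : i = j
      · subst hij
        simp only [if_true, mul_one, ← map_sub, Derivation.leibniz, pderiv_X_self, smul_eq_mul]
        congr 1
        ring
      · have h1 : (Sum.inr j : Fin n ⊕ Fin n) ≠ Sum.inr i := by simpa using Ne.symm hij
        simp only [hij, if_false, mul_zero, sub_zero, Derivation.leibniz, pderiv_X_of_ne h1,
          smul_eq_mul]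
        congr 1
        ring

theorem normalOrder_surjective : Function.Surjective (normalOrder k n) := by
  intro d
  induction d using weyl_induction with
  | h1 => exact ⟨1, normalOrder_one⟩
  | hadd d e hd he =>
    obtain ⟨p, rfl⟩ := hd
    obtain ⟨q, rfl⟩ := he
    exact ⟨p + q, map_add _ _ _⟩
  | hsmul c d hd =>
    obtain ⟨p, rfl⟩ := hd
    exact ⟨c • p, map_smul _ _ _⟩
  | hX i d hd =>
    obtain ⟨p, rfl⟩ := hd
    exact ⟨_, (XDi_mul_normalOrder i p).symm⟩
  | hpd i d hd =>
    obtain ⟨p, rfl⟩ := hd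
    exact ⟨_, normalOrder_X_inl_mul i p⟩

theorem normalOrder_pderiv_inl (i : Fin n) (q : MvPolynomial (Fin n ⊕ Fin n) k) :
    normalOrder k n (pderiv (Sum.inl i) q) =
      normalOrder k n q * XDi k n i - XDi k n i * normalOrder k n q := by
  rw [XDi_mul_normalOrder, map_sub, normalOrder_X_inr_mul]
  abel

theorem normalOrder_pderiv_inr (i : Fin n) (q : MvPolynomial (Fin n ⊕ Fin n) k) :
    normalOrder k n (pderiv (Sum.inr i) q) =
      pdDi k n i * normalOrder k n q - normalOrder k n q * pdDi k n i := by
  rw [normalOrder_mul_pdDi, map_sub, normalOrder_X_inl_mul]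
  abel

instance : Nontrivial (WeylN k n) :=
  inferInstanceAs (Nontrivial
    (Algebra.adjoin k (Set.range (XopN k n) ∪ Set.range (pdOpN k n))))

theorem normalOrder_injective [CharZero k] : Function.Injective (normalOrder k n) := by
  rw [injective_iff_map_eq_zero]
  intro q hq
  refine MvPolynomial.eq_zero_of_mem_of_pderiv_stable {q | normalOrder k n q = 0} ?_ ?_ q hq
  · rintro p (hp : _ = 0) (i | i)
    · simp [normalOrder_pderiv_inl, hp]
    · simp [normalOrder_pderiv_inr, hp]
  · intro c (hc : _ = 0)
    rw [normalOrder_C] at hc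
    exact (smul_eq_zero.1 hc).resolve_right one_ne_zero

/-- The normal ordering isomorphism. -/
noncomputable def normalOrderEquiv (k : Type) [Field k] [CharZero k] (n : ℕ) :
    MvPolynomial (Fin n ⊕ Fin n) k ≃ₗ[k] WeylN k n :=
  LinearEquiv.ofBijective (normalOrder k n) ⟨normalOrder_injective, normalOrder_surjective⟩

theorem normalOrderEquiv_apply [CharZero k] (q : MvPolynomial (Fin n ⊕ Fin n) k) :
    normalOrderEquiv k n q = normalOrder k n q := rfl

end

section

variable {k : Type} [Field k] {n : ℕ}

/-- For every generator of the polynomial ring, left multiplication by the corresponding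
operator agrees with multiplication by the generator up to terms of lower degree. -/
theorem exists_mul_normalOrder_eq (s : Fin n ⊕ Fin n) :
    ∃ t : WeylN k n, ∀ r, ∃ r' : MvPolynomial (Fin n ⊕ Fin n) k,
      t * normalOrder k n r = normalOrder k n (X s * r - r') ∧
      ∀ d, (∀ m, d < m.degree → coeff m r = 0) → ∀ m, d ≤ m.degree → coeff m r' = 0 := by
  rcases s with i | i
  · exact ⟨pdDi k n i, fun r => ⟨0, by rw [sub_zero, normalOrder_X_inl_mul], by simp⟩⟩
  · refine ⟨XDi k n i, fun r => ⟨_, XDi_mul_normalOrder i r, fun d hd m hm => ?_⟩⟩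
    rw [coeff_pderiv, hd, zero_mul]
    simp only [map_add, Finsupp.degree_single]
    omega

/-- The ideal of leading symbols of a left ideal of the Weyl algebra. -/
noncomputable def symbolIdeal (I : Submodule (WeylN k n) (WeylN k n)) :
    Ideal (MvPolynomial (Fin n ⊕ Fin n) k) where
  carrier := {q | ∀ d : ℕ, ∃ r, normalOrder k n r ∈ I ∧ (∀ m, d < m.degree → coeff m r = 0) ∧
    ∀ m, m.degree = d → coeff m r = coeff m q}
  zero_mem' d := ⟨0, by simp, by simp, by simp⟩
  add_mem' := by
    intro p q hp hq d
    obtain ⟨r, h1, h2, h3⟩ := hp d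
    obtain ⟨s, h4, h5, h6⟩ := hq d
    refine ⟨r + s, by rw [map_add]; exact I.add_mem h1 h4, fun m hm => ?_, fun m hm => ?_⟩
    · rw [coeff_add, h2 m hm, h5 m hm, add_zero]
    · rw [coeff_add, h3 m hm, h6 m hm, coeff_add]
  smul_mem' := by
    intro c q hq
    change ∀ d : ℕ, _
    induction c using MvPolynomial.induction_on with
    | C c =>
      intro d
      obtain ⟨r, h1, h2, h3⟩ := hq d
      refine ⟨c • r, ?_, fun m hm => ?_, fun m hm => ?_⟩
      · rw [map_smul, ← algebraMap_smul (WeylN k n) c]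
        exact I.smul_mem _ h1
      · rw [coeff_smul, h2 m hm, smul_zero]
      · rw [coeff_smul, h3 m hm, smul_eq_mul, smul_eq_mul, coeff_C_mul]
    | add a b ha hb =>
      intro d
      obtain ⟨r, h1, h2, h3⟩ := ha d
      obtain ⟨s, h4, h5, h6⟩ := hb d
      refine ⟨r + s, by rw [map_add]; exact I.add_mem h1 h4, fun m hm => ?_, fun m hm => ?_⟩
      · rw [coeff_add, h2 m hm, h5 m hm, add_zero]
      · rw [coeff_add, h3 m hm, h6 m hm, add_smul, coeff_add]
    | mul_X a s ha =>
      rintro (_ | d)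
      · refine ⟨0, by simp, by simp, fun m hm => ?_⟩
        obtain rfl : m = 0 := (Finsupp.degree_eq_zero_iff m).1 hm
        rw [mul_comm a, mul_smul, smul_eq_mul, coeff_X_mul']
        simp
      · obtain ⟨t, ht⟩ := exists_mul_normalOrder_eq (k := k) s
        obtain ⟨r, h1, h2, h3⟩ := ha d
        obtain ⟨r', h4, h5⟩ := ht r
        have hdeg : ∀ m : Fin n ⊕ Fin n →₀ ℕ, s ∈ m.support →
            (m - Finsupp.single s 1).degree + 1 = m.degree := by
          intro m hm
          have h : m - Finsupp.single s 1 + Finsupp.single s 1 = m :=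
            tsub_add_cancel_of_le (by simpa [Nat.one_le_iff_ne_zero] using hm)
          conv_rhs => rw [← h]
          simp
        refine ⟨X s * r - r', by rw [← h4]; exact I.smul_mem t h1, fun m hm => ?_,
          fun m hm => ?_⟩
        · rw [coeff_sub, h5 d h2 m (by omega), sub_zero, coeff_X_mul']
          split_ifs with hs
          · exact h2 _ (by have := hdeg m hs; omega)
          · rfl
        · rw [coeff_sub, h5 d h2 m (by omega), sub_zero, mul_comm a, mul_smul, smul_eq_mul,
            coeff_X_mul', coeff_X_mul']
          split_ifs with hs
          · exact h3 _ (by have := hdeg m hs; omega)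
          · rfl

theorem symbolIdeal_strictMono : StrictMono (symbolIdeal (k := k) (n := n)) := by
  have hmono : Monotone (symbolIdeal (k := k) (n := n)) := by
    intro I J hIJ q hq d
    obtain ⟨r, h1, h2⟩ := hq d
    exact ⟨r, hIJ h1, h2⟩
  intro I J hIJ
  refine lt_of_le_not_ge (hmono hIJ.le) fun h => hIJ.not_ge ?_
  have key : ∀ d (q : MvPolynomial (Fin n ⊕ Fin n) k),
      (∀ m, d ≤ m.degree → coeff m q = 0) → normalOrder k n q ∈ J → normalOrder k n q ∈ I := by
    intro d
    induction d with
    | zero =>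
      intro q hq _
      obtain rfl : q = 0 := by ext m; exact hq m (Nat.zero_le _)
      simp
    | succ d ih =>
      intro q hq hqJ
      have htop : homogeneousComponent d q ∈ symbolIdeal J := by
        intro e
        by_cases hed : e = d
        · subst hed
          refine ⟨q, hqJ, hq, fun m hm => ?_⟩
          rw [coeff_homogeneousComponent, if_pos hm]
        · refine ⟨0, by simp, by simp, fun m hm => ?_⟩
          rw [coeff_homogeneousComponent, if_neg (hm ▸ hed), coeff_zero]
      obtain ⟨r, h1, h2, h3⟩ := h htop d
      have h4 := ih (q - r) (fun m hm => by
        rcases hm.eq_or_lt with hm | hm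
        · rw [coeff_sub, h3 m hm.symm, coeff_homogeneousComponent, if_pos hm.symm, sub_self]
        · rw [coeff_sub, h2 m hm, hq m hm, sub_self])
        (by rw [map_sub]; exact J.sub_mem hqJ (hIJ.le h1))
      rw [map_sub] at h4
      simpa using I.add_mem h4 h1
  intro x hx
  obtain ⟨q, rfl⟩ := normalOrder_surjective x
  refine key (q.totalDegree + 1) q (fun m hm => ?_) hx
  refine coeff_eq_zero_of_totalDegree_lt ?_
  rw [Finsupp.degree_apply] at hm
  exact hm

instance : IsNoetherianRing (WeylN k n) := by
  rw [IsNoetherianRing, isNoetherian_iff']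
  have : WellFoundedGT (Ideal (MvPolynomial (Fin n ⊕ Fin n) k)) :=
    isNoetherian_iff'.1 (inferInstance : IsNoetherianRing (MvPolynomial (Fin n ⊕ Fin n) k))
  exact symbolIdeal_strictMono.wellFoundedGT

end

/-- The inclusion of polynomials in the `x_i` into the Weyl algebra. -/
noncomputable def XHom (k : Type) [Field k] (n : ℕ) : MvPolynomial (Fin n) k →ₐ[k] WeylN k n :=
  (exists_algHom_of_commute (XDi k n) (XDi_commute k n)).choose

/-- The inclusion of polynomials in the `∂_i` into the Weyl algebra. -/
noncomputable def pdHom (k : Type) [Field k] (n : ℕ) : MvPolynomial (Fin n) k →ₐ[k] WeylN k n :=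
  (exists_algHom_of_commute (pdDi k n) (pdDi_commute k n)).choose

section

variable {k : Type} [Field k] {n : ℕ}

theorem XHom_X (i : Fin n) : XHom k n (X i) = XDi k n i :=
  (exists_algHom_of_commute (XDi k n) (XDi_commute k n)).choose_spec i

theorem pdHom_X (i : Fin n) : pdHom k n (X i) = pdDi k n i :=
  (exists_algHom_of_commute (pdDi k n) (pdDi_commute k n)).choose_spec i

theorem pdDi_mul_XHom (i : Fin n) (p : MvPolynomial (Fin n) k) :
    pdDi k n i * XHom k n p = XHom k n p * pdDi k n i + XHom k n (pderiv i p) := by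
  induction p using MvPolynomial.induction_on with
  | C c =>
    have h : C c = algebraMap k (MvPolynomial (Fin n) k) c := rfl
    rw [pderiv_C, h, AlgHom.commutes, Algebra.commutes, map_zero, add_zero]
  | add p q hp hq => rw [map_add, mul_add, hp, hq, map_add, map_add, add_mul]; abel
  | mul_X p j hp =>
    rw [map_mul, ← mul_assoc, hp, add_mul, mul_assoc, XHom_X, pdDi_mul_XDi, mul_add, ← mul_assoc]
    by_cases hij : i = j
    · subst hij
      simp only [if_true, Derivation.leibniz, pderiv_X_self, smul_eq_mul, mul_one, map_add,
        mul_comm (X i), map_mul, XHom_X]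
      abel
    · simp only [hij, if_false, Derivation.leibniz, pderiv_X_of_ne (Ne.symm hij), smul_eq_mul,
        mul_zero, mul_comm (X j), map_mul, XHom_X, zero_add, add_zero]

theorem XDi_mul_pdHom (i : Fin n) (p : MvPolynomial (Fin n) k) :
    XDi k n i * pdHom k n p = pdHom k n p * XDi k n i - pdHom k n (pderiv i p) := by
  induction p using MvPolynomial.induction_on with
  | C c =>
    have h : C c = algebraMap k (MvPolynomial (Fin n) k) c := rfl
    rw [pderiv_C, h, AlgHom.commutes, Algebra.commutes, map_zero, sub_zero]
  | add p q hp hq => rw [map_add, mul_add, hp, hq, map_add, map_add, add_mul]; abel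
  | mul_X p j hp =>
    rw [map_mul, ← mul_assoc, hp, sub_mul, mul_assoc, pdHom_X,
      eq_sub_of_add_eq (pdDi_mul_XDi k n j i).symm, mul_sub, ← mul_assoc]
    by_cases hij : j = i
    · subst hij
      simp only [if_true, Derivation.leibniz, pderiv_X_self, smul_eq_mul, mul_one, map_add,
        mul_comm (X j), map_mul, pdHom_X]
      abel
    · simp only [hij, if_false, Derivation.leibniz, pderiv_X_of_ne hij, smul_eq_mul,
        mul_zero, mul_comm (X j), map_mul, pdHom_X, zero_add, sub_zero]

/-- The class of `1` in `E_D`. -/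
noncomputable def EDone (k : Type) [Field k] (n : ℕ) : EDcar k n :=
  Submodule.Quotient.mk (p := Submodule.span (WeylN k n) (Set.range (XDi k n))) 1

theorem XDi_smul_EDone (i : Fin n) : XDi k n i • EDone k n = 0 := by
  change Submodule.Quotient.mk (p := Submodule.span (WeylN k n) (Set.range (XDi k n)))
    (XDi k n i • 1) = 0
  rw [Submodule.Quotient.mk_eq_zero, smul_eq_mul, mul_one]
  exact Submodule.subset_span ⟨i, rfl⟩

theorem exists_smul_EDone (e : EDcar k n) : ∃ d : WeylN k n, d • EDone k n = e := by
  obtain ⟨d, rfl⟩ := Submodule.Quotient.mk_surjective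
    (Submodule.span (WeylN k n) (Set.range (XDi k n))) e
  refine ⟨d, ?_⟩
  change Submodule.Quotient.mk (p := Submodule.span (WeylN k n) (Set.range (XDi k n)))
    (d • 1) = _
  rw [smul_eq_mul, mul_one]

theorem XDi_smul_pdHom_smul_EDone (i : Fin n) (p : MvPolynomial (Fin n) k) :
    XDi k n i • pdHom k n p • EDone k n = -(pdHom k n (pderiv i p) • EDone k n) := by
  rw [← mul_smul, XDi_mul_pdHom, sub_smul, mul_smul, XDi_smul_EDone, smul_zero, zero_sub]

theorem exists_pdHom_smul_EDone (e : EDcar k n) :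
    ∃ p : MvPolynomial (Fin n) k, pdHom k n p • EDone k n = e := by
  obtain ⟨d, rfl⟩ := exists_smul_EDone e
  induction d using weyl_induction with
  | h1 => exact ⟨1, by rw [map_one]⟩
  | hadd d e hd he =>
    obtain ⟨p, hp⟩ := hd
    obtain ⟨q, hq⟩ := he
    exact ⟨p + q, by rw [map_add, add_smul, hp, hq, add_smul]⟩
  | hsmul c d hd =>
    obtain ⟨p, hp⟩ := hd
    exact ⟨c • p, by rw [map_smul, smul_assoc, hp, smul_assoc]⟩
  | hX i d hd =>
    obtain ⟨p, hp⟩ := hd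
    exact ⟨-pderiv i p, by rw [mul_smul, ← hp, XDi_smul_pdHom_smul_EDone, map_neg, neg_smul]⟩
  | hpd i d hd =>
    obtain ⟨p, hp⟩ := hd
    exact ⟨X i * p, by rw [map_mul, pdHom_X, mul_smul, hp, ← mul_smul]⟩

/-- The residue functional exists: it kills all `∂_i·E_D` and is `1` on the class of `1`. -/
theorem exists_residue (k : Type) [Field k] [CharZero k] (n : ℕ) :
    ∃ ρ : EDcar k n →ₗ[k] k, ρ (EDone k n) = 1 ∧ ∀ i e, ρ (pdDi k n i • e) = 0 := by
  let r : WeylN k n →ₗ[k] k :=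
    MvPolynomial.lcoeff k (0 : Fin n ⊕ Fin n →₀ ℕ) ∘ₗ (normalOrderEquiv k n).symm.toLinearMap
  have hr : ∀ q, r (normalOrder k n q) = coeff 0 q := by
    intro q
    rw [← normalOrderEquiv_apply]
    simp [r]
  have hrX : ∀ d i, r (d * XDi k n i) = 0 := by
    intro d i
    obtain ⟨q, rfl⟩ := normalOrder_surjective d
    rw [← normalOrder_X_inr_mul, hr]
    simp [coeff_X_mul']
  have hrpd : ∀ d i, r (pdDi k n i * d) = 0 := by
    intro d i
    obtain ⟨q, rfl⟩ := normalOrder_surjective d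
    rw [← normalOrder_X_inl_mul, hr]
    simp [coeff_X_mul']
  have hspan : (Submodule.span (WeylN k n) (Set.range (XDi k n))).restrictScalars k ≤
      LinearMap.ker r := by
    intro d (hd : d ∈ Submodule.span (WeylN k n) (Set.range (XDi k n)))
    rw [LinearMap.mem_ker]
    suffices h : ∀ e, r (e * d) = 0 by simpa using h 1
    induction hd using Submodule.span_induction with
    | mem x hx => obtain ⟨i, rfl⟩ := hx; exact fun e => hrX e i
    | zero => simp
    | add x y _ _ hx hy => intro e; rw [mul_add, map_add, hx, hy, add_zero]
    | smul a x _ hx => intro e; rw [smul_eq_mul, ← mul_assoc, hx]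
  let ρ : EDcar k n →ₗ[k] k := Submodule.liftQ
    ((Submodule.span (WeylN k n) (Set.range (XDi k n))).restrictScalars k) r hspan
  have hρ : ∀ d, ρ (d • EDone k n) = r d := by
    intro d
    change r (d • 1) = r d
    rw [smul_eq_mul, mul_one]
  refine ⟨ρ, ?_, fun i e => ?_⟩
  · rw [← one_smul (WeylN k n) (EDone k n), hρ, ← normalOrder_one, hr]
    simp
  · obtain ⟨d, rfl⟩ := exists_smul_EDone e
    rw [← mul_smul, hρ, hrpd]

/-- The residue functional on `E_D`. -/
noncomputable def EDres (k : Type) [Field k] [CharZero k] (n : ℕ) : EDcar k n →ₗ[k] k :=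
  (exists_residue k n).choose

variable [CharZero k]

theorem EDres_EDone : EDres k n (EDone k n) = 1 := (exists_residue k n).choose_spec.1

theorem EDres_pdDi_smul (i : Fin n) (e : EDcar k n) : EDres k n (pdDi k n i • e) = 0 :=
  (exists_residue k n).choose_spec.2 i e

/-- The residue pairing between polynomials and `E_D` is nondegenerate on the side of `E_D`. -/
theorem eq_zero_of_EDres_eq_zero (e : EDcar k n)
    (h : ∀ p, EDres k n (XHom k n p • e) = 0) : e = 0 := by
  obtain ⟨q, rfl⟩ := exists_pdHom_smul_EDone e
  suffices hq : q = 0 by rw [hq, map_zero, zero_smul]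
  refine MvPolynomial.eq_zero_of_mem_of_pderiv_stable
    {q | ∀ p, EDres k n (XHom k n p • pdHom k n q • EDone k n) = 0} ?_ ?_ q h
  · intro q (hq : ∀ p, _) i p
    have := hq (p * X i)
    rw [map_mul, XHom_X, mul_smul, XDi_smul_pdHom_smul_EDone, smul_neg, map_neg,
      neg_eq_zero] at this
    exact this
  · intro c hc
    have := hc 1
    have h1 : C c = algebraMap k (MvPolynomial (Fin n) k) c := rfl
    rwa [map_one, one_smul, h1, AlgHom.commutes, algebraMap_smul, map_smul, EDres_EDone,
      smul_eq_mul, mul_one] at this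

end

theorem Finsupp.exists_eq_add_single_of_ne_zero {σ : Type} {c : σ →₀ ℕ} (hc : c ≠ 0) :
    ∃ (c' : σ →₀ ℕ) (i : σ), c = c' + Finsupp.single i 1 := by
  obtain ⟨i, hi⟩ := Finsupp.ne_iff.1 hc
  refine ⟨c - Finsupp.single i 1, i, (tsub_add_cancel_of_le ?_).symm⟩
  simpa [Nat.one_le_iff_ne_zero] using hi

section

variable {k : Type} [Field k] [CharZero k] {n : ℕ}

/-- Distinct monomials are orthogonal for the residue pairing, equal ones are not. -/
theorem EDres_monomial_pairing (c b : Fin n →₀ ℕ) :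
    (b = c → EDres k n (XHom k n (monomial c 1) • pdHom k n (monomial b 1) • EDone k n) ≠ 0) ∧
    (b ≠ c → EDres k n (XHom k n (monomial c 1) • pdHom k n (monomial b 1) • EDone k n) = 0) := by
  have hmon : ∀ (c : Fin n →₀ ℕ) (i : Fin n), monomial (c + Finsupp.single i 1) (1 : k) =
      monomial c 1 * X i := by
    intro c i
    rw [X, monomial_mul, mul_one]
  have hone : monomial (0 : Fin n →₀ ℕ) (1 : k) = 1 := rfl
  induction hd : c.degree generalizing b c with
  | zero =>
    obtain rfl := (Finsupp.degree_eq_zero_iff c).1 hd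
    refine ⟨fun hb => ?_, fun hb => ?_⟩
    · rw [hb, hone, map_one, map_one, one_smul, one_smul, EDres_EDone]
      exact one_ne_zero
    · obtain ⟨b, i, rfl⟩ := Finsupp.exists_eq_add_single_of_ne_zero hb
      rw [hone, map_one, one_smul, hmon, mul_comm, map_mul, pdHom_X, mul_smul, EDres_pdDi_smul]
  | succ d ih =>
    have hc : c ≠ 0 := by rintro rfl; simp at hd
    obtain ⟨c, i, rfl⟩ := Finsupp.exists_eq_add_single_of_ne_zero hc
    have hstep : EDres k n (XHom k n (monomial (c + Finsupp.single i 1) 1) •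
        pdHom k n (monomial b 1) • EDone k n) = -((b i : k) *
        EDres k n (XHom k n (monomial c 1) •
          pdHom k n (monomial (b - Finsupp.single i 1) 1) • EDone k n)) := by
      have h1 : monomial (b - Finsupp.single i 1) (b i : k) =
          (b i : k) • monomial (b - Finsupp.single i 1) 1 := by
        rw [smul_monomial, smul_eq_mul, mul_one]
      rw [hmon, map_mul, XHom_X, mul_smul, XDi_smul_pdHom_smul_EDone, pderiv_monomial, one_mul,
        h1, map_smul (pdHom k n), smul_assoc, smul_neg, map_neg, smul_comm, map_smul, smul_eq_mul]
    obtain ⟨h1, h2⟩ := ih c (b - Finsupp.single i 1) (by simpa using hd)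
    rw [hstep]
    refine ⟨fun hb => ?_, fun hb => ?_⟩
    · subst hb
      refine neg_ne_zero.2 (mul_ne_zero ?_ (h1 (add_tsub_cancel_right _ _)))
      simp only [Finsupp.add_apply, Finsupp.single_eq_same]
      exact Nat.cast_ne_zero.2 (Nat.succ_ne_zero _)
    · by_cases hbi : b i = 0
      · rw [hbi, Nat.cast_zero, zero_mul, neg_zero]
      · rw [h2, mul_zero, neg_zero]
        intro h
        refine hb ?_
        rw [← h, tsub_add_cancel_of_le]
        simpa [Nat.one_le_iff_ne_zero] using hbi

/-- A functional on polynomials vanishing on almost all monomials is represented by `E_D`. -/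
theorem exists_EDres_eq (μ : MvPolynomial (Fin n) k →ₗ[k] k)
    (hμ : {b : Fin n →₀ ℕ | μ (monomial b 1) ≠ 0}.Finite) :
    ∃ e, ∀ p, EDres k n (XHom k n p • e) = μ p := by
  classical
  let κ := fun b => EDres k n (XHom k n (monomial b 1) • pdHom k n (monomial b 1) • EDone k n)
  refine ⟨∑ b ∈ hμ.toFinset, (μ (monomial b 1) / κ b) • pdHom k n (monomial b 1) • EDone k n,
    fun p => ?_⟩
  induction p using MvPolynomial.induction_on' with
  | monomial u a =>
    have h1 : monomial u a = a • monomial u (1 : k) := by rw [smul_monomial, smul_eq_mul, mul_one]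
    rw [h1, map_smul (XHom k n), smul_assoc, map_smul (EDres k n), map_smul μ,
       Finset.smul_sum, map_sum]
    congr 1
    rw [Finset.sum_eq_single u]
    · rw [smul_comm, map_smul, smul_eq_mul]
      exact div_mul_cancel₀ _ ((EDres_monomial_pairing u u).1 rfl)
    · intro b _ hb
      rw [smul_comm, map_smul, (EDres_monomial_pairing u b).2 hb, smul_zero]
    · intro hu
      have : μ (monomial u 1) = 0 := by simpa using hu
      rw [this, zero_div, zero_smul, smul_zero, map_zero]
  | add p q hp hq => rw [map_add, add_smul, map_add, hp, hq, map_add]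

theorem finite_setOf_EDres_ne_zero (e : EDcar k n) :
    {b : Fin n →₀ ℕ | EDres k n (XHom k n (monomial b 1) • e) ≠ 0}.Finite := by
  obtain ⟨p, rfl⟩ := exists_pdHom_smul_EDone e
  induction p using MvPolynomial.induction_on' with
  | monomial u a =>
    have h1 : monomial u a = a • monomial u (1 : k) := by rw [smul_monomial, smul_eq_mul, mul_one]
    refine (Set.finite_singleton u).subset fun b hb => ?_
    by_contra hc
    refine hb ?_
    rw [h1, map_smul (pdHom k n), smul_assoc, smul_comm, map_smul,
      (EDres_monomial_pairing b u).2 (Ne.symm hc), smul_zero]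
  | add p q hp hq =>
    refine (hp.union hq).subset fun b hb => ?_
    by_contra hc
    simp only [Set.mem_union, Set.mem_ofPred_eq, not_or, not_not] at hc
    exact hb (by rw [map_add, add_smul, smul_add, map_add, hc.1, hc.2, add_zero])

end

theorem EDres_comp_injective {k : Type} [Field k] [CharZero k] {n : ℕ} {M : Type}
    [AddCommGroup M] [Module (WeylN k n) M] (f g : M →ₗ[WeylN k n] EDcar k n)
    (h : ∀ m, EDres k n (f m) = EDres k n (g m)) : f = g := by
  ext m
  rw [← sub_eq_zero]
  refine eq_zero_of_EDres_eq_zero _ fun p => ?_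
  rw [smul_sub, map_sub, ← map_smul, ← map_smul, h, sub_self]

/-- The functionals on a `D`-module corresponding to its maps to `E_D`: those killing the images
of the `∂_i` and almost all monomial multiples of each element. -/
def EDfun (k : Type) [Field k] (n : ℕ) (M : Type) [AddCommGroup M] [Module k M]
    [Module (WeylN k n) M] : Submodule k (M →ₗ[k] k) where
  carrier := {l | (∀ i m, l (pdDi k n i • m) = 0) ∧
    ∀ m, {b : Fin n →₀ ℕ | l (XHom k n (monomial b 1) • m) ≠ 0}.Finite}
  zero_mem' := ⟨by simp, by simp⟩
  add_mem' := by
    rintro l l' ⟨h1, h2⟩ ⟨h3, h4⟩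
    refine ⟨fun i m => by simp [h1, h3], fun m => ((h2 m).union (h4 m)).subset ?_⟩
    intro b hb
    by_contra hc
    simp only [Set.mem_union, Set.mem_ofPred_eq, not_or, not_not] at hc
    exact hb (by simp [hc.1, hc.2])
  smul_mem' := by
    rintro c l ⟨h1, h2⟩
    refine ⟨fun i m => by simp [h1], fun m => (h2 m).subset ?_⟩
    intro b hb hc
    exact hb (by simp [hc])

section

variable {k : Type} [Field k] [CharZero k] {n : ℕ}
variable {M : Type} [AddCommGroup M] [Module k M] [Module (WeylN k n) M]
  [IsScalarTower k (WeylN k n) M]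

theorem EDres_comp_mem_EDfun (f : M →ₗ[WeylN k n] EDcar k n) :
    EDres k n ∘ₗ f.restrictScalars k ∈ EDfun k n M := by
  refine ⟨fun i m => ?_, fun m => ?_⟩
  · simp [EDres_pdDi_smul]
  · simpa using finite_setOf_EDres_ne_zero (f m)

theorem exists_EDres_comp_eq (l : M →ₗ[k] k) (hl : l ∈ EDfun k n M) :
    ∃ f : M →ₗ[WeylN k n] EDcar k n, ∀ m, EDres k n (f m) = l m := by
  have hex : ∀ m, ∃ e : EDcar k n, ∀ p, EDres k n (XHom k n p • e) = l (XHom k n p • m) := by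
    intro m
    refine exists_EDres_eq (l ∘ₗ (LinearMap.toSpanSingleton (WeylN k n) M m).restrictScalars k ∘ₗ
      (XHom k n).toLinearMap) ?_
    simpa using hl.2 m
  choose f hf using hex
  have huniq : ∀ m e, (∀ p, EDres k n (XHom k n p • e) = l (XHom k n p • m)) → e = f m := by
    intro m e he
    rw [← sub_eq_zero]
    refine eq_zero_of_EDres_eq_zero _ fun p => ?_
    rw [smul_sub, map_sub, he, hf, sub_self]
  have hadd : ∀ m m', f (m + m') = f m + f m' := fun m m' =>
    (huniq _ _ fun p => by rw [smul_add, map_add, hf, hf, smul_add, map_add]).symm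
  have hsmul : ∀ (c : k) m, f (c • m) = c • f m := fun c m => by
    refine (huniq _ _ fun p => ?_).symm
    rw [smul_comm, map_smul, hf, ← map_smul, ← algebraMap_smul (WeylN k n) c (_ • _),
      ← algebraMap_smul (WeylN k n) c m, smul_smul, smul_smul, Algebra.commutes]
  refine ⟨⟨⟨f, hadd⟩, fun d m => ?_⟩, fun m => by simpa using hf m 1⟩
  change f (d • m) = d • f m
  induction d using weyl_induction generalizing m with
  | h1 => rw [one_smul, one_smul]
  | hadd d e hd he => rw [add_smul, hadd, hd, he, add_smul]
  | hsmul c d hd => rw [smul_assoc, smul_assoc, ← hd, hsmul]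
  | hX i d hd =>
    rw [mul_smul, mul_smul, ← hd]
    refine (huniq _ _ fun p => ?_).symm
    rw [smul_smul, ← XHom_X, ← map_mul, hf, map_mul, mul_smul]
  | hpd i d hd =>
    rw [mul_smul, mul_smul, ← hd]
    refine (huniq _ _ fun p => ?_).symm
    rw [smul_smul, smul_smul, eq_sub_of_add_eq (pdDi_mul_XHom i p).symm, sub_smul, sub_smul,
      map_sub, map_sub, mul_smul, mul_smul, EDres_pdDi_smul, hl.1, hf]

end

/-- A grading of a `D`-module, encoded by the projections `p a` onto the part of degree `< a`. -/
structure WeylGrading (k : Type) [Field k] (n : ℕ) (M : Type) [AddCommGroup M] [Module k M]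
    [Module (WeylN k n) M] where
  p : ℤ → Module.End k M
  p_p : ∀ a b m, p a (p b m) = p (min a b) m
  p_X : ∀ a i m, p (a + 1) (XDi k n i • m) = XDi k n i • p a m
  p_pd : ∀ a i m, p a (pdDi k n i • m) = pdDi k n i • p (a + 1) m
  top : ∀ m, ∃ a, p a m = m
  bot : ∀ m, ∃ a, p a m = 0

namespace WeylGrading

section

variable {k : Type} [Field k] {n : ℕ} {M : Type} [AddCommGroup M] [Module k M]
  [Module (WeylN k n) M]

theorem p_eq_self_of_le (T : WeylGrading k n M) {a b : ℤ} (h : a ≤ b) {m : M} (hm : T.p a m = m) :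
    T.p b m = m := by
  nth_rw 1 [← hm]
  rw [T.p_p, min_eq_right h, hm]

theorem p_eq_zero_of_le (T : WeylGrading k n M) {a b : ℤ} (h : a ≤ b) {m : M} (hm : T.p b m = 0) :
    T.p a m = 0 := by
  rw [← min_eq_left h, ← T.p_p, hm, map_zero]

/-- The homogeneous elements of degree `l`. -/
def hom (T : WeylGrading k n M) (l : ℤ) : Set M := {m | ∀ a, T.p a m = if l < a then m else 0}

theorem sub_mem_hom (T : WeylGrading k n M) (l : ℤ) (m : M) :
    T.p (l + 1) m - T.p l m ∈ T.hom l := by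
  intro a
  rw [map_sub, T.p_p, T.p_p]
  split_ifs with h
  · rw [min_eq_right h, min_eq_right h.le]
  · rw [min_eq_left (by omega), min_eq_left (by omega), sub_self]

theorem span_hom (T : WeylGrading k n M) : Submodule.span (WeylN k n) (⋃ l, T.hom l) = ⊤ := by
  refine eq_top_iff.2 fun m _ => ?_
  obtain ⟨a, ha⟩ := T.top m
  obtain ⟨b, hb⟩ := T.bot m
  have key : ∀ t : ℕ, T.p (b + t) m ∈ Submodule.span (WeylN k n) (⋃ l, T.hom l) := by
    intro t
    induction t with
    | zero => simp [hb]
    | succ t ih =>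
      have h := add_mem (Submodule.subset_span (s := ⋃ l, T.hom l)
        (Set.mem_iUnion.2 ⟨_, T.sub_mem_hom (b + t) m⟩)) ih
      rw [sub_add_cancel] at h
      simpa [add_assoc] using h
  have h := key (a - b).toNat
  rwa [T.p_eq_self_of_le (by omega) ha] at h

theorem exists_generators [Module.Finite (WeylN k n) M] (T : WeylGrading k n M) :
    ∃ (ι : Type) (_ : Fintype ι) (v : ι → M) (d : ι → ℤ), (∀ i, v i ∈ T.hom (d i)) ∧
      Submodule.span (WeylN k n) (Set.range v) = ⊤ := by
  have hfg : (Submodule.span (WeylN k n) (⋃ l, T.hom l)).FG := by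
    rw [T.span_hom]
    exact Module.Finite.fg_top
  obtain ⟨s, hs, hspan⟩ := (Submodule.fg_span_iff_fg_span_finset_subset _).1 hfg
  choose d hd using fun i : s => Set.mem_iUnion.1 (hs i.2)
  refine ⟨s, inferInstance, Subtype.val, d, hd, ?_⟩
  rw [← T.span_hom, hspan]
  simp

/-- The grading of the kernel of a degree-preserving map. -/
def ker [IsScalarTower k (WeylN k n) M] {N : Type} [AddCommGroup N] [Module k N]
    [Module (WeylN k n) N] [IsScalarTower k (WeylN k n) N] (T : WeylGrading k n M)
    (S : WeylGrading k n N)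
    (f : M →ₗ[WeylN k n] N) (hf : ∀ a m, f (T.p a m) = S.p a (f m)) :
    WeylGrading k n (LinearMap.ker f) where
  p a :=
    { toFun := fun x => ⟨T.p a x, by simp [hf]⟩
      map_add' := fun x y => Subtype.ext (map_add _ _ _)
      map_smul' := fun c x => Subtype.ext (map_smul (T.p a) c (x : M)) }
  p_p a b m := Subtype.ext (T.p_p a b m)
  p_X a i m := Subtype.ext (T.p_X a i m)
  p_pd a i m := Subtype.ext (T.p_pd a i m)
  top m := (T.top m).imp fun _ h => Subtype.ext h
  bot m := (T.bot m).imp fun _ h => Subtype.ext h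

/-- The grading shifted by `c`. -/
def shift (T : WeylGrading k n M) (c : ℤ) : WeylGrading k n M where
  p a := T.p (a - c)
  p_p a b m := by rw [T.p_p, min_sub_sub_right]
  p_X a i m := by rw [← T.p_X]; congr 2; ring
  p_pd a i m := by rw [T.p_pd]; congr 3; ring
  top m := by
    obtain ⟨a, ha⟩ := T.top m
    exact ⟨a + c, by rwa [add_sub_cancel_right]⟩
  bot m := by
    obtain ⟨a, ha⟩ := T.bot m
    exact ⟨a + c, by rwa [add_sub_cancel_right]⟩

/-- The grading of a finite product. -/
def pi {ι : Type} [Fintype ι] (T : ι → WeylGrading k n M) : WeylGrading k n (ι → M) where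
  p a := LinearMap.pi fun i => (T i).p a ∘ₗ LinearMap.proj i
  p_p a b m := funext fun i => (T i).p_p a b (m i)
  p_X a j m := funext fun i => (T i).p_X a j (m i)
  p_pd a j m := funext fun i => (T i).p_pd a j (m i)
  top m := by
    choose a ha using fun i => (T i).top (m i)
    obtain ⟨b, hb⟩ := (Set.finite_range a).bddAbove
    exact ⟨b, funext fun i => (T i).p_eq_self_of_le (hb ⟨i, rfl⟩) (ha i)⟩
  bot m := by
    choose a ha using fun i => (T i).bot (m i)
    obtain ⟨b, hb⟩ := (Set.finite_range a).bddBelow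
    exact ⟨b, funext fun i => (T i).p_eq_zero_of_le (hb ⟨i, rfl⟩) (ha i)⟩

/-- A grading defined by a homogeneous spanning family. -/
def ofSpan [IsScalarTower k (WeylN k n) M] {ι : Type} (b : ι → M) (wt : ι → ℤ)
    (p : ℤ → Module.End k M) (hspan : Submodule.span k (Set.range b) = ⊤)
    (hb : ∀ s a, p a (b s) = if wt s < a then b s else 0)
    (hX : ∀ i s a, p a (XDi k n i • b s) = if wt s + 1 < a then XDi k n i • b s else 0)
    (hpd : ∀ i s a, p a (pdDi k n i • b s) = if wt s - 1 < a then pdDi k n i • b s else 0) :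
    WeylGrading k n M :=
  have hp : ∀ a c m, p a (p c m) = p (min a c) m := by
    intro a c m
    have hm : m ∈ Submodule.span k (Set.range b) := hspan ▸ Submodule.mem_top
    induction hm using Submodule.span_induction with
    | mem m hm =>
      obtain ⟨s, rfl⟩ := hm
      rw [hb, hb]
      split_ifs <;> first | rfl | (exfalso; omega) | simp_all
    | zero => simp
    | add x y _ _ hx hy => simp [hx, hy]
    | smul c x _ hx => simp [hx]
  { p := p
    p_p := hp
    p_X := fun a i m => by
      have hm : m ∈ Submodule.span k (Set.range b) := hspan ▸ Submodule.mem_top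
      induction hm using Submodule.span_induction with
      | mem m hm =>
        obtain ⟨s, rfl⟩ := hm
        rw [hb, hX]
        simp only [add_lt_add_iff_right]
        split_ifs <;> simp
      | zero => simp
      | add x y _ _ hx hy => simp [hx, hy]
      | smul c x _ hx => rw [smul_comm, map_smul, hx, map_smul, smul_comm]
    p_pd := fun a i m => by
      have hm : m ∈ Submodule.span k (Set.range b) := hspan ▸ Submodule.mem_top
      induction hm using Submodule.span_induction with
      | mem m hm =>
        obtain ⟨s, rfl⟩ := hm
        rw [hb, hpd]
        simp only [sub_lt_iff_lt_add]
        split_ifs <;> simp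
      | zero => simp
      | add x y _ _ hx hy => simp [hx, hy]
      | smul c x _ hx => rw [smul_comm, map_smul, hx, map_smul, smul_comm]
    top := fun m => by
      have hm : m ∈ Submodule.span k (Set.range b) := hspan ▸ Submodule.mem_top
      have hmono : ∀ m a c, a ≤ c → p a m = m → p c m = m := by
        intro m a c hac h
        rw [← h, hp, min_eq_right hac]
      induction hm using Submodule.span_induction with
      | mem m hm =>
        obtain ⟨s, rfl⟩ := hm
        exact ⟨wt s + 1, by simp [hb]⟩
      | zero => exact ⟨0, map_zero _⟩
      | add x y _ _ hx hy =>
        obtain ⟨a, ha⟩ := hx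
        obtain ⟨c, hc⟩ := hy
        exact ⟨max a c, by rw [map_add, hmono x a _ (le_max_left _ _) ha,
          hmono y c _ (le_max_right _ _) hc]⟩
      | smul c x _ hx =>
        obtain ⟨a, ha⟩ := hx
        exact ⟨a, by rw [map_smul, ha]⟩
    bot := fun m => by
      have hm : m ∈ Submodule.span k (Set.range b) := hspan ▸ Submodule.mem_top
      have hmono : ∀ m a c, a ≤ c → p c m = 0 → p a m = 0 := by
        intro m a c hac h
        rw [← min_eq_left hac, ← hp, h, map_zero]
      induction hm using Submodule.span_induction with
      | mem m hm =>
        obtain ⟨s, rfl⟩ := hm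
        exact ⟨wt s, by simp [hb]⟩
      | zero => exact ⟨0, map_zero _⟩
      | add x y _ _ hx hy =>
        obtain ⟨a, ha⟩ := hx
        obtain ⟨c, hc⟩ := hy
        exact ⟨min a c, by rw [map_add, hmono x _ _ (min_le_left _ _) ha,
          hmono y _ _ (min_le_right _ _) hc, add_zero]⟩
      | smul c x _ hx =>
        obtain ⟨a, ha⟩ := hx
        exact ⟨a, by rw [map_smul, ha, smul_zero]⟩ }

theorem nonempty_of_isInternal [IsScalarTower k (WeylN k n) M] (deg : ℤ → Submodule k M)
    (hint : DirectSum.IsInternal deg)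
    (hX : ∀ (i : Fin n) (l : ℤ), ∀ m ∈ deg l, XDi k n i • m ∈ deg (l + 1))
    (hpd : ∀ (i : Fin n) (l : ℤ), ∀ m ∈ deg l, pdDi k n i • m ∈ deg (l - 1)) :
    Nonempty (WeylGrading k n M) := by
  let e := LinearEquiv.ofBijective (DirectSum.coeLinearMap deg) hint
  let p : ℤ → Module.End k M := fun a => DirectSum.toModule k ℤ M
    (fun l => if l < a then (deg l).subtype else 0) ∘ₗ e.symm.toLinearMap
  have hp : ∀ l m, m ∈ deg l → ∀ a, p a m = if l < a then m else 0 := by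
    intro l m hm a
    have h1 : e (DirectSum.lof k ℤ (fun l => ↥(deg l)) l ⟨m, hm⟩) = m :=
      DirectSum.coeLinearMap_lof deg l ⟨m, hm⟩
    change DirectSum.toModule k ℤ M _ (e.symm m) = _
    rw [(LinearEquiv.symm_apply_eq e).2 h1.symm, DirectSum.toModule_lof]
    split_ifs <;> simp
  refine ⟨ofSpan (ι := Σ l, deg l) (fun s => s.2) (fun s => s.1) p ?_
    (fun s a => hp _ _ s.2.2 a) (fun i s a => hp _ _ (hX i _ _ s.2.2) a)
    (fun i s a => hp _ _ (hpd i _ _ s.2.2) a)⟩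
  rw [eq_top_iff, ← hint.submodule_iSup_eq_top]
  exact iSup_le fun l m hm => Submodule.subset_span ⟨⟨l, m, hm⟩, rfl⟩

end

end WeylGrading

/-- The degree of `ξ^b y^a`, where `ξ` stands for `∂` and `y` for `x`. -/
def weylWeight {n : ℕ} (s : Fin n ⊕ Fin n →₀ ℕ) : ℤ :=
  ∑ i, (s (Sum.inr i) : ℤ) - ∑ i, (s (Sum.inl i) : ℤ)

section

variable {n : ℕ}

theorem weylWeight_zero : weylWeight (0 : Fin n ⊕ Fin n →₀ ℕ) = 0 := by simp [weylWeight]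

theorem weylWeight_add (s t : Fin n ⊕ Fin n →₀ ℕ) :
    weylWeight (s + t) = weylWeight s + weylWeight t := by
  simp only [weylWeight, Finsupp.add_apply, Nat.cast_add, Finset.sum_add_distrib]
  ring

theorem weylWeight_single_inl (i : Fin n) : weylWeight (Finsupp.single (Sum.inl i) 1) = -1 := by
  classical
  simp [weylWeight, Finsupp.single_apply]

theorem weylWeight_single_inr (i : Fin n) : weylWeight (Finsupp.single (Sum.inr i) 1) = 1 := by
  classical
  simp [weylWeight, Finsupp.single_apply]

variable {k : Type} [Field k]

/-- The part of weight `< a` of a symbol. -/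
noncomputable def symbolTrunc (k : Type) [Field k] (n : ℕ) (a : ℤ) :
    Module.End k (MvPolynomial (Fin n ⊕ Fin n) k) :=
  (basisMonomials (Fin n ⊕ Fin n) k).constr k fun s =>
    if weylWeight s < a then monomial s 1 else 0

theorem symbolTrunc_monomial (a : ℤ) (s : Fin n ⊕ Fin n →₀ ℕ) (c : k) :
    symbolTrunc k n a (monomial s c) = if weylWeight s < a then monomial s c else 0 := by
  have h1 : monomial s c = c • monomial s (1 : k) := by rw [smul_monomial, smul_eq_mul, mul_one]
  have h2 := (basisMonomials (Fin n ⊕ Fin n) k).constr_basis k (fun s =>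
    if weylWeight s < a then monomial s (1 : k) else 0) s
  rw [coe_basisMonomials] at h2
  rw [h1, map_smul, symbolTrunc, h2]
  split_ifs <;> simp

theorem exists_eq_sum_pdDi_mul_add (d : WeylN k n) :
    ∃ (e : Fin n → WeylN k n) (r : MvPolynomial (Fin n) k),
      d = ∑ j, pdDi k n j * e j + XHom k n r := by
  obtain ⟨q, rfl⟩ := normalOrder_surjective d
  induction q using MvPolynomial.induction_on with
  | C c => exact ⟨0, C c, by
      rw [normalOrder_C, C_eq_smul_one, map_smul, map_one]
      simp⟩
  | add p q hp hq =>
    obtain ⟨e, r, h⟩ := hp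
    obtain ⟨e', r', h'⟩ := hq
    refine ⟨e + e', r + r', ?_⟩
    simp only [map_add, h, h', Pi.add_apply, mul_add, Finset.sum_add_distrib]
    abel
  | mul_X p s hp =>
    obtain ⟨e, r, h⟩ := hp
    rw [mul_comm]
    rcases s with j | j
    · rw [normalOrder_X_inl_mul]
      refine ⟨Pi.single j (normalOrder k n p), 0, ?_⟩
      rw [map_zero, add_zero, Finset.sum_eq_single j, Pi.single_eq_same]
      · intro b _ hb
        rw [Pi.single_eq_of_ne hb, mul_zero]
      · simp
    · rw [normalOrder_X_inr_mul, h]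
      refine ⟨fun i => e i * XDi k n j, r * X j, ?_⟩
      rw [map_mul, XHom_X, add_mul, Finset.sum_mul]
      simp only [mul_assoc]

end

section

variable {k : Type} [Field k] [CharZero k] {n : ℕ}

/-- The grading of the Weyl algebra. -/
noncomputable def weylGrading (k : Type) [Field k] [CharZero k] (n : ℕ) :
    WeylGrading k n (WeylN k n) :=
  WeylGrading.ofSpan (ι := Fin n ⊕ Fin n →₀ ℕ) (fun s => normalOrderEquiv k n (monomial s 1))
    weylWeight
    (fun a => (normalOrderEquiv k n).toLinearMap ∘ₗ symbolTrunc k n a ∘ₗ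
      (normalOrderEquiv k n).symm.toLinearMap)
    (by
      have h := (basisMonomials (Fin n ⊕ Fin n) k).span_eq
      rw [coe_basisMonomials] at h
      change Submodule.span k (Set.range ((normalOrderEquiv k n).toLinearMap ∘ _)) = ⊤
      rw [Set.range_comp, ← Submodule.map_span, h, Submodule.map_top, LinearMap.range_eq_top]
      exact (normalOrderEquiv k n).surjective)
    (fun s a => by
      simp only [LinearMap.comp_apply, LinearEquiv.coe_coe, LinearEquiv.symm_apply_apply,
        symbolTrunc_monomial]
      split_ifs <;> simp)
    (fun i s a => by
      simp only [LinearMap.comp_apply, LinearEquiv.coe_coe, smul_eq_mul]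
      have h : XDi k n i * normalOrderEquiv k n (monomial s 1) = normalOrderEquiv k n
          (monomial (Finsupp.single (Sum.inr i) 1 + s) 1 -
            monomial (s - Finsupp.single (Sum.inl i) 1) (s (Sum.inl i) : k)) := by
        rw [normalOrderEquiv_apply, normalOrderEquiv_apply, XDi_mul_normalOrder, X, monomial_mul,
          pderiv_monomial, mul_one, one_mul]
      rw [h, LinearEquiv.symm_apply_apply, map_sub, symbolTrunc_monomial, symbolTrunc_monomial,
        weylWeight_add, weylWeight_single_inr, add_comm 1]
      by_cases hs : s (Sum.inl i) = 0
      · rw [hs, Nat.cast_zero, map_zero]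
        split_ifs <;> simp
      · have h2 : weylWeight (s - Finsupp.single (Sum.inl i) 1) = weylWeight s + 1 := by
          have h3 : s - Finsupp.single (Sum.inl i) 1 + Finsupp.single (Sum.inl i) 1 = s :=
            tsub_add_cancel_of_le (by simpa [Nat.one_le_iff_ne_zero] using hs)
          have h4 := congrArg weylWeight h3
          rw [weylWeight_add, weylWeight_single_inl] at h4
          omega
        rw [h2]
        split_ifs <;> simp)
    (fun i s a => by
      simp only [LinearMap.comp_apply, LinearEquiv.coe_coe, smul_eq_mul]
      have h : pdDi k n i * normalOrderEquiv k n (monomial s 1) = normalOrderEquiv k n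
          (monomial (Finsupp.single (Sum.inl i) 1 + s) 1) := by
        rw [normalOrderEquiv_apply, normalOrderEquiv_apply, ← normalOrder_X_inl_mul, X,
          monomial_mul, mul_one]
      rw [h, LinearEquiv.symm_apply_apply, symbolTrunc_monomial, weylWeight_add,
        weylWeight_single_inl, add_comm, ← sub_eq_add_neg]
      split_ifs <;> simp)

theorem weylGrading_p_one (a : ℤ) :
    (weylGrading k n).p a 1 = if 0 < a then 1 else 0 := by
  have h1 : (1 : WeylN k n) = normalOrderEquiv k n (monomial 0 1) :=
    (normalOrder_one (k := k) (n := n)).symm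
  change normalOrderEquiv k n (symbolTrunc k n a ((normalOrderEquiv k n).symm 1)) = _
  rw [h1, LinearEquiv.symm_apply_apply, symbolTrunc_monomial, weylWeight_zero]
  split_ifs <;> simp

end

namespace WeylGrading

section

variable {k : Type} [Field k] {n : ℕ} {M : Type} [AddCommGroup M] [Module k M]
  [Module (WeylN k n) M]

theorem p_XHom_monomial_smul (T : WeylGrading k n M) (a : ℤ) (b : Fin n →₀ ℕ) (m : M) :
    T.p (a + b.degree) (XHom k n (monomial b 1) • m) = XHom k n (monomial b 1) • T.p a m := by
  induction hd : b.degree generalizing b m with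
  | zero =>
    obtain rfl := (Finsupp.degree_eq_zero_iff b).1 hd
    have hone : monomial (0 : Fin n →₀ ℕ) (1 : k) = 1 := rfl
    simp [hone]
  | succ d ih =>
    have hb : b ≠ 0 := by rintro rfl; simp at hd
    obtain ⟨b, i, rfl⟩ := Finsupp.exists_eq_add_single_of_ne_zero hb
    have hmon : monomial (b + Finsupp.single i 1) (1 : k) = X i * monomial b 1 := by
      rw [X, monomial_mul, mul_one, add_comm]
    rw [hmon, map_mul, XHom_X, mul_smul, mul_smul, ← ih b m (by simpa using hd), ← T.p_X]
    push_cast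
    rw [add_assoc]

theorem mem_EDfun_of_p (T : WeylGrading k n M) (l : M →ₗ[k] k)
    (hl : ∀ i m, l (pdDi k n i • m) = 0) (N : ℤ) (hN : ∀ m, l (T.p N m) = l m) :
    l ∈ EDfun k n M := by
  refine ⟨hl, fun m => ?_⟩
  obtain ⟨c, hc⟩ := T.bot m
  refine (Finsupp.finite_of_degree_le (N - c).toNat).subset fun b hb => ?_
  by_contra hlt
  refine hb ?_
  rw [← hN, T.p_eq_zero_of_le (b := c + b.degree) _ (by rw [T.p_XHom_monomial_smul, hc, smul_zero]),
    map_zero]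
  simp only [Set.mem_ofPred_eq, not_le] at hlt
  omega

theorem exists_p_of_mem_EDfun [CharZero k] [IsScalarTower k (WeylN k n) M]
    [Module.Finite (WeylN k n) M] (T : WeylGrading k n M)
    (l : M →ₗ[k] k) (hl : l ∈ EDfun k n M) : ∃ N, ∀ m, l (T.p N m) = l m := by
  obtain ⟨ι, _, v, d, hv, hspan⟩ := T.exists_generators
  have hB : ∀ i, ∃ B : ℤ, ∀ b : Fin n →₀ ℕ, B ≤ b.degree + d i →
      l (XHom k n (monomial b 1) • v i) = 0 := by
    intro i
    obtain ⟨B, hB⟩ := ((hl.2 (v i)).image fun b => (b.degree : ℤ) + d i).bddAbove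
    refine ⟨B + 1, fun b hb => ?_⟩
    by_contra hne
    have := hB ⟨b, hne, rfl⟩
    simp only at this
    omega
  choose B hB using hB
  obtain ⟨N, hN⟩ := (Set.finite_range B).bddAbove
  refine ⟨N, fun m => ?_⟩
  have hm : m ∈ Submodule.span (WeylN k n) (Set.range v) := hspan ▸ Submodule.mem_top
  obtain ⟨c, rfl⟩ := (Submodule.mem_span_range_iff_exists_fun _).1 hm
  rw [map_sum, map_sum, map_sum]
  refine Finset.sum_congr rfl fun i _ => ?_
  obtain ⟨e, r, he⟩ := exists_eq_sum_pdDi_mul_add (c i)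
  rw [he, add_smul, Finset.sum_smul, map_add, map_add, map_add, map_sum, map_sum, map_sum]
  congr 1
  · refine Finset.sum_congr rfl fun j _ => ?_
    rw [mul_smul, T.p_pd, hl.1, hl.1]
  · clear he
    induction r using MvPolynomial.induction_on' with
    | monomial u a =>
      have h1 : monomial u a = a • monomial u (1 : k) := by
        rw [smul_monomial, smul_eq_mul, mul_one]
      rw [h1, map_smul (XHom k n), smul_assoc, map_smul (T.p N), map_smul l, map_smul l]
      congr 1
      have h2 := T.p_XHom_monomial_smul (N - u.degree) u (v i)
      rw [sub_add_cancel, hv i] at h2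
      rw [h2]
      split_ifs with h
      · rfl
      · rw [smul_zero, map_zero, hB i u]
        exact (hN ⟨i, rfl⟩).trans (by omega)
    | add p q hp hq => rw [map_add, add_smul, map_add, map_add, map_add, hp, hq]

theorem p_smul_of_mem_hom [CharZero k] [IsScalarTower k (WeylN k n) M] (T : WeylGrading k n M)
    {l : ℤ} {v : M} (hv : v ∈ T.hom l) (a : ℤ) (d : WeylN k n) :
    (weylGrading k n).p (a - l) d • v = T.p a (d • v) := by
  induction d using weyl_induction generalizing a with
  | h1 =>
    rw [weylGrading_p_one, one_smul, hv a]
    simp only [sub_pos]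
    split_ifs <;> simp
  | hadd d e hd he => rw [map_add, add_smul, add_smul, map_add, hd, he]
  | hsmul c d hd => rw [map_smul, smul_assoc, smul_assoc, map_smul, hd]
  | hX i d hd =>
    obtain ⟨a, rfl⟩ : ∃ b, a = b + 1 := ⟨a - 1, by ring⟩
    rw [mul_smul, T.p_X, ← hd, ← mul_smul, ← smul_eq_mul (a := XDi k n i),
      ← smul_eq_mul (a := XDi k n i), ← (weylGrading k n).p_X]
    congr 3
    ring
  | hpd i d hd =>
    rw [mul_smul, T.p_pd, ← hd, ← mul_smul, ← smul_eq_mul (a := pdDi k n i),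
      ← smul_eq_mul (a := pdDi k n i), (weylGrading k n).p_pd]
    congr 4
    ring

end

end WeylGrading

section

variable {n : ℕ}

/-- The sign `e_j ∧ e_{t ∖ j} = ± e_t` (for `j ∈ t`). -/
def wedgeSign (t : Finset (Fin n)) (j : Fin n) : ℤ := (-1) ^ (t.filter (fun a => a < j)).card

theorem wedgeSign_mul_self (t : Finset (Fin n)) (j : Fin n) :
    wedgeSign t j * wedgeSign t j = 1 := by
  rw [wedgeSign, ← pow_add, ← two_mul, pow_mul, neg_one_sq, one_pow]

theorem wedgeSign_insert (t : Finset (Fin n)) (i j : Fin n) (hi : i ∉ t) :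
    wedgeSign (insert i t) j = if i < j then -wedgeSign t j else wedgeSign t j := by
  rw [wedgeSign, Finset.filter_insert]
  split_ifs
  · rw [Finset.card_insert_of_notMem (by simp [hi]), pow_succ, mul_neg_one, wedgeSign]
  · rfl

theorem wedgeSign_erase (t : Finset (Fin n)) (i j : Fin n) (hi : i ∈ t) :
    wedgeSign (t.erase i) j = if i < j then -wedgeSign t j else wedgeSign t j := by
  conv_rhs => rw [← Finset.insert_erase hi, wedgeSign_insert _ _ _ (Finset.notMem_erase i t)]
  split_ifs <;> simp

variable {k : Type} [Field k] {M : Type} [AddCommGroup M] [Module k M]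

/-- Left wedge multiplication by `e_j` on `M ⊗ Λ(k^n)`. -/
def wedge (k : Type) [Field k] (M : Type) [AddCommGroup M] [Module k M] (j : Fin n) :
    Module.End k (Finset (Fin n) → M) where
  toFun ω t := if j ∈ t then wedgeSign t j • ω (t.erase j) else 0
  map_add' ω ω' := by
    ext t
    simp only [Pi.add_apply]
    split_ifs <;> simp
  map_smul' c ω := by
    ext t
    simp only [Pi.smul_apply, RingHom.id_apply]
    split_ifs
    · exact smul_comm _ _ _
    · exact (smul_zero c).symm

/-- Contraction with `e_j` on `M ⊗ Λ(k^n)`. -/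
def contract (k : Type) [Field k] (M : Type) [AddCommGroup M] [Module k M] (j : Fin n) :
    Module.End k (Finset (Fin n) → M) where
  toFun ω t := if j ∈ t then 0 else wedgeSign t j • ω (insert j t)
  map_add' ω ω' := by
    ext t
    simp only [Pi.add_apply]
    split_ifs <;> simp
  map_smul' c ω := by
    ext t
    simp only [Pi.smul_apply, RingHom.id_apply]
    split_ifs
    · exact (smul_zero c).symm
    · exact smul_comm _ _ _

theorem wedge_apply (j : Fin n) (ω : Finset (Fin n) → M) (t : Finset (Fin n)) :
    wedge k M j ω t = if j ∈ t then wedgeSign t j • ω (t.erase j) else 0 := rfl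

theorem contract_apply (j : Fin n) (ω : Finset (Fin n) → M) (t : Finset (Fin n)) :
    contract k M j ω t = if j ∈ t then 0 else wedgeSign t j • ω (insert j t) := rfl

theorem wedge_mul_self (j : Fin n) : wedge k M j * wedge k M j = 0 := by
  refine LinearMap.ext fun ω => funext fun t => ?_
  simp [wedge_apply]

theorem wedge_mul_wedge_add (i j : Fin n) :
    wedge k M i * wedge k M j + wedge k M j * wedge k M i = 0 := by
  rcases eq_or_ne i j with rfl | hij
  · rw [wedge_mul_self, add_zero]
  refine LinearMap.ext fun ω => funext fun t => ?_
  simp only [LinearMap.add_apply, Module.End.mul_apply, Pi.add_apply, wedge_apply,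
    Finset.mem_erase, LinearMap.zero_apply, Pi.zero_apply]
  by_cases hi : i ∈ t <;> by_cases hj : j ∈ t
  · rw [if_pos hi, if_pos ⟨hij.symm, hj⟩, if_pos hj, if_pos ⟨hij, hi⟩, wedgeSign_erase _ _ _ hi,
      wedgeSign_erase _ _ _ hj, Finset.erase_right_comm, smul_smul, smul_smul, ← add_smul]
    convert zero_smul ℤ _
    rcases lt_or_gt_of_ne hij with h | h
    · rw [if_pos h, if_neg h.not_gt]; ring
    · rw [if_neg h.not_gt, if_pos h]; ring
  all_goals simp [hi, hj]

theorem wedge_mul_contract_add (i j : Fin n) :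
    wedge k M i * contract k M j + contract k M j * wedge k M i = if i = j then 1 else 0 := by
  refine LinearMap.ext fun ω => funext fun t => ?_
  simp only [LinearMap.add_apply, Module.End.mul_apply, Pi.add_apply, wedge_apply, contract_apply,
    Finset.mem_erase, Finset.mem_insert]
  rcases eq_or_ne i j with rfl | hij
  · by_cases hi : i ∈ t
    · simp [hi, wedgeSign_erase, smul_smul, wedgeSign_mul_self]
    · simp [hi, wedgeSign_insert, smul_smul, wedgeSign_mul_self]
  · rw [if_neg hij, LinearMap.zero_apply, Pi.zero_apply]
    by_cases hi : i ∈ t <;> by_cases hj : j ∈ t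
    · simp [hi, hj, hij.symm]
    · have h1 : (insert j t).erase i = insert j (t.erase i) :=
        Finset.erase_insert_of_ne hij.symm
      rw [if_pos hi, if_neg (by simp [hj]), if_neg hj, if_pos (Or.inr hi), h1,
        wedgeSign_erase _ _ _ hi, wedgeSign_insert _ _ _ hj, smul_smul, smul_smul, ← add_smul]
      convert zero_smul ℤ _
      rcases lt_or_gt_of_ne hij with h | h
      · rw [if_pos h, if_neg h.not_gt]; ring
      · rw [if_neg h.not_gt, if_pos h]; ring
    · simp [hi, hj]
    · simp [hi, hj, hij]

/-- An endomorphism of `M` acting on `M ⊗ Λ(k^n)`. -/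
def pointwise (n : ℕ) (T : Module.End k M) : Module.End k (Finset (Fin n) → M) :=
  T.compLeft (Finset (Fin n))

theorem pointwise_apply (T : Module.End k M) (ω : Finset (Fin n) → M) (t : Finset (Fin n)) :
    pointwise n T ω t = T (ω t) := rfl

theorem pointwise_mul (S T : Module.End k M) :
    pointwise n (S * T) = pointwise n S * pointwise n T := rfl

theorem pointwise_mul_wedge (T : Module.End k M) (j : Fin n) :
    pointwise n T * wedge k M j = wedge k M j * pointwise n T := by
  refine LinearMap.ext fun ω => funext fun t => ?_
  simp only [Module.End.mul_apply, pointwise_apply, wedge_apply]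
  split_ifs <;> simp

theorem pointwise_mul_contract (T : Module.End k M) (j : Fin n) :
    pointwise n T * contract k M j = contract k M j * pointwise n T := by
  refine LinearMap.ext fun ω => funext fun t => ?_
  simp only [Module.End.mul_apply, pointwise_apply, contract_apply]
  split_ifs <;> simp

/-- The de Rham differential on `M ⊗ Λ(k^n)`. -/
def deRhamTotal (pd : Fin n → Module.End k M) : Module.End k (Finset (Fin n) → M) :=
  ∑ j, pointwise n (pd j) * wedge k M j

theorem deRhamTotal_apply (pd : Fin n → Module.End k M) (ω : Finset (Fin n) → M)
    (t : Finset (Fin n)) :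
    deRhamTotal pd ω t = ∑ j ∈ t, wedgeSign t j • pd j (ω (t.erase j)) := by
  rw [deRhamTotal, LinearMap.sum_apply, Finset.sum_apply]
  simp only [Module.End.mul_apply, pointwise_apply, wedge_apply, apply_ite (pd _), map_zero,
    map_zsmul]
  rw [← Finset.sum_filter, Finset.filter_univ_mem]

theorem deRhamTotal_mul_self [CharZero k] (pd : Fin n → Module.End k M)
    (hpd : ∀ i j, Commute (pd i) (pd j)) :
    deRhamTotal pd * deRhamTotal pd = 0 := by
  have h1 : deRhamTotal pd * deRhamTotal pd =
      ∑ i, ∑ j, pointwise n (pd i * pd j) * (wedge k M i * wedge k M j) := by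
    rw [deRhamTotal, Finset.sum_mul_sum]
    refine Finset.sum_congr rfl fun i _ => Finset.sum_congr rfl fun j _ => ?_
    rw [pointwise_mul, mul_assoc, ← mul_assoc (wedge k M i), ← pointwise_mul_wedge]
    simp only [mul_assoc]
  have h2 : deRhamTotal pd * deRhamTotal pd =
      -∑ i, ∑ j, pointwise n (pd i * pd j) * (wedge k M i * wedge k M j) := by
    conv_lhs => rw [h1, Finset.sum_comm]
    rw [← Finset.sum_neg_distrib]
    refine Finset.sum_congr rfl fun i _ => ?_
    rw [← Finset.sum_neg_distrib]
    refine Finset.sum_congr rfl fun j _ => ?_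
    have h : wedge k M j * wedge k M i = -(wedge k M i * wedge k M j) := by
      rw [← add_eq_zero_iff_eq_neg]
      exact wedge_mul_wedge_add j i
    rw [(hpd j i).eq, h]
    exact mul_neg (pointwise n (pd i * pd j)) (wedge k M i * wedge k M j)
  rw [← h1] at h2
  have h3 : (2 : k) • (deRhamTotal pd * deRhamTotal pd) = 0 := by
    rw [two_smul]
    exact eq_neg_iff_add_eq_zero.1 h2
  exact (smul_eq_zero.1 h3).resolve_left two_ne_zero

theorem sum_contract_mul_wedge_apply (ω : Finset (Fin n) → M) (t : Finset (Fin n)) :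
    (∑ j, contract k M j * wedge k M j) ω t = (n - t.card) • ω t := by
  rw [LinearMap.sum_apply, Finset.sum_apply]
  have h : ∀ j, (contract k M j * wedge k M j) ω t = if j ∈ tᶜ then ω t else 0 := by
    intro j
    rw [Module.End.mul_apply, contract_apply, wedge_apply]
    by_cases hj : j ∈ t
    · simp [hj]
    · simp [hj, wedgeSign_insert, smul_smul, wedgeSign_mul_self]
  simp only [h]
  rw [← Finset.sum_filter, Finset.filter_univ_mem, Finset.sum_const, Finset.card_compl,
    Fintype.card_fin]

/-- The Koszul homotopy. -/
def koszulHomotopy (A : Fin n → Module.End k M) : Module.End k (Finset (Fin n) → M) :=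
  ∑ j, pointwise n (A j) * contract k M j

theorem deRhamTotal_homotopy (L A : Fin n → Module.End k M)
    (hAL : ∀ i j, A i * L j = L j * A i + if i = j then 1 else 0) :
    deRhamTotal L * koszulHomotopy A + koszulHomotopy A * deRhamTotal L =
      pointwise n (∑ j, L j * A j) + ∑ j, contract k M j * wedge k M j := by
  have h1 : deRhamTotal L * koszulHomotopy A =
      ∑ i, ∑ j, pointwise n (L i * A j) * (wedge k M i * contract k M j) := by
    rw [deRhamTotal, koszulHomotopy, Finset.sum_mul_sum]
    refine Finset.sum_congr rfl fun i _ => Finset.sum_congr rfl fun j _ => ?_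
    rw [pointwise_mul, mul_assoc, ← mul_assoc (wedge k M i), ← pointwise_mul_wedge]
    simp only [mul_assoc]
  have h2 : koszulHomotopy A * deRhamTotal L =
      ∑ i, ∑ j, pointwise n (A j * L i) * (contract k M j * wedge k M i) := by
    rw [deRhamTotal, koszulHomotopy, Finset.sum_mul_sum, Finset.sum_comm]
    refine Finset.sum_congr rfl fun i _ => Finset.sum_congr rfl fun j _ => ?_
    rw [pointwise_mul, mul_assoc, ← mul_assoc (contract k M j), ← pointwise_mul_contract]
    simp only [mul_assoc]
  have h3 : ∀ i j, pointwise n (L i * A j) * (wedge k M i * contract k M j) +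
      pointwise n (A j * L i) * (contract k M j * wedge k M i) =
      if j = i then pointwise n (L i * A i) + contract k M i * wedge k M i else 0 := by
    intro i j
    have h4 : wedge k M i * contract k M j = (if i = j then 1 else 0) -
        contract k M j * wedge k M i := eq_sub_of_add_eq (wedge_mul_contract_add i j)
    have h5 : pointwise n (A j * L i) = pointwise n (L i * A j) + if j = i then 1 else 0 := by
      rw [hAL]
      split_ifs <;> rfl
    have hring : ∀ P Q : Module.End k (Finset (Fin n) → M), P * (1 - Q) + (P + 1) * Q = P + Q := by
      intro P Q
      rw [mul_sub, add_mul, mul_one, one_mul]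
      abel
    have hring' : ∀ P Q : Module.End k (Finset (Fin n) → M), P * (0 - Q) + (P + 0) * Q = 0 := by
      intro P Q
      rw [mul_sub, add_zero, mul_zero, zero_sub, neg_add_cancel]
    rw [h4, h5]
    rcases eq_or_ne j i with rfl | hij
    · rw [if_pos rfl, if_pos rfl]
      exact hring _ _
    · rw [if_neg hij.symm, if_neg hij, if_neg hij]
      exact hring' _ _
  rw [h1, h2, ← Finset.sum_add_distrib]
  simp only [← Finset.sum_add_distrib, h3]
  simp only [Finset.sum_ite_eq', Finset.mem_univ, if_true, Finset.sum_add_distrib]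
  congr 1
  refine LinearMap.ext fun ω => funext fun t => ?_
  simp only [LinearMap.sum_apply, Finset.sum_apply, pointwise_apply]

/-- A closed form of degree `c < n` is exact when the operators `∑ L_j A_j + c`, `c > 0`, are
invertible. -/
theorem exists_deRhamTotal_eq (L A : Fin n → Module.End k M)
    (hAL : ∀ i j, A i * L j = L j * A i + if i = j then 1 else 0)
    (hL : ∀ i j, Commute (L i) (L j))
    (hQ : ∀ c : ℕ, c ≠ 0 → IsUnit (∑ j, L j * A j + (c : Module.End k M)))
    (ω : Finset (Fin n) → M) (hω : deRhamTotal L ω = 0) (i : ℕ) (hi : i < n)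
    (hsupp : ∀ t, t.card ≠ i → ω t = 0) : ∃ η, deRhamTotal L η = ω := by
  have hNL : ∀ l, (∑ j, L j * A j) * L l = L l * (∑ j, L j * A j) + L l := by
    intro l
    rw [Finset.sum_mul, Finset.mul_sum, ← sub_eq_iff_eq_add', ← Finset.sum_sub_distrib]
    have h : ∀ j, L j * A j * L l - L l * (L j * A j) = if j = l then L l else 0 := by
      intro j
      rw [mul_assoc, hAL, mul_add, ← mul_assoc, ← mul_assoc, (hL j l).eq, add_sub_cancel_left]
      split_ifs with h
      · rw [h, mul_one]
      · rw [mul_zero]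
    simp [h]
  obtain ⟨u, hu⟩ := hQ (n - i) (by omega)
  obtain ⟨v, hv⟩ := hQ (n - i + 1) (by omega)
  have huv : ∀ l, (u⁻¹ : (Module.End k M)ˣ) * L l = L l * (v⁻¹ : (Module.End k M)ˣ) := by
    intro l
    rw [Units.inv_mul_eq_iff_eq_mul, ← mul_assoc, Units.eq_mul_inv_iff_mul_eq, hu, hv, add_mul, hNL]
    push_cast
    rw [mul_add, mul_add, mul_one, (Nat.cast_commute (n - i) (L l)).eq]
    abel
  have h1 : deRhamTotal L (koszulHomotopy A ω) = pointwise n (u : Module.End k M) ω := by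
    have h2 := LinearMap.congr_fun (deRhamTotal_homotopy L A hAL) ω
    rw [LinearMap.add_apply, Module.End.mul_apply, Module.End.mul_apply, hω, map_zero,
      add_zero] at h2
    rw [h2]
    funext t
    rw [LinearMap.add_apply, Pi.add_apply, sum_contract_mul_wedge_apply, pointwise_apply,
      pointwise_apply, hu, LinearMap.add_apply, Module.End.natCast_apply]
    by_cases ht : t.card = i
    · rw [ht]
    · rw [hsupp t ht, smul_zero, smul_zero]
  refine ⟨pointwise n ((v⁻¹ : (Module.End k M)ˣ) : Module.End k M) (koszulHomotopy A ω), ?_⟩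
  have h3 : deRhamTotal L * pointwise n ((v⁻¹ : (Module.End k M)ˣ) : Module.End k M) =
      pointwise n ((u⁻¹ : (Module.End k M)ˣ) : Module.End k M) * deRhamTotal L := by
    rw [deRhamTotal, Finset.sum_mul, Finset.mul_sum]
    refine Finset.sum_congr rfl fun j _ => ?_
    rw [mul_assoc, ← pointwise_mul_wedge, ← mul_assoc, ← mul_assoc, ← pointwise_mul,
      ← pointwise_mul, huv]
  rw [← Module.End.mul_apply, h3, Module.End.mul_apply, h1, ← Module.End.mul_apply,
    ← pointwise_mul, Units.inv_mul]
  rfl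

end

/-- Two subquotients are isomorphic if they correspond under a linear relation. -/
theorem nonempty_subquotient_equiv {k V W : Type} [Field k] [AddCommGroup V] [Module k V]
    [AddCommGroup W] [Module k W] (Z B : Submodule k V) (Z' B' : Submodule k W)
    (R : Submodule k (V × W)) (h1 : ∀ p ∈ R, p.1 ∈ Z) (h2 : ∀ p ∈ R, p.2 ∈ Z')
    (h3 : ∀ x ∈ Z, ∃ y, (x, y) ∈ R) (h4 : ∀ y ∈ Z', ∃ x, (x, y) ∈ R)
    (h5 : ∀ p ∈ R, p.1 ∈ B ↔ p.2 ∈ B') :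
    Nonempty ((Z ⧸ B.comap Z.subtype) ≃ₗ[k] (Z' ⧸ B'.comap Z'.subtype)) := by
  let f : R →ₗ[k] Z ⧸ B.comap Z.subtype := (B.comap Z.subtype).mkQ ∘ₗ
    (LinearMap.fst k V W ∘ₗ R.subtype).codRestrict Z fun p => h1 _ p.2
  let g : R →ₗ[k] Z' ⧸ B'.comap Z'.subtype := (B'.comap Z'.subtype).mkQ ∘ₗ
    (LinearMap.snd k V W ∘ₗ R.subtype).codRestrict Z' fun p => h2 _ p.2
  have hf : Function.Surjective f := by
    intro x
    obtain ⟨x, rfl⟩ := Submodule.mkQ_surjective _ x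
    obtain ⟨y, hy⟩ := h3 _ x.2
    exact ⟨⟨_, hy⟩, rfl⟩
  have hg : Function.Surjective g := by
    intro y
    obtain ⟨y, rfl⟩ := Submodule.mkQ_surjective _ y
    obtain ⟨x, hx⟩ := h4 _ y.2
    exact ⟨⟨_, hx⟩, rfl⟩
  have hfg : LinearMap.ker f = LinearMap.ker g := by
    ext p
    rw [LinearMap.mem_ker, LinearMap.mem_ker]
    change Submodule.Quotient.mk _ = 0 ↔ Submodule.Quotient.mk _ = 0
    rw [Submodule.Quotient.mk_eq_zero, Submodule.Quotient.mk_eq_zero]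
    exact h5 _ p.2
  exact ⟨(f.quotKerEquivOfSurjective hf).symm ≪≫ₗ Submodule.quotEquivOfEq _ _ hfg ≪≫ₗ
    g.quotKerEquivOfSurjective hg⟩

section

variable {n : ℕ} {k : Type} [Field k] {M : Type} [AddCommGroup M] [Module k M]

/-- The component of degree `i` of a form. -/
def formRestrict (k : Type) [Field k] (n : ℕ) (M : Type) [AddCommGroup M] [Module k M] (i : ℤ) :
    (Finset (Fin n) → M) →ₗ[k] drT k n M i :=
  LinearMap.funLeft k M Subtype.val

theorem formRestrict_apply (i : ℤ) (ω : Finset (Fin n) → M)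
    (t : {s : Finset (Fin n) // (s.card : ℤ) = i}) : formRestrict k n M i ω t = ω t := rfl

theorem drD_formRestrict (pd : Fin n → Module.End k M) (i : ℤ) (ω : Finset (Fin n) → M) :
    drD pd i (formRestrict k n M i ω) = formRestrict k n M (i + 1) (deRhamTotal pd ω) := by
  funext t
  rw [formRestrict_apply, deRhamTotal_apply, ← Finset.sum_attach]
  rfl

theorem exists_form_extension {i : ℤ} (x : drT k n M i) :
    ∃ ω, formRestrict k n M i ω = x ∧ ∀ t : Finset (Fin n), (t.card : ℤ) ≠ i → ω t = 0 := by
  refine ⟨fun t => if h : (t.card : ℤ) = i then x ⟨t, h⟩ else 0, ?_, fun t ht => dif_neg ht⟩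
  funext t
  rw [formRestrict_apply, dif_pos t.2]

theorem mem_drBnd (pd : Fin n → Module.End k M) (i : ℤ) (x : drT k n M i) :
    x ∈ drBnd pd i ↔ ∃ ω, formRestrict k n M i (deRhamTotal pd ω) = x := by
  have key : ∀ (j : ℤ) (h : j + 1 = i), (h ▸ LinearMap.range (drD pd j) : Submodule k _) =
      (LinearMap.range (deRhamTotal pd)).map (formRestrict k n M i) := by
    rintro j rfl
    ext x
    simp only [LinearMap.mem_range, Submodule.mem_map, exists_exists_eq_and]
    constructor
    · rintro ⟨y, rfl⟩
      obtain ⟨ω, rfl, _⟩ := exists_form_extension y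
      exact ⟨ω, (drD_formRestrict pd j ω).symm⟩
    · rintro ⟨ω, rfl⟩
      exact ⟨_, drD_formRestrict pd j ω⟩
  rw [drBnd, key]
  simp

theorem mem_drBnd_succ (pd : Fin n → Module.End k M) (i : ℤ) (x : drT k n M (i + 1)) :
    x ∈ drBnd pd (i + 1) ↔ ∃ y, drD pd i y = x := by
  rw [mem_drBnd]
  constructor
  · rintro ⟨ω, rfl⟩
    exact ⟨_, drD_formRestrict pd i ω⟩
  · rintro ⟨y, rfl⟩
    obtain ⟨ω, rfl, _⟩ := exists_form_extension y
    exact ⟨ω, (drD_formRestrict pd i ω).symm⟩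

theorem drD_eq_zero_of_mem_drBnd [CharZero k] (pd : Fin n → Module.End k M)
    (hpd : ∀ i j, Commute (pd i) (pd j)) (i : ℤ) (x : drT k n M i) (hx : x ∈ drBnd pd i) :
    drD pd i x = 0 := by
  obtain ⟨ω, rfl⟩ := (mem_drBnd pd i x).1 hx
  rw [drD_formRestrict, ← Module.End.mul_apply, deRhamTotal_mul_self pd hpd, LinearMap.zero_apply,
    map_zero]

theorem drD_drD [CharZero k] (pd : Fin n → Module.End k M) (hpd : ∀ i j, Commute (pd i) (pd j))
    (i : ℤ) (x : drT k n M i) : drD pd (i + 1) (drD pd i x) = 0 :=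
  drD_eq_zero_of_mem_drBnd pd hpd _ _ ((mem_drBnd_succ pd i _).2 ⟨x, rfl⟩)

theorem mem_drBnd_of_drD_eq_zero (L A : Fin n → Module.End k M)
    (hAL : ∀ i j, A i * L j = L j * A i + if i = j then 1 else 0)
    (hL : ∀ i j, Commute (L i) (L j))
    (hQ : ∀ c : ℕ, c ≠ 0 → IsUnit (∑ j, L j * A j + (c : Module.End k M)))
    (i : ℤ) (hi : i < n) (x : drT k n M i) (hx : drD L i x = 0) : x ∈ drBnd L i := by
  rw [mem_drBnd]
  by_cases h0 : i < 0
  · exact ⟨0, funext fun t => absurd t.2 (by omega)⟩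
  obtain ⟨i, rfl⟩ := Int.eq_ofNat_of_zero_le (not_lt.1 h0)
  obtain ⟨ω, rfl, hω⟩ := exists_form_extension x
  have hclosed : deRhamTotal L ω = 0 := by
    rw [drD_formRestrict] at hx
    funext t
    by_cases ht : (t.card : ℤ) = i + 1
    · exact congrFun hx ⟨t, ht⟩
    · rw [deRhamTotal_apply]
      refine Finset.sum_eq_zero fun j hj => ?_
      have h1 := Finset.card_erase_add_one hj
      rw [hω _ (by omega), map_zero, smul_zero]
  obtain ⟨η, hη⟩ := exists_deRhamTotal_eq L A hAL hL hQ ω hclosed i (by omega)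
    fun t ht => hω t (by omega)
  exact ⟨η, by rw [hη]⟩

/-- The sum of the images of the `∂_j`. -/
def pdImage (pd : Fin n → Module.End k M) : Submodule k M :=
  LinearMap.range (LinearMap.lsum k (fun _ => M) k pd)

theorem mem_pdImage (pd : Fin n → Module.End k M) (y : M) :
    y ∈ pdImage pd ↔ ∃ m : Fin n → M, ∑ j, pd j (m j) = y := by
  simp [pdImage, LinearMap.lsum_apply]

theorem mem_pdImage_iff_deRhamTotal (pd : Fin n → Module.End k M) (y : M) :
    y ∈ pdImage pd ↔ ∃ ω, deRhamTotal pd ω Finset.univ = y := by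
  simp only [mem_pdImage, deRhamTotal_apply]
  constructor
  · rintro ⟨m, rfl⟩
    refine ⟨fun s => ∑ j ∈ sᶜ, wedgeSign Finset.univ j • m j, Finset.sum_congr rfl fun j _ => ?_⟩
    beta_reduce
    rw [Finset.compl_erase, Finset.compl_univ, Finset.sum_insert (Finset.notMem_empty _),
      Finset.sum_empty, add_zero, map_zsmul, smul_smul, wedgeSign_mul_self, one_smul]
  · rintro ⟨ω, rfl⟩
    exact ⟨fun j => wedgeSign Finset.univ j • ω (Finset.univ.erase j),
      Finset.sum_congr rfl fun j _ => map_zsmul _ _ _⟩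

theorem eq_of_apply_univ {k : Type} [Field k] {V : Type} [AddCommGroup V] [Module k V] {i : ℤ}
    (hu : ((Finset.univ : Finset (Fin n)).card : ℤ) = i) {x y : drT k n V i}
    (h : x ⟨Finset.univ, hu⟩ = y ⟨Finset.univ, hu⟩) : x = y := by
  funext t
  obtain ⟨t, ht⟩ := t
  obtain rfl := (Finset.card_eq_iff_eq_univ t).1 (by
    rw [Finset.card_univ] at hu
    omega)
  exact h

theorem nonempty_drH_equiv_quotient_pdImage (pd : Fin n → Module.End k M) :
    Nonempty (drH pd (n : ℤ) ≃ₗ[k] M ⧸ pdImage pd) := by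
  have hu : ((Finset.univ : Finset (Fin n)).card : ℤ) = n := by simp
  let f : LinearMap.ker (drD pd (n : ℤ)) →ₗ[k] M ⧸ pdImage pd := (pdImage pd).mkQ ∘ₗ
    LinearMap.proj ⟨Finset.univ, hu⟩ ∘ₗ (LinearMap.ker (drD pd (n : ℤ))).subtype
  have hf : Function.Surjective f := by
    intro y
    obtain ⟨y, rfl⟩ := Submodule.mkQ_surjective _ y
    refine ⟨⟨fun _ => y, ?_⟩, rfl⟩
    rw [LinearMap.mem_ker]
    funext t
    have h1 := t.1.card_le_univ
    rw [Fintype.card_fin] at h1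
    have h2 := t.2
    omega
  have hker : LinearMap.ker f =
      (drBnd pd (n : ℤ)).comap (LinearMap.ker (drD pd (n : ℤ))).subtype := by
    ext x
    rw [LinearMap.mem_ker, Submodule.mem_comap, mem_drBnd]
    change Submodule.Quotient.mk _ = 0 ↔ _
    rw [Submodule.Quotient.mk_eq_zero, mem_pdImage_iff_deRhamTotal]
    exact exists_congr fun ω => ⟨fun h => eq_of_apply_univ hu h, fun h => congrFun h ⟨_, hu⟩⟩
  exact ⟨(Submodule.quotEquivOfEq _ _ hker).symm ≪≫ₗ f.quotKerEquivOfSurjective hf⟩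

theorem finite_drH_of_neg (pd : Fin n → Module.End k M) (i : ℤ) (hi : i < 0) :
    Module.Finite k (drH pd i) := by
  have h : Subsingleton (drT k n M i) := ⟨fun x y => funext fun t => absurd t.2 (by omega)⟩
  infer_instance

end

section

variable {n : ℕ} {k : Type} [Field k] {M F K : Type} [AddCommGroup M] [Module k M]
  [AddCommGroup F] [Module k F] [AddCommGroup K] [Module k K]
  (pdM : Fin n → Module.End k M) (pdF : Fin n → Module.End k F) (pdK : Fin n → Module.End k K)

theorem drD_comp (f : M →ₗ[k] F) (hf : ∀ j m, f (pdM j m) = pdF j (f m)) (i : ℤ)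
    (x : drT k n M i) : drD pdF i (f ∘ x) = f ∘ drD pdM i x := by
  funext t
  change _ = f (∑ j ∈ t.1.attach, _)
  rw [map_sum]
  refine Finset.sum_congr rfl fun j _ => ?_
  rw [map_zsmul, hf]
  rfl

theorem formRestrict_deRhamTotal_comp (f : M →ₗ[k] F) (hf : ∀ j m, f (pdM j m) = pdF j (f m))
    (i : ℤ) (ω : Finset (Fin n) → M) : formRestrict k n F i (deRhamTotal pdF (f ∘ ω)) =
      f ∘ formRestrict k n M i (deRhamTotal pdM ω) := by
  funext t
  rw [formRestrict_apply, deRhamTotal_apply]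
  change _ = f (deRhamTotal pdM ω t)
  rw [deRhamTotal_apply, map_sum]
  refine Finset.sum_congr rfl fun j _ => ?_
  rw [map_zsmul, hf]
  rfl

/-- The connecting relation of the de Rham complexes of a short exact sequence. -/
def connectingRel (f : K →ₗ[k] F) (g : F →ₗ[k] M) (i : ℤ) :
    Submodule k (drT k n M i × drT k n K (i + 1)) where
  carrier := {p | ∃ w, g ∘ w = p.1 ∧ drD pdF i w = f ∘ p.2}
  zero_mem' := ⟨0, funext fun t => by simp, by rw [map_zero]; exact funext fun t => by simp⟩
  add_mem' := by
    rintro p q ⟨w, h1, h2⟩ ⟨w', h3, h4⟩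
    refine ⟨w + w', ?_, ?_⟩
    · rw [Prod.fst_add, ← h1, ← h3]
      exact funext fun t => by simp
    · rw [map_add, h2, h4]
      exact funext fun t => by simp
  smul_mem' := by
    rintro c p ⟨w, h1, h2⟩
    refine ⟨c • w, ?_, ?_⟩
    · rw [Prod.smul_fst, ← h1]
      exact funext fun t => by simp
    · rw [map_smul, h2]
      exact funext fun t => by simp

variable (f : K →ₗ[k] F) (g : F →ₗ[k] M)

theorem exists_comp_eq (ι : Type) (w : ι → F) (hfg : Function.Exact f g) (h : g ∘ w = 0) :
    ∃ x : ι → K, f ∘ x = w := by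
  choose x hx using fun t => (hfg (w t)).1 (congrFun h t)
  exact ⟨x, funext hx⟩

theorem mem_ker_of_mem_connectingRel (hg : ∀ j m, g (pdF j m) = pdM j (g m))
    (hfg : Function.Exact f g) (i : ℤ) (p : drT k n M i × drT k n K (i + 1))
    (hp : p ∈ connectingRel pdF f g i) : p.1 ∈ LinearMap.ker (drD pdM i) := by
  obtain ⟨w, h1, h2⟩ := hp
  rw [LinearMap.mem_ker, ← h1, drD_comp pdF pdM g hg, h2]
  exact funext fun t => hfg.apply_apply_eq_zero _

theorem exists_mem_connectingRel (hg : ∀ j m, g (pdF j m) = pdM j (g m))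
    (hsurj : Function.Surjective g) (hfg : Function.Exact f g) (i : ℤ) (x : drT k n M i)
    (hx : x ∈ LinearMap.ker (drD pdM i)) : ∃ y, (x, y) ∈ connectingRel pdF f g i := by
  choose w hw using fun t => hsurj (x t)
  have hw' : g ∘ w = x := funext hw
  obtain ⟨y, hy⟩ := exists_comp_eq f g _ (drD pdF i w) hfg (by
    rw [← drD_comp pdF pdM g hg, hw', LinearMap.mem_ker.1 hx])
  exact ⟨y, w, hw', hy.symm⟩

theorem mem_drBnd_iff_of_mem_connectingRel [CharZero k]
    (hpdF : ∀ i j, Commute (pdF i) (pdF j))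
    (hf : ∀ j m, f (pdK j m) = pdF j (f m)) (hg : ∀ j m, g (pdF j m) = pdM j (g m))
    (hinj : Function.Injective f) (hsurj : Function.Surjective g) (hfg : Function.Exact f g)
    (i : ℤ) (hF : ∀ x : drT k n F i, drD pdF i x = 0 → x ∈ drBnd pdF i)
    (p : drT k n M i × drT k n K (i + 1)) (hp : p ∈ connectingRel pdF f g i) :
    p.1 ∈ drBnd pdM i ↔ p.2 ∈ drBnd pdK (i + 1) := by
  obtain ⟨w, h1, h2⟩ := hp
  rw [mem_drBnd_succ, mem_drBnd]
  constructor
  · rintro ⟨ω, hω⟩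
    choose η hη using fun t => hsurj (ω t)
    obtain rfl : g ∘ η = ω := funext hη
    rw [formRestrict_deRhamTotal_comp pdF pdM g hg, ← h1] at hω
    obtain ⟨a, ha⟩ := exists_comp_eq f g _
      (w - formRestrict k n F i (deRhamTotal pdF η)) hfg (by
        funext t
        simpa [sub_eq_zero] using (congrFun hω t).symm)
    refine ⟨a, hinj.comp_left ?_⟩
    change f ∘ _ = f ∘ _
    rw [← drD_comp pdK pdF f hf, ha, map_sub, h2,
      drD_eq_zero_of_mem_drBnd pdF hpdF i _ ((mem_drBnd pdF i _).2 ⟨η, rfl⟩), sub_zero]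
  · rintro ⟨a, ha⟩
    have h3 : drD pdF i (w - f ∘ a) = 0 := by
      rw [map_sub, h2, drD_comp pdK pdF f hf, ha, sub_self]
    obtain ⟨η, hη⟩ := (mem_drBnd pdF i _).1 (hF _ h3)
    refine ⟨g ∘ η, ?_⟩
    rw [formRestrict_deRhamTotal_comp pdF pdM g hg, hη, ← h1]
    funext t
    simp [hfg.apply_apply_eq_zero]

/-- Dimension shifting for de Rham cohomology. -/
theorem nonempty_drH_equiv_succ [CharZero k] (hpdF : ∀ i j, Commute (pdF i) (pdF j))
    (hf : ∀ j m, f (pdK j m) = pdF j (f m)) (hg : ∀ j m, g (pdF j m) = pdM j (g m))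
    (hinj : Function.Injective f) (hsurj : Function.Surjective g) (hfg : Function.Exact f g)
    (hF : ∀ i : ℤ, i < n → ∀ x : drT k n F i, drD pdF i x = 0 → x ∈ drBnd pdF i)
    (i : ℤ) (hi : i + 1 < n) : Nonempty (drH pdM i ≃ₗ[k] drH pdK (i + 1)) := by
  refine nonempty_subquotient_equiv _ _ _ _ (connectingRel pdF f g i)
    (mem_ker_of_mem_connectingRel pdM pdF f g hg hfg i) ?_
    (exists_mem_connectingRel pdM pdF f g hg hsurj hfg i) ?_
    (mem_drBnd_iff_of_mem_connectingRel pdM pdF pdK f g hpdF hf hg hinj hsurj hfg i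
      (hF i (by omega)))
  · rintro p ⟨w, h1, h2⟩
    rw [LinearMap.mem_ker]
    refine hinj.comp_left ?_
    change f ∘ _ = f ∘ _
    rw [← drD_comp pdK pdF f hf, ← h2, drD_drD pdF hpdF]
    exact funext fun t => (map_zero f).symm
  · intro y hy
    have h1 : drD pdF (i + 1) (f ∘ y) = 0 := by
      rw [drD_comp pdK pdF f hf, LinearMap.mem_ker.1 hy]
      exact funext fun t => map_zero f
    obtain ⟨w, hw⟩ := (mem_drBnd_succ pdF i _).1 (hF _ hi _ h1)
    exact ⟨g ∘ w, w, rfl, hw⟩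

/-- Dimension shifting for de Rham cohomology in top degree. -/
theorem nonempty_drH_equiv_pdImage [CharZero k] (hpdF : ∀ i j, Commute (pdF i) (pdF j))
    (hf : ∀ j m, f (pdK j m) = pdF j (f m)) (hg : ∀ j m, g (pdF j m) = pdM j (g m))
    (hinj : Function.Injective f) (hsurj : Function.Surjective g) (hfg : Function.Exact f g)
    (hF : ∀ i : ℤ, i < n → ∀ x : drT k n F i, drD pdF i x = 0 → x ∈ drBnd pdF i)
    (i : ℤ) (hi : i + 1 = n) : Nonempty (drH pdM i ≃ₗ[k] ((pdImage pdF).comap f : Submodule k K) ⧸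
      (pdImage pdK).comap ((pdImage pdF).comap f).subtype) := by
  have hu : ((Finset.univ : Finset (Fin n)).card : ℤ) = i + 1 := by simp [hi]
  have hbnd : ∀ {V : Type} [AddCommGroup V] [Module k V] (pd : Fin n → Module.End k V) (v : V),
      v ∈ pdImage pd ↔ (fun _ => v) ∈ drBnd pd (i + 1) := by
    intro V _ _ pd v
    rw [mem_pdImage_iff_deRhamTotal, mem_drBnd]
    exact exists_congr fun ω => ⟨fun h => eq_of_apply_univ hu h, fun h => congrFun h ⟨_, hu⟩⟩
  have hconst : ∀ {V : Type} [AddCommGroup V] [Module k V] (y : drT k n V (i + 1)),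
      (fun _ => y ⟨Finset.univ, hu⟩) = y :=
    fun y => eq_of_apply_univ hu rfl
  refine nonempty_subquotient_equiv _ _ _ _ ((connectingRel pdF f g i).comap
    (LinearMap.prodMap LinearMap.id (LinearMap.pi fun _ => LinearMap.id)))
    (fun p hp => mem_ker_of_mem_connectingRel pdM pdF f g hg hfg i _ hp) ?_ (fun x hx => ?_) ?_
    (fun p hp => ?_)
  · rintro p ⟨w, h1, h2⟩
    rw [Submodule.mem_comap, hbnd, mem_drBnd_succ]
    exact ⟨w, h2⟩
  · obtain ⟨y, hy⟩ := exists_mem_connectingRel pdM pdF f g hg hsurj hfg i x hx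
    rw [← hconst y] at hy
    exact ⟨_, hy⟩
  · intro y hy
    rw [Submodule.mem_comap, hbnd, mem_drBnd_succ] at hy
    obtain ⟨w, hw⟩ := hy
    exact ⟨g ∘ w, w, rfl, hw⟩
  · rw [hbnd]
    exact mem_drBnd_iff_of_mem_connectingRel pdM pdF pdK f g hpdF hf hg hinj hsurj hfg i
      (hF i (by omega)) _ hp

end

section

variable {k : Type} [Field k] {n : ℕ}

/-- The Euler operator in the variables `ξ`. -/
noncomputable def eulerInl (k : Type) [Field k] (n : ℕ) :
    Module.End k (MvPolynomial (Fin n ⊕ Fin n) k) :=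
  ∑ j : Fin n, LinearMap.mulLeft k (X (Sum.inl j) : MvPolynomial (Fin n ⊕ Fin n) k) *
    (pderiv (Sum.inl j) : Derivation k (MvPolynomial (Fin n ⊕ Fin n) k) _).toLinearMap

theorem eulerInl_monomial (s : Fin n ⊕ Fin n →₀ ℕ) (a : k) :
    eulerInl k n (monomial s a) = ((∑ j, s (Sum.inl j) : ℕ) : k) • monomial s a := by
  rw [eulerInl, LinearMap.sum_apply, Nat.cast_sum, Finset.sum_smul]
  refine Finset.sum_congr rfl fun j _ => ?_
  rw [Module.End.mul_apply, LinearMap.mulLeft_apply]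
  exact (X_mul_pderiv_monomial (R := k) (m := s)).trans
    (Nat.cast_smul_eq_nsmul k (s (Sum.inl j)) (monomial s a)).symm

/-- The inverse of the Euler operator shifted by `c`. -/
noncomputable def eulerInv (k : Type) [Field k] (n c : ℕ) :
    Module.End k (MvPolynomial (Fin n ⊕ Fin n) k) :=
  (basisMonomials (Fin n ⊕ Fin n) k).constr k fun s =>
    ((∑ j, s (Sum.inl j) + c : ℕ) : k)⁻¹ • monomial s 1

theorem eulerInv_monomial (c : ℕ) (s : Fin n ⊕ Fin n →₀ ℕ) :
    eulerInv k n c (monomial s 1) = ((∑ j, s (Sum.inl j) + c : ℕ) : k)⁻¹ • monomial s 1 := by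
  have h := (basisMonomials (Fin n ⊕ Fin n) k).constr_basis k (fun s =>
    ((∑ j, s (Sum.inl j) + c : ℕ) : k)⁻¹ • monomial s (1 : k)) s
  rw [coe_basisMonomials] at h
  rw [eulerInv, h]

theorem eulerInl_add_monomial (c : ℕ) (s : Fin n ⊕ Fin n →₀ ℕ) :
    (eulerInl k n + (c : k) • (LinearMap.id : Module.End k (MvPolynomial (Fin n ⊕ Fin n) k)))
      (monomial s (1 : k)) =
      ((∑ j, s (Sum.inl j) + c : ℕ) : k) • monomial s 1 := by
  rw [LinearMap.add_apply, eulerInl_monomial, LinearMap.smul_apply, LinearMap.id_apply,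
    Nat.cast_add, add_smul]

theorem bijective_eulerInl_add [CharZero k] (c : ℕ) (hc : c ≠ 0) :
    Function.Bijective
      (eulerInl k n + (c : k) • (LinearMap.id : Module.End k (MvPolynomial (Fin n ⊕ Fin n) k))) := by
  have hne : ∀ s : Fin n ⊕ Fin n →₀ ℕ, ((∑ j, s (Sum.inl j) + c : ℕ) : k) ≠ 0 := fun s =>
    Nat.cast_ne_zero.2 (by omega)
  refine (Module.End.isUnit_iff _).1 (isUnit_iff_exists.2 ⟨eulerInv k n c, ?_, ?_⟩)
  · refine (basisMonomials (Fin n ⊕ Fin n) k).ext fun s => ?_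
    rw [coe_basisMonomials, Module.End.mul_apply, eulerInv_monomial, map_smul,
      eulerInl_add_monomial, inv_smul_smul₀ (hne s)]
    rfl
  · refine (basisMonomials (Fin n ⊕ Fin n) k).ext fun s => ?_
    rw [coe_basisMonomials, Module.End.mul_apply, eulerInl_add_monomial, map_smul,
      eulerInv_monomial, smul_inv_smul₀ (hne s)]
    rfl

/-- The commutator `d ↦ d x_j - x_j d` on the coordinates of a free module. -/
noncomputable def commX (k : Type) [Field k] (n : ℕ) (ι : Type) (j : Fin n) :
    Module.End k (ι → WeylN k n) :=
  (LinearMap.mulRight k (XDi k n j) - LinearMap.mulLeft k (XDi k n j)).compLeft ι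

theorem commX_mul_pdEnd (ι : Type) (i j : Fin n) :
    commX k n ι i * pdEnd k n (ι → WeylN k n) j =
      pdEnd k n (ι → WeylN k n) j * commX k n ι i + if i = j then 1 else 0 := by
  refine LinearMap.ext fun d => funext fun t => ?_
  have h : commX k n ι i (pdDi k n j • d) t = (pdDi k n j • commX k n ι i d) t +
      (if j = i then 1 else 0) * d t := by
    have hring : ∀ (A : Type) [Ring A] (p x e δ : A), p * x = x * p + δ →
        p * e * x - x * (p * e) = p * (e * x - x * e) + δ * e := by
      intro A _ p x e δ h
      rw [eq_sub_of_add_eq' h.symm]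
      noncomm_ring
    exact hring _ _ _ (d t) _ (pdDi_mul_XDi k n j i)
  rw [LinearMap.add_apply, Pi.add_apply]
  refine h.trans ?_
  congr 1
  rcases eq_or_ne i j with rfl | hij
  · rw [if_pos rfl, if_pos rfl, one_mul]
    rfl
  · rw [if_neg hij, if_neg hij.symm, zero_mul]
    rfl

theorem pdEnd_commute (k : Type) [Field k] (n : ℕ) (M : Type) [AddCommGroup M] [Module k M]
    [Module (WeylN k n) M] [IsScalarTower k (WeylN k n) M] (i j : Fin n) :
    Commute (pdEnd k n M i) (pdEnd k n M j) := by
  refine LinearMap.ext fun m => ?_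
  change pdDi k n i • pdDi k n j • m = pdDi k n j • pdDi k n i • m
  rw [smul_smul, smul_smul, pdDi_commute k n i j]

theorem isUnit_sum_pdEnd_mul_commX_add [CharZero k] (ι : Type) (c : ℕ) (hc : c ≠ 0) :
    IsUnit (∑ j, pdEnd k n (ι → WeylN k n) j * commX k n ι j +
      (c : Module.End k (ι → WeylN k n))) := by
  let T : WeylN k n → WeylN k n := normalOrderEquiv k n ∘
    (eulerInl k n + (c : k) • (LinearMap.id : Module.End k (MvPolynomial (Fin n ⊕ Fin n) k))) ∘
      (normalOrderEquiv k n).symm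
  have hT : Function.Bijective T := (normalOrderEquiv k n).bijective.comp
    ((bijective_eulerInl_add c hc).comp (normalOrderEquiv k n).symm.bijective)
  have hcoord : ⇑(∑ j, pdEnd k n (ι → WeylN k n) j * commX k n ι j +
      (c : Module.End k (ι → WeylN k n))) = fun d => T ∘ d := by
    funext d t
    obtain ⟨q, hq⟩ := (normalOrderEquiv k n).surjective (d t)
    change _ = T (d t)
    rw [LinearMap.add_apply, LinearMap.sum_apply, Module.End.natCast_apply, Pi.add_apply,
      Finset.sum_apply, Pi.smul_apply]
    simp only [T, Function.comp_apply]
    rw [← hq, LinearEquiv.symm_apply_apply, LinearMap.add_apply, map_add,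
      LinearMap.smul_apply, LinearMap.id_apply, map_smul, Nat.cast_smul_eq_nsmul,
      eulerInl, LinearMap.sum_apply, map_sum]
    congr 1
    refine Finset.sum_congr rfl fun j _ => ?_
    change pdDi k n j * (d t * XDi k n j - XDi k n j * d t) =
      normalOrder k n (X (Sum.inl j) * pderiv (Sum.inl j) q)
    rw [normalOrder_X_inl_mul, normalOrder_pderiv_inl, ← hq]
    rfl
  rw [Module.End.isUnit_iff, hcoord]
  exact ⟨hT.1.comp_left, hT.2.comp_left⟩

theorem mem_drBnd_pi_of_drD_eq_zero [CharZero k] (ι : Type) (i : ℤ) (hi : i < n)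
    (x : drT k n (ι → WeylN k n) i) (hx : drD (pdEnd k n (ι → WeylN k n)) i x = 0) :
    x ∈ drBnd (pdEnd k n (ι → WeylN k n)) i :=
  mem_drBnd_of_drD_eq_zero _ (commX k n ι) (commX_mul_pdEnd ι) (pdEnd_commute k n _)
    (isUnit_sum_pdEnd_mul_commX_add ι) i hi x hx

end

/-- Every finitely generated graded module is covered by a graded finite free module. -/
theorem WeylGrading.exists_cover {k : Type} [Field k] [CharZero k] {n : ℕ} {M : Type}
    [AddCommGroup M] [Module k M] [Module (WeylN k n) M] [IsScalarTower k (WeylN k n) M]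
    [Module.Finite (WeylN k n) M] (T : WeylGrading k n M) :
    ∃ (ι : Type) (_ : Fintype ι) (π : (ι → WeylN k n) →ₗ[WeylN k n] M)
      (S : WeylGrading k n (ι → WeylN k n)), Function.Surjective π ∧
      ∀ a x, π (S.p a x) = T.p a (π x) := by
  obtain ⟨ι, _, v, d, hv, hspan⟩ := T.exists_generators
  refine ⟨ι, inferInstance, Fintype.linearCombination (WeylN k n) v,
    WeylGrading.pi fun i => (weylGrading k n).shift (d i), ?_, fun a x => ?_⟩
  · rw [← LinearMap.range_eq_top, Fintype.range_linearCombination, hspan]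
  · rw [Fintype.linearCombination_apply, Fintype.linearCombination_apply, map_sum]
    exact Finset.sum_congr rfl fun i _ => T.p_smul_of_mem_hom (hv i) a (x i)

theorem exists_extend_of_comap_le_ker {k K F : Type} [Field k] [AddCommGroup K] [Module k K]
    [AddCommGroup F] [Module k F] (f : K →ₗ[k] F) (B : Submodule k F) (l : K →ₗ[k] k)
    (h : B.comap f ≤ LinearMap.ker l) :
    ∃ μ : F →ₗ[k] k, B ≤ LinearMap.ker μ ∧ ∀ x, μ (f x) = l x := by
  have hl : l ∈ LinearMap.range (B.mkQ ∘ₗ f).dualMap := by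
    rw [LinearMap.range_dualMap_eq_dualAnnihilator_ker, Submodule.mem_dualAnnihilator]
    intro x hx
    exact h ((Submodule.Quotient.mk_eq_zero B).1 hx)
  obtain ⟨μ, hμ⟩ := hl
  refine ⟨μ ∘ₗ B.mkQ, fun y hy => ?_, fun x => DFunLike.congr_fun hμ x⟩
  rw [LinearMap.mem_ker, LinearMap.comp_apply, Submodule.mkQ_apply,
    (Submodule.Quotient.mk_eq_zero B).2 hy, map_zero]

section

variable {k : Type} [Field k] {n : ℕ} {K : Type} [AddCommGroup K] [Module k K]
  [Module (WeylN k n) K] [IsScalarTower k (WeylN k n) K]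

theorem pdImage_le_ker_iff (l : K →ₗ[k] k) :
    pdImage (pdEnd k n K) ≤ LinearMap.ker l ↔ ∀ i m, l (pdDi k n i • m) = 0 := by
  classical
  constructor
  · intro h i m
    refine h ((mem_pdImage _ _).2 ⟨Pi.single i m, ?_⟩)
    rw [Finset.sum_eq_single i, Pi.single_eq_same]
    · rfl
    · intro j _ hj
      rw [Pi.single_eq_of_ne hj, map_zero]
    · simp
  · intro h y hy
    obtain ⟨m, rfl⟩ := (mem_pdImage _ _).1 hy
    rw [LinearMap.mem_ker, map_sum]
    exact Finset.sum_eq_zero fun j _ => h j (m j)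

theorem WeylGrading.pdImage_le_ker_comp_p (T : WeylGrading k n K) (l : K →ₗ[k] k)
    (h : pdImage (pdEnd k n K) ≤ LinearMap.ker l) (N : ℤ) :
    pdImage (pdEnd k n K) ≤ LinearMap.ker (l ∘ₗ T.p N) := by
  rw [pdImage_le_ker_iff] at h ⊢
  intro i m
  rw [LinearMap.comp_apply, T.p_pd, h]

theorem WeylGrading.comp_p_mem_EDfun (T : WeylGrading k n K) (l : K →ₗ[k] k)
    (h : pdImage (pdEnd k n K) ≤ LinearMap.ker l) (N : ℤ) : l ∘ₗ T.p N ∈ EDfun k n K :=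
  T.mem_EDfun_of_p _ ((pdImage_le_ker_iff _).1 (T.pdImage_le_ker_comp_p l h N)) N fun m => by
    rw [LinearMap.comp_apply, LinearMap.comp_apply, T.p_p, min_self]

/-- A functional on a finite dimensional subquotient of `K / ∂K` comes from `EDfun`. -/
theorem WeylGrading.exists_mem_EDfun_extending (T : WeylGrading k n K) (W : Submodule k K)
    [Module.Finite k (W ⧸ (pdImage (pdEnd k n K)).comap W.subtype)]
    (φ : W ⧸ (pdImage (pdEnd k n K)).comap W.subtype →ₗ[k] k) :
    ∃ l ∈ EDfun k n K, ∀ w : W, l w = φ (Submodule.Quotient.mk w) := by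
  let B := pdImage (pdEnd k n K)
  obtain ⟨l, hlB, hl⟩ := exists_extend_of_comap_le_ker W.subtype B
    (φ ∘ₗ (B.comap W.subtype).mkQ) (fun x hx => by
      rw [LinearMap.mem_ker, LinearMap.comp_apply, Submodule.mkQ_apply,
        (Submodule.Quotient.mk_eq_zero _).2 hx, map_zero])
  obtain ⟨s, hs⟩ := (Module.Finite.fg_top : (⊤ : Submodule k (W ⧸ B.comap W.subtype)).FG)
  have hrep : ∀ v : W ⧸ B.comap W.subtype, ∃ w : W, Submodule.Quotient.mk w = v :=
    Submodule.Quotient.mk_surjective _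
  choose r hr using hrep
  choose a ha using T.top
  obtain ⟨N, hN⟩ := (s.image fun v => a (r v)).exists_le
  have hfix : ∀ v ∈ s, T.p N (r v) = r v := fun v hv =>
    T.p_eq_self_of_le (hN _ (Finset.mem_image_of_mem _ hv)) (ha _)
  have hker := T.pdImage_le_ker_comp_p l hlB N
  refine ⟨l ∘ₗ T.p N, T.comp_p_mem_EDfun l hlB N, fun w => ?_⟩
  have hagree : (B.comap W.subtype).liftQ ((l ∘ₗ T.p N) ∘ₗ W.subtype)
      (fun x hx => hker hx) = φ := by
    refine LinearMap.ext_on hs fun v hv => ?_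
    nth_rw 1 [← hr v]
    change l (T.p N (r v)) = φ v
    rw [hfix v hv]
    refine (hl (r v)).trans ?_
    rw [LinearMap.comp_apply, Submodule.mkQ_apply, hr]
  rw [← hagree]
  rfl

end

section

variable {k : Type} [Field k] [CharZero k] {n : ℕ} {K : Type} [AddCommGroup K] [Module k K]
  [Module (WeylN k n) K] [IsScalarTower k (WeylN k n) K]

/-- A homomorphism to `E_D`, composed with the residue and restricted to a subquotient
of `K / ∂K`. -/
noncomputable def homEDToDual (W : Submodule k K) : (K →ₗ[WeylN k n] EDcar k n) →ₗ[k]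
    Module.Dual k (W ⧸ (pdImage (pdEnd k n K)).comap W.subtype) where
  toFun h := ((pdImage (pdEnd k n K)).comap W.subtype).liftQ
    ((EDres k n ∘ₗ h.restrictScalars k) ∘ₗ W.subtype) fun _ hx =>
      (pdImage_le_ker_iff _).2 (EDres_comp_mem_EDfun h).1 hx
  map_add' _ _ := Submodule.linearMap_qext _ (LinearMap.ext fun _ => map_add (EDres k n) _ _)
  map_smul' _ _ := Submodule.linearMap_qext _ (LinearMap.ext fun _ => map_smul (EDres k n) _ _)

theorem homEDToDual_mk (W : Submodule k K) (h : K →ₗ[WeylN k n] EDcar k n) (w : W) :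
    homEDToDual W h (Submodule.Quotient.mk w) = EDres k n (h w) := rfl

theorem homEDToDual_eq_zero_iff (W : Submodule k K) (h : K →ₗ[WeylN k n] EDcar k n) :
    homEDToDual W h = 0 ↔ ∀ w ∈ W, EDres k n (h w) = 0 := by
  constructor
  · intro hh w hw
    rw [← homEDToDual_mk W h ⟨w, hw⟩, hh, LinearMap.zero_apply]
  · intro hh
    exact Submodule.linearMap_qext _ (LinearMap.ext fun w => hh w w.2)

theorem WeylGrading.homEDToDual_surjective (T : WeylGrading k n K)
    (W : Submodule k K) [Module.Finite k (W ⧸ (pdImage (pdEnd k n K)).comap W.subtype)] :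
    Function.Surjective (homEDToDual (n := n) W) := by
  intro φ
  obtain ⟨l, hl, hlφ⟩ := T.exists_mem_EDfun_extending W φ
  obtain ⟨h, hh⟩ := exists_EDres_comp_eq l hl
  exact ⟨h, Submodule.linearMap_qext _ (LinearMap.ext fun w => (hh w).trans (hlφ w))⟩

theorem nonempty_homED_equiv_dual (T : WeylGrading k n K)
    [Module.Finite k (K ⧸ pdImage (pdEnd k n K))] :
    Nonempty ((K →ₗ[WeylN k n] EDcar k n) ≃ₗ[k]
      Module.Dual k (K ⧸ pdImage (pdEnd k n K))) := by
  let e : ((⊤ : Submodule k K) ⧸ (pdImage (pdEnd k n K)).comap (⊤ : Submodule k K).subtype) ≃ₗ[k]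
      K ⧸ pdImage (pdEnd k n K) :=
    Submodule.Quotient.equiv _ _ Submodule.topEquiv (by
      ext x
      simp)
  have : Module.Finite k ((⊤ : Submodule k K) ⧸
      (pdImage (pdEnd k n K)).comap (⊤ : Submodule k K).subtype) := Module.Finite.equiv e.symm
  refine ⟨(LinearEquiv.ofBijective (homEDToDual ⊤) ⟨?_, T.homEDToDual_surjective ⊤⟩).trans
    e.symm.dualMap⟩
  rw [← LinearMap.ker_eq_bot, LinearMap.ker_eq_bot']
  intro h hh
  rw [homEDToDual_eq_zero_iff] at hh
  exact EDres_comp_injective _ _ fun m => by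
    rw [hh m trivial, LinearMap.zero_apply, map_zero]

theorem range_lcomp_eq_ker_homEDToDual {F : Type} [AddCommGroup F] [Module k F]
    [Module (WeylN k n) F] [IsScalarTower k (WeylN k n) F]
    [Module.Finite (WeylN k n) K]
    (T : WeylGrading k n K) (S : WeylGrading k n F) (f : K →ₗ[WeylN k n] F)
    (hf : ∀ a m, f (T.p a m) = S.p a (f m)) :
    LinearMap.range (LinearMap.lcomp k (EDcar k n) f) = LinearMap.ker
      (homEDToDual ((pdImage (pdEnd k n F)).comap (f.restrictScalars k))) := by
  ext h
  rw [LinearMap.mem_ker, homEDToDual_eq_zero_iff]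
  constructor
  · rintro ⟨g, rfl⟩ w hw
    exact (pdImage_le_ker_iff _).2 (EDres_comp_mem_EDfun g).1 hw
  · intro hh
    obtain ⟨N, hN⟩ := T.exists_p_of_mem_EDfun _ (EDres_comp_mem_EDfun h)
    obtain ⟨μ, hμB, hμ⟩ := exists_extend_of_comap_le_ker (f.restrictScalars k)
      (pdImage (pdEnd k n F)) (EDres k n ∘ₗ h.restrictScalars k) hh
    obtain ⟨g, hg⟩ := exists_EDres_comp_eq _ (S.comp_p_mem_EDfun μ hμB N)
    refine ⟨g, EDres_comp_injective _ _ fun m => ?_⟩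
    refine (hg (f m)).trans ?_
    rw [LinearMap.comp_apply, ← hf]
    exact (hμ _).trans (hN m)

theorem nonempty_homED_quotient_equiv_dual {F : Type} [AddCommGroup F] [Module k F]
    [Module (WeylN k n) F] [IsScalarTower k (WeylN k n) F]
    [Module.Finite (WeylN k n) K]
    (T : WeylGrading k n K) (S : WeylGrading k n F) (f : K →ₗ[WeylN k n] F)
    (hf : ∀ a m, f (T.p a m) = S.p a (f m))
    [Module.Finite k (((pdImage (pdEnd k n F)).comap (f.restrictScalars k)) ⧸
      (pdImage (pdEnd k n K)).comap
        ((pdImage (pdEnd k n F)).comap (f.restrictScalars k)).subtype)] :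
    Nonempty (((K →ₗ[WeylN k n] EDcar k n) ⧸
        LinearMap.range (LinearMap.lcomp k (EDcar k n) f)) ≃ₗ[k]
      Module.Dual k (((pdImage (pdEnd k n F)).comap (f.restrictScalars k)) ⧸
        (pdImage (pdEnd k n K)).comap
          ((pdImage (pdEnd k n F)).comap (f.restrictScalars k)).subtype)) := by
  rw [range_lcomp_eq_ker_homEDToDual T S f hf]
  exact ⟨LinearMap.quotKerEquivOfSurjective _ (T.homEDToDual_surjective _)⟩

end

theorem nonempty_homology_equiv {k : Type} [Field k]
    (S : CategoryTheory.ShortComplex (ModuleCat.{0} k))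
    {P : Type} [AddCommGroup P] [Module k P] (q : P →ₗ[k] S.X₂) (hq : Function.Injective q)
    (hker : LinearMap.range q = LinearMap.ker S.g.hom) (R : Submodule k P)
    (hR : R.map q = LinearMap.range S.f.hom) : Nonempty (S.homology ≃ₗ[k] P ⧸ R) := by
  let e : P ≃ₗ[k] LinearMap.ker S.g.hom :=
    (LinearEquiv.ofInjective q hq).trans (LinearEquiv.ofEq _ _ hker)
  have he : R.map e.toLinearMap = LinearMap.range S.moduleCatToCycles := by
    refine Submodule.map_injective_of_injective
      (LinearMap.ker S.g.hom).injective_subtype ?_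
    rw [← Submodule.map_comp, ← LinearMap.range_comp]
    exact hR
  exact ⟨S.moduleCatHomologyIso.toLinearEquiv.trans (Submodule.Quotient.equiv _ _ e he).symm⟩

section

open CategoryTheory CategoryTheory.Limits

variable {C : Type 1} [Category.{0} C] [Abelian C] (M F : ℕ → C)
  (ι : ∀ i, M (i + 1) ⟶ F i) (π : ∀ i, F i ⟶ M i) (w : ∀ i, ι i ≫ π i = 0)

/-- The complex obtained by splicing the sequences `0 → M (i+1) → F i → M i → 0`. -/
noncomputable def splicedComplex : ChainComplex C ℕ :=
  ChainComplex.of F (fun i => π (i + 1) ≫ ι i) fun i => by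
    rw [Category.assoc, reassoc_of% (w (i + 1)), zero_comp, comp_zero]

theorem splicedComplex_d (i : ℕ) :
    (splicedComplex M F ι π w).d (i + 1) i = π (i + 1) ≫ ι i :=
  ChainComplex.of_d F (fun i => π (i + 1) ≫ ι i) i

theorem comp_comp_eq_zero (w : ∀ i, ι i ≫ π i = 0) (i : ℕ) : (π (i + 1) ≫ ι i) ≫ π i = 0 := by
  rw [Category.assoc, w, comp_zero]

theorem exact_comp_of_epi [∀ i, Epi (π i)] (hex : ∀ i, (ShortComplex.mk (ι i) (π i) (w i)).Exact)
    (i : ℕ) :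
    (ShortComplex.mk (π (i + 1) ≫ ι i) (π i) (comp_comp_eq_zero M F ι π w i)).Exact := by
  let φ : ShortComplex.mk (π (i + 1) ≫ ι i) (π i) (comp_comp_eq_zero M F ι π w i) ⟶
      ShortComplex.mk (ι i) (π i) (w i) :=
    { τ₁ := π (i + 1)
      τ₂ := 𝟙 _
      τ₃ := 𝟙 _ }
  have h1 : Epi φ.τ₁ := inferInstanceAs (Epi (π (i + 1)))
  have h2 : IsIso φ.τ₂ := inferInstanceAs (IsIso (𝟙 (F i)))
  have h3 : Mono φ.τ₃ := inferInstanceAs (Mono (𝟙 (M i)))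
  exact (ShortComplex.exact_iff_of_epi_of_isIso_of_mono φ).2 (hex i)

theorem exact_comp_comp [∀ i, Epi (π i)] [∀ i, Mono (ι i)]
    (hex : ∀ i, (ShortComplex.mk (ι i) (π i) (w i)).Exact)
    (i : ℕ) (h : (π (i + 2) ≫ ι (i + 1)) ≫ π (i + 1) ≫ ι i = 0) :
    (ShortComplex.mk (π (i + 2) ≫ ι (i + 1)) (π (i + 1) ≫ ι i) h).Exact := by
  let φ : ShortComplex.mk (π (i + 2) ≫ ι (i + 1)) (π (i + 1))
      (comp_comp_eq_zero M F ι π w (i + 1)) ⟶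
      ShortComplex.mk (π (i + 2) ≫ ι (i + 1)) (π (i + 1) ≫ ι i) h :=
    { τ₁ := 𝟙 _
      τ₂ := 𝟙 _
      τ₃ := ι i }
  have h1 : Epi φ.τ₁ := inferInstanceAs (Epi (𝟙 (F (i + 2))))
  have h2 : IsIso φ.τ₂ := inferInstanceAs (IsIso (𝟙 (F (i + 1))))
  have h3 : Mono φ.τ₃ := inferInstanceAs (Mono (ι i))
  exact (ShortComplex.exact_iff_of_epi_of_isIso_of_mono φ).1
    (exact_comp_of_epi M F ι π w hex (i + 1))

theorem splicedComplex_exactAt [∀ i, Epi (π i)] [∀ i, Mono (ι i)]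
    (hex : ∀ i, (ShortComplex.mk (ι i) (π i) (w i)).Exact) (i : ℕ) :
    (splicedComplex M F ι π w).ExactAt (i + 1) := by
  rw [HomologicalComplex.exactAt_iff' _ (i + 1 + 1) (i + 1) i (by simp) (by simp)]
  have h : (π (i + 2) ≫ ι (i + 1)) ≫ π (i + 1) ≫ ι i = 0 := by
    rw [Category.assoc, reassoc_of% (w (i + 1)), zero_comp, comp_zero]
  refine (ShortComplex.exact_iff_of_iso ?_).1 (exact_comp_comp M F ι π w hex i h)
  exact ShortComplex.isoMk (Iso.refl _) (Iso.refl _) (Iso.refl _)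
    ((Category.id_comp _).trans
      ((splicedComplex_d M F ι π w (i + 1)).trans (Category.comp_id _).symm))
    ((Category.id_comp _).trans
      ((splicedComplex_d M F ι π w i).trans (Category.comp_id _).symm))

/-- The spliced complex as a projective resolution of `M 0`. -/
noncomputable def splicedResolution [∀ i, Epi (π i)] [∀ i, Mono (ι i)] [∀ i, Projective (F i)]
    (hex : ∀ i, (ShortComplex.mk (ι i) (π i) (w i)).Exact) : ProjectiveResolution (M 0) where
  complex := splicedComplex M F ι π w
  projective i := inferInstanceAs (Projective (F i))
  π := (ChainComplex.toSingle₀Equiv _ _).symm ⟨π 0, by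
    rw [splicedComplex_d]
    exact comp_comp_eq_zero M F ι π w 0⟩
  quasiIso := ⟨fun i => by
    cases i
    · rw [ChainComplex.quasiIsoAt₀_iff, ShortComplex.quasiIso_iff_of_zeros']
      · refine (ShortComplex.exact_and_epi_g_iff_of_iso
          (S₁ := ShortComplex.mk (π 1 ≫ ι 0) (π 0) (comp_comp_eq_zero M F ι π w 0)) ?_).1
          ⟨exact_comp_of_epi M F ι π w hex 0, inferInstanceAs (Epi (π 0))⟩
        exact ShortComplex.isoMk (Iso.refl _) (Iso.refl _) (Iso.refl _)
          ((Category.id_comp _).trans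
            ((splicedComplex_d M F ι π w 0).trans (Category.comp_id _).symm))
          ((Category.id_comp _).trans
            ((ChainComplex.toSingle₀Equiv_symm_apply_f_zero _ _).trans (Category.comp_id _).symm))
      all_goals rfl
    · rw [quasiIsoAt_iff_exactAt']
      · exact splicedComplex_exactAt M F ι π w hex _
      · apply ChainComplex.exactAt_succ_single_obj⟩

variable {k : Type} [Field k] [Linear k C] (Y : C)

theorem range_leftComp_eq_ker (i : ℕ) [Epi (π i)] [Epi (π (i + 1))]
    (hex : (ShortComplex.mk (ι i) (π i) (w i)).Exact) :
    LinearMap.range (Linear.leftComp k Y (π i)) =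
      LinearMap.ker (Linear.leftComp k Y (π (i + 1) ≫ ι i)) := by
  ext h
  rw [LinearMap.mem_ker, LinearMap.mem_range]
  constructor
  · rintro ⟨g, rfl⟩
    change (π (i + 1) ≫ ι i) ≫ π i ≫ g = 0
    rw [Category.assoc, reassoc_of% (w i), zero_comp, comp_zero]
  · intro hh
    change (π (i + 1) ≫ ι i) ≫ h = 0 at hh
    have hι : ι i ≫ h = 0 := by
      rw [← cancel_epi (π (i + 1)), comp_zero, ← Category.assoc, hh]
    have hepi : Epi (ShortComplex.mk (ι i) (π i) (w i)).g := inferInstanceAs (Epi (π i))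
    exact ⟨hex.desc h hι, hex.g_desc h hι⟩

theorem map_leftComp_range {A B D : C} (f : A ⟶ B) (g : B ⟶ D) :
    (LinearMap.range (Linear.leftComp k Y g)).map (Linear.leftComp k Y f) =
      LinearMap.range (Linear.leftComp k Y (f ≫ g)) := by
  rw [← LinearMap.range_comp]
  congr 1
  exact LinearMap.ext fun h => (Category.assoc _ _ _).symm

theorem nonempty_Ext_zero_equiv [EnoughProjectives C] [∀ i, Epi (π i)] [∀ i, Mono (ι i)]
    [∀ i, Projective (F i)] (hex : ∀ i, (ShortComplex.mk (ι i) (π i) (w i)).Exact) :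
    Nonempty (((Ext k C 0).obj (Opposite.op (M 0))).obj Y ≃ₗ[k] (M 0 ⟶ Y)) := by
  let K := (splicedComplex M F ι π w).linearYonedaObj k Y
  let S := K.sc' 0 0 1
  have hf : S.f = 0 := K.shape 0 0 (by simp)
  have hg : S.g.hom = Linear.leftComp k Y (π 1 ≫ ι 0) := by
    rw [← splicedComplex_d M F ι π w]
    rfl
  obtain ⟨e⟩ := nonempty_homology_equiv S (Linear.leftComp k Y (π 0))
    (fun a b h => (cancel_epi (π 0)).1 h)
    ((range_leftComp_eq_ker M F ι π w Y 0 (hex 0)).trans (congrArg LinearMap.ker hg.symm)) ⊥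
    (by
      rw [hf]
      exact (Submodule.map_bot _).trans LinearMap.range_zero.symm)
  exact ⟨(((splicedResolution M F ι π w hex).isoExt 0 Y ≪≫
    ShortComplex.homologyMapIso (K.isoSc' 0 0 1 (by simp)
      (by simp))).toLinearEquiv.trans
      e).trans (Submodule.quotEquivOfEqBot ⊥ rfl)⟩

theorem nonempty_Ext_succ_equiv [EnoughProjectives C] [∀ i, Epi (π i)] [∀ i, Mono (ι i)]
    [∀ i, Projective (F i)] (hex : ∀ i, (ShortComplex.mk (ι i) (π i) (w i)).Exact) (i : ℕ) :
    Nonempty (((Ext k C (i + 1)).obj (Opposite.op (M 0))).obj Y ≃ₗ[k]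
      (M (i + 1) ⟶ Y) ⧸ LinearMap.range (Linear.leftComp k Y (ι i))) := by
  let K := (splicedComplex M F ι π w).linearYonedaObj k Y
  let S := K.sc' i (i + 1) (i + 2)
  have hf : S.f.hom = Linear.leftComp k Y (π (i + 1) ≫ ι i) := by
    rw [← splicedComplex_d M F ι π w]
    rfl
  have hg : S.g.hom = Linear.leftComp k Y (π (i + 2) ≫ ι (i + 1)) := by
    rw [← splicedComplex_d M F ι π w]
    rfl
  obtain ⟨e⟩ := nonempty_homology_equiv S (Linear.leftComp k Y (π (i + 1)))
    (fun a b h => (cancel_epi (π (i + 1))).1 h)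
    ((range_leftComp_eq_ker M F ι π w Y (i + 1) (hex _)).trans
      (congrArg LinearMap.ker hg.symm))
    (LinearMap.range (Linear.leftComp k Y (ι i))) (by
      rw [hf]
      exact map_leftComp_range Y _ _)
  exact ⟨((splicedResolution M F ι π w hex).isoExt (i + 1) Y ≪≫
    ShortComplex.homologyMapIso (K.isoSc' i (i + 1) (i + 2) (by simp)
      (by simp))).toLinearEquiv.trans
      e⟩

end

/-- A finitely generated graded module over the Weyl algebra. -/
structure GradedFGModule (k : Type) [Field k] (n : ℕ) where
  carrier : Type
  [addCommGroup : AddCommGroup carrier]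
  [moduleBase : Module k carrier]
  [moduleWeyl : Module (WeylN k n) carrier]
  [isScalarTower : IsScalarTower k (WeylN k n) carrier]
  [finite : Module.Finite (WeylN k n) carrier]
  grading : WeylGrading k n carrier

attribute [instance] GradedFGModule.addCommGroup GradedFGModule.moduleBase
  GradedFGModule.moduleWeyl GradedFGModule.isScalarTower GradedFGModule.finite

namespace GradedFGModule

variable {k : Type} [Field k] [CharZero k] {n : ℕ} (X : GradedFGModule k n)

/-- The index type of the generators of a chosen graded finite free cover. -/
noncomputable def CoverIndex : Type := X.grading.exists_cover.choose

noncomputable instance : Fintype X.CoverIndex := X.grading.exists_cover.choose_spec.choose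

/-- A chosen graded finite free cover. -/
abbrev Cover : Type := X.CoverIndex → WeylN k n

/-- The projection from the chosen graded finite free cover. -/
noncomputable def coverMap : X.Cover →ₗ[WeylN k n] X.carrier :=
  X.grading.exists_cover.choose_spec.choose_spec.choose

/-- The grading of the chosen graded finite free cover. -/
noncomputable def coverGrading : WeylGrading k n X.Cover :=
  X.grading.exists_cover.choose_spec.choose_spec.choose_spec.choose

theorem coverMap_surjective : Function.Surjective X.coverMap :=
  X.grading.exists_cover.choose_spec.choose_spec.choose_spec.choose_spec.1

theorem coverMap_p (a : ℤ) (x : X.Cover) :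
    X.coverMap (X.coverGrading.p a x) = X.grading.p a (X.coverMap x) :=
  X.grading.exists_cover.choose_spec.choose_spec.choose_spec.choose_spec.2 a x

/-- The kernel of the chosen graded finite free cover. -/
noncomputable def syzygy : GradedFGModule k n where
  carrier := LinearMap.ker X.coverMap
  grading := X.coverGrading.ker X.grading X.coverMap X.coverMap_p

/-- The inclusion of the first syzygy in the cover. -/
noncomputable def syzygyInclusion : X.syzygy.carrier →ₗ[WeylN k n] X.Cover :=
  (LinearMap.ker X.coverMap).subtype

theorem syzygyInclusion_injective : Function.Injective X.syzygyInclusion :=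
  Subtype.val_injective

theorem syzygyInclusion_p (a : ℤ) (x : X.syzygy.carrier) :
    X.syzygyInclusion (X.syzygy.grading.p a x) = X.coverGrading.p a (X.syzygyInclusion x) := rfl

theorem exact_syzygyInclusion_coverMap : Function.Exact X.syzygyInclusion X.coverMap :=
  LinearMap.exact_subtype_ker_map X.coverMap

theorem nonempty_drH_equiv_syzygy (i : ℤ) (hi : i + 1 < n) :
    Nonempty (drH (pdEnd k n X.carrier) i ≃ₗ[k] drH (pdEnd k n X.syzygy.carrier) (i + 1)) :=
  nonempty_drH_equiv_succ (pdEnd k n X.carrier) (pdEnd k n X.Cover) (pdEnd k n X.syzygy.carrier)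
    (X.syzygyInclusion.restrictScalars k) (X.coverMap.restrictScalars k) (pdEnd_commute k n _)
    (fun j m => map_smul X.syzygyInclusion (pdDi k n j) m)
    (fun j m => map_smul X.coverMap (pdDi k n j) m)
    X.syzygyInclusion_injective X.coverMap_surjective X.exact_syzygyInclusion_coverMap
    (mem_drBnd_pi_of_drD_eq_zero _) i hi

theorem nonempty_drH_equiv_pdImage (i : ℤ) (hi : i + 1 = n) :
    Nonempty (drH (pdEnd k n X.carrier) i ≃ₗ[k]
      ((pdImage (pdEnd k n X.Cover)).comap (X.syzygyInclusion.restrictScalars k)) ⧸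
        (pdImage (pdEnd k n X.syzygy.carrier)).comap
          ((pdImage (pdEnd k n X.Cover)).comap (X.syzygyInclusion.restrictScalars k)).subtype) :=
  _root_.nonempty_drH_equiv_pdImage (pdEnd k n X.carrier) (pdEnd k n X.Cover)
    (pdEnd k n X.syzygy.carrier)
    (X.syzygyInclusion.restrictScalars k) (X.coverMap.restrictScalars k) (pdEnd_commute k n _)
    (fun j m => map_smul X.syzygyInclusion (pdDi k n j) m)
    (fun j m => map_smul X.coverMap (pdDi k n j) m)
    X.syzygyInclusion_injective X.coverMap_surjective X.exact_syzygyInclusion_coverMap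
    (mem_drBnd_pi_of_drD_eq_zero _) i hi

/-- The iterated syzygies. -/
noncomputable def syz : ℕ → GradedFGModule k n
  | 0 => X
  | i + 1 => (syz i).syzygy

theorem nonempty_drH_equiv_syz (i : ℕ) (j l : ℤ) (hl : j + i = l) (hln : l < n) :
    Nonempty (drH (pdEnd k n X.carrier) j ≃ₗ[k] drH (pdEnd k n (X.syz i).carrier) l) := by
  induction i generalizing l with
  | zero =>
    rw [Nat.cast_zero, add_zero] at hl
    subst hl
    exact ⟨LinearEquiv.refl k _⟩
  | succ i ih =>
    obtain ⟨e⟩ := ih (j + i) rfl (by push_cast at hl; omega)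
    have hl' : l = j + i + 1 := by push_cast at hl; omega
    subst hl'
    obtain ⟨e'⟩ := (X.syz i).nonempty_drH_equiv_syzygy (j + i) hln
    exact ⟨e.trans e'⟩

theorem nonempty_homED_quotient_equiv_dual_drH (i : ℕ)
    [Module.Finite k (drH (pdEnd k n X.carrier) (n - (i + 1 : ℕ) : ℤ))] :
    Nonempty ((((X.syz (i + 1)).carrier →ₗ[WeylN k n] EDcar k n) ⧸
      LinearMap.range (LinearMap.lcomp k (EDcar k n) (X.syz i).syzygyInclusion)) ≃ₗ[k]
        Module.Dual k (drH (pdEnd k n X.carrier) (n - (i + 1 : ℕ) : ℤ))) := by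
  obtain ⟨e⟩ := X.nonempty_drH_equiv_syz i (n - (i + 1 : ℕ)) (n - 1) (by push_cast; ring) (by omega)
  obtain ⟨e'⟩ := (X.syz i).nonempty_drH_equiv_pdImage (n - 1) (by ring)
  have := Module.Finite.equiv (e.trans e')
  obtain ⟨e''⟩ := nonempty_homED_quotient_equiv_dual (X.syz i).syzygy.grading
    (X.syz i).coverGrading (X.syz i).syzygyInclusion (X.syz i).syzygyInclusion_p
  exact ⟨e''.trans (e.trans e').dualMap⟩

end GradedFGModule

section

open CategoryTheory

/-- For a module `B` with a compatible `k`-linear structure and a module `Y` isomorphic to it,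
morphisms to `Y` in the `k`-linear category of modules are linear maps to `B`. -/
noncomputable def moduleCatHomLinearEquiv {k : Type} [Field k] {D : Type} [Ring D] [Algebra k D]
    (A : ModuleCat.{0} D) {Y : ModuleCat.{0} D} {B : Type} [AddCommGroup B] [Module D B]
    [Module k B] [IsScalarTower k D B] [SMulCommClass D k B] (e : Y ≃ₗ[D] B) :
    (A ⟶ Y) ≃ₗ[k] (A →ₗ[D] B) where
  toFun f := e.toLinearMap ∘ₗ f.hom
  invFun g := ModuleCat.ofHom (e.symm.toLinearMap ∘ₗ g)
  left_inv f := by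
    ext a
    exact e.symm_apply_apply (f.hom a)
  right_inv g := by
    ext a
    exact e.apply_symm_apply (g a)
  map_add' f g := by
    ext a
    exact e.map_add (f.hom a) (g.hom a)
  map_smul' c f := by
    ext a
    change e (algebraMap k D c • f.hom a) = c • e (f.hom a)
    rw [e.map_smul, algebraMap_smul]

theorem nonempty_quotient_leftComp_equiv {k : Type} [Field k] {D : Type} [Ring D] [Algebra k D]
    {A F Y : ModuleCat.{0} D} {B : Type} [AddCommGroup B] [Module D B] [Module k B]
    [IsScalarTower k D B] [SMulCommClass D k B] (e : Y ≃ₗ[D] B) (f : A ⟶ F) :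
    Nonempty (((A ⟶ Y) ⧸ LinearMap.range (Linear.leftComp k Y f)) ≃ₗ[k]
        (A →ₗ[D] B) ⧸ LinearMap.range (LinearMap.lcomp k B f.hom)) := by
  refine ⟨Submodule.Quotient.equiv _ _ (moduleCatHomLinearEquiv A e) ?_⟩
  ext g
  constructor
  · rintro ⟨_, ⟨h, rfl⟩, rfl⟩
    exact ⟨e.toLinearMap ∘ₗ h.hom, rfl⟩
  · rintro ⟨h, rfl⟩
    exact ⟨_, ⟨(moduleCatHomLinearEquiv (k := k) F e).symm h, rfl⟩,
      LinearMap.ext fun a => e.apply_symm_apply (h (f.hom a))⟩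

namespace GradedFGModule

variable {k : Type} [Field k] [CharZero k] {n : ℕ} (X : GradedFGModule k n)

/-- The iterated syzygies as objects of the category of modules. -/
noncomputable abbrev syzCat (i : ℕ) : ModuleCat.{0} (WeylN k n) :=
  ModuleCat.of (WeylN k n) (X.syz i).carrier

/-- The free covers of the iterated syzygies as objects of the category of modules. -/
noncomputable abbrev coverCat (i : ℕ) : ModuleCat.{0} (WeylN k n) :=
  ModuleCat.of (WeylN k n) (X.syz i).Cover

/-- The inclusion of a syzygy in the free cover of the previous one. -/
noncomputable def syzι (i : ℕ) : X.syzCat (i + 1) ⟶ X.coverCat i :=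
  ModuleCat.ofHom (X.syz i).syzygyInclusion

/-- The free cover of a syzygy. -/
noncomputable def syzπ (i : ℕ) : X.coverCat i ⟶ X.syzCat i :=
  ModuleCat.ofHom (X.syz i).coverMap

instance (i : ℕ) : Mono (X.syzι i) :=
  (ModuleCat.mono_iff_injective _).2 (X.syz i).syzygyInclusion_injective

instance (i : ℕ) : Epi (X.syzπ i) :=
  (ModuleCat.epi_iff_surjective _).2 (X.syz i).coverMap_surjective

instance (i : ℕ) : Projective (X.coverCat i) :=
  (IsProjective.iff_projective _).1 (inferInstanceAs (Module.Projective _ (X.syz i).Cover))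

theorem syzι_comp_syzπ (i : ℕ) : X.syzι i ≫ X.syzπ i = 0 := by
  ext x
  exact (X.syz i).exact_syzygyInclusion_coverMap.apply_apply_eq_zero x

theorem exact_syzι_syzπ (i : ℕ) :
    (ShortComplex.mk (X.syzι i) (X.syzπ i) (X.syzι_comp_syzπ i)).Exact :=
  (ShortComplex.ShortExact.moduleCat_exact_iff_function_exact _).2
    (X.syz i).exact_syzygyInclusion_coverMap

/-- `Ext^i(X, E)` is dual to the de Rham cohomology in degree `n - i`. -/
theorem nonempty_Ext_equiv_dual_drH (i : ℕ)
    [Module.Finite k (drH (pdEnd k n X.carrier) (n - i : ℤ))] :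
    Nonempty ((((Ext k (ModuleCat (WeylN k n)) i).obj
      (Opposite.op (ModuleCat.of (WeylN k n) X.carrier))).obj
        (ModuleCat.of (WeylN k n) (EDcar k n))) ≃ₗ[k]
          Module.Dual k (drH (pdEnd k n X.carrier) (n - i : ℤ))) := by
  cases i with
  | zero =>
    have h : (n - (0 : ℕ) : ℤ) = n := by simp
    have hfin : Module.Finite k (drH (pdEnd k n X.carrier) (n : ℤ)) := h ▸ inferInstance
    rw [h]
    obtain ⟨q⟩ := nonempty_drH_equiv_quotient_pdImage (pdEnd k n X.carrier)
    have := Module.Finite.equiv q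
    obtain ⟨e⟩ := nonempty_homED_equiv_dual X.grading
    obtain ⟨e'⟩ := nonempty_Ext_zero_equiv (k := k) X.syzCat X.coverCat X.syzι X.syzπ
      X.syzι_comp_syzπ (ModuleCat.of (WeylN k n) (EDcar k n)) X.exact_syzι_syzπ
    exact ⟨((e'.trans (moduleCatHomLinearEquiv _ (LinearEquiv.refl _ _))).trans e).trans q.dualMap⟩
  | succ i =>
    obtain ⟨e⟩ := nonempty_Ext_succ_equiv (k := k) X.syzCat X.coverCat X.syzι X.syzπ
      X.syzι_comp_syzπ (ModuleCat.of (WeylN k n) (EDcar k n)) X.exact_syzι_syzπ i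
    obtain ⟨e'⟩ := nonempty_quotient_leftComp_equiv (k := k)
      (Y := ModuleCat.of (WeylN k n) (EDcar k n))
      (LinearEquiv.refl (WeylN k n) (EDcar k n)) (X.syzι i)
    obtain ⟨e''⟩ := X.nonempty_homED_quotient_equiv_dual_drH i
    exact ⟨(e.trans e').trans e''⟩

end GradedFGModule

end

open CategoryTheory in
/-- Let `M` be a finitely generated graded left `D`-module (`D` the
Weyl algebra over a field `k` of characteristic zero) whose de Rham cohomology spaces
`H^j_dR(M)`, `0 ≤ j ≤ n`, are all finite dimensional over `k`.  Then, for every `i ≥ 0`,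
the `k`-vector space `Ext^i_D(M, E_D)` (computed in the `k`-linear category of left
`D`-modules) is finite dimensional, of dimension `dim_k H^{n-i}_dR(M)`. -/
theorem dim_Ext_D_to_ED_eq_dim_deRham
    (k : Type) [Field k] [CharZero k] (n : ℕ) (hn : 0 < n)
    (M : Type) [AddCommGroup M] [Module k M]
    [Module (WeylN k n) M] [IsScalarTower k (WeylN k n) M]
    [Module.Finite (WeylN k n) M]
    (deg : ℤ → Submodule k M)
    (hint : DirectSum.IsInternal deg)
    (hX : ∀ (i : Fin n) (l : ℤ), ∀ m ∈ deg l, XDi k n i • m ∈ deg (l + 1))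
    (hpd : ∀ (i : Fin n) (l : ℤ), ∀ m ∈ deg l, pdDi k n i • m ∈ deg (l - 1))
    (hfin : ∀ j : ℕ, j ≤ n →
      FiniteDimensional k (drH (k := k) (n := n) (M := M) (pdEnd k n M) (j : ℤ))) :
    ∀ i : ℕ,
      FiniteDimensional k
        (((Ext k (ModuleCat (WeylN k n)) i).obj
            (Opposite.op (ModuleCat.of (WeylN k n) M))).obj
          (ModuleCat.of (WeylN k n) (EDcar k n))) ∧
      Module.finrank k
        (((Ext k (ModuleCat (WeylN k n)) i).obj
            (Opposite.op (ModuleCat.of (WeylN k n) M))).obj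
          (ModuleCat.of (WeylN k n) (EDcar k n))) =
        Module.finrank k (drH (k := k) (n := n) (M := M) (pdEnd k n M) ((n : ℤ) - (i : ℤ))) := by
  intro i
  obtain ⟨T⟩ := WeylGrading.nonempty_of_isInternal deg hint hX hpd
  have : Module.Finite k (drH (pdEnd k n M) ((n : ℤ) - (i : ℤ))) := by
    rcases le_or_gt i n with hi | hi
    · rw [← Nat.cast_sub hi]
      exact hfin (n - i) (n.sub_le i)
    · exact finite_drH_of_neg _ _ (by omega)
  let X : GradedFGModule k n := { carrier := M, grading := T }
  obtain ⟨e⟩ := X.nonempty_Ext_equiv_dual_drH i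
  exact ⟨Module.Finite.equiv e.symm, e.finrank_eq.trans Subspace.dual_finrank_eq⟩
end

section
/- Let M be a finitely generated graded left D-module such that H^n_dR(M) = M/(∂_1·M + ⋯ + ∂_n·M) is a finite-dimensional k-vector space. Then the k-vector space Hom_D(M, E_D) of left D-module homomorphisms is finite-dimensional and dim_k Hom_D(M, E_D) = dim_k H^n_dR(M). -/
/-! Statement 12. -/

open MvPolynomial

set_option maxHeartbeats 2000000
set_option synthInstance.maxHeartbeats 1000000

namespace WeylN

lemma exponent_induction {n : ℕ} {p : (Fin n →₀ ℕ) → Prop} (b : Fin n →₀ ℕ) (zero : p 0)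
    (add_single : ∀ b i, p b → p (b + Finsupp.single i 1)) : p b := by
  suffices ∀ c, p c → p (c + b) by simpa using this 0 zero
  induction b using Finsupp.induction_linear with
  | zero => simp
  | add f g hf hg =>
    intro c hc
    rw [← add_assoc]
    exact hg _ (hf c hc)
  | single i m =>
    intro c hc
    induction m with
    | zero => simpa using hc
    | succ m ih =>
      rw [Finsupp.single_add, ← add_assoc]
      exact add_single _ _ ih

section Operators

variable {k : Type} [Field k] {n : ℕ}

/-- The tautological action of the Weyl algebra on polynomials. -/
noncomputable def toEnd (k : Type) [Field k] (n : ℕ) :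
    WeylN k n →ₐ[k] Module.End k (MvPolynomial (Fin n) k) :=
  (Algebra.adjoin k (Set.range (XopN k n) ∪ Set.range (pdOpN k n))).val

lemma toEnd_injective : Function.Injective (toEnd k n) := Subtype.val_injective

@[simp] lemma toEnd_XDi (i : Fin n) (f : MvPolynomial (Fin n) k) :
    toEnd k n (XDi k n i) f = X i * f := rfl

@[simp] lemma toEnd_pdDi (i : Fin n) (f : MvPolynomial (Fin n) k) :
    toEnd k n (pdDi k n i) f = pderiv i f := rfl

/-- Induction principle: every property of operators stable under the algebra operations and
satisfied by the generators holds on the Weyl algebra. -/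
lemma induction {p : WeylN k n → Prop} (hX : ∀ i, p (XDi k n i)) (hpd : ∀ i, p (pdDi k n i))
    (halg : ∀ r, p (algebraMap k (WeylN k n) r)) (hadd : ∀ P Q, p P → p Q → p (P + Q))
    (hmul : ∀ P Q, p P → p Q → p (P * Q)) (P : WeylN k n) : p P := by
  obtain ⟨P, hP⟩ := P
  induction hP using Algebra.adjoin_induction with
  | mem x hx =>
    rcases hx with ⟨i, rfl⟩ | ⟨i, rfl⟩
    · exact hX i
    · exact hpd i
  | algebraMap r => exact halg r
  | add x y hx hy h₁ h₂ => exact hadd _ _ h₁ h₂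
  | mul x y hx hy h₁ h₂ => exact hmul _ _ h₁ h₂

/-- A `k`-subspace of a `D`-module stable under the generators is stable under `D`. -/
lemma smul_mem_of_generators {V : Type*} [AddCommGroup V] [Module k V] [Module (WeylN k n) V]
    [IsScalarTower k (WeylN k n) V] (N : Submodule k V)
    (hX : ∀ i, ∀ v ∈ N, XDi k n i • v ∈ N) (hpd : ∀ i, ∀ v ∈ N, pdDi k n i • v ∈ N)
    (P : WeylN k n) : ∀ v ∈ N, P • v ∈ N := by
  induction P using WeylN.induction with
  | hX i => exact hX i
  | hpd i => exact hpd i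
  | halg r =>
    intro v hv
    rw [algebraMap_smul]
    exact N.smul_mem r hv
  | hadd P Q hP hQ =>
    intro v hv
    rw [add_smul]
    exact N.add_mem (hP v hv) (hQ v hv)
  | hmul P Q hP hQ =>
    intro v hv
    rw [mul_smul]
    exact hP _ (hQ v hv)

/-- Multiplication operators: the embedding of the polynomial ring in the Weyl algebra. -/
noncomputable def mulOp (k : Type) [Field k] (n : ℕ) :
    MvPolynomial (Fin n) k →ₐ[k] WeylN k n :=
  (Algebra.lmul k (MvPolynomial (Fin n) k)).codRestrict
    (Algebra.adjoin k (Set.range (XopN k n) ∪ Set.range (pdOpN k n))) fun f => by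
      induction f using MvPolynomial.induction_on with
      | C a =>
        rw [← MvPolynomial.algebraMap_eq, AlgHom.commutes]
        exact Subalgebra.algebraMap_mem _ a
      | add p q hp hq =>
        rw [map_add]
        exact add_mem hp hq
      | mul_X p i hp =>
        rw [map_mul]
        exact mul_mem hp (Algebra.subset_adjoin (Or.inl ⟨i, rfl⟩))

@[simp] lemma toEnd_mulOp (f g : MvPolynomial (Fin n) k) :
    toEnd k n (mulOp k n f) g = f * g := rfl

@[simp] lemma mulOp_X (i : Fin n) : mulOp k n (X i) = XDi k n i := rfl

lemma pdDi_mul_mulOp (i : Fin n) (f : MvPolynomial (Fin n) k) :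
    pdDi k n i * mulOp k n f = mulOp k n f * pdDi k n i + mulOp k n (pderiv i f) := by
  apply toEnd_injective
  ext1 a
  ext1
  simp
  ring

lemma pderiv_comm (i j : Fin n) (f : MvPolynomial (Fin n) k) :
    pderiv i (pderiv j f) = pderiv j (pderiv i f) := by
  ext m
  simp only [coeff_pderiv, Finsupp.add_apply]
  rw [add_right_comm]
  rcases eq_or_ne i j with rfl | h
  · rfl
  · rw [Finsupp.single_eq_of_ne h.symm, Finsupp.single_eq_of_ne h]
    push_cast
    ring

lemma pdDi_comm (i j : Fin n) : pdDi k n i * pdDi k n j = pdDi k n j * pdDi k n i := by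
  apply toEnd_injective
  ext1 a
  ext1
  simp [pderiv_comm i j]

lemma exists_constCoeffOp (k : Type) [Field k] (n : ℕ) :
    ∃ δ : MvPolynomial (Fin n) k →ₐ[k] WeylN k n, ∀ i, δ (X i) = pdDi k n i := by
  have hcomm : ∀ x ∈ Set.range (pdDi k n), ∀ y ∈ Set.range (pdDi k n), x * y = y * x := by
    rintro _ ⟨i, rfl⟩ _ ⟨j, rfl⟩
    exact pdDi_comm i j
  have := Algebra.isMulCommutative_adjoin k hcomm
  let _ : CommRing (Algebra.adjoin k (Set.range (pdDi k n))) :=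
    { (Algebra.adjoin k (Set.range (pdDi k n))).toRing with mul_comm := this.is_comm.comm }
  let φ : MvPolynomial (Fin n) k →ₐ[k] Algebra.adjoin k (Set.range (pdDi k n)) :=
    aeval fun i => ⟨pdDi k n i, Algebra.subset_adjoin ⟨i, rfl⟩⟩
  refine ⟨(Algebra.adjoin k (Set.range (pdDi k n))).val.comp φ, fun i => ?_⟩
  simp [φ]

/-- Constant coefficient differential operators: substitution of `∂_i` for `x_i`. -/
noncomputable def constCoeffOp (k : Type) [Field k] (n : ℕ) :
    MvPolynomial (Fin n) k →ₐ[k] WeylN k n :=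
  (exists_constCoeffOp k n).choose

@[simp] lemma constCoeffOp_X (i : Fin n) : constCoeffOp k n (X i) = pdDi k n i :=
  (exists_constCoeffOp k n).choose_spec i

lemma XDi_mul_constCoeffOp (i : Fin n) (g : MvPolynomial (Fin n) k) :
    XDi k n i * constCoeffOp k n g =
      constCoeffOp k n g * XDi k n i - constCoeffOp k n (pderiv i g) := by
  induction g using MvPolynomial.induction_on with
  | C a =>
    rw [← MvPolynomial.algebraMap_eq, AlgHom.commutes, Derivation.map_algebraMap, map_zero,
      sub_zero, Algebra.commutes]
  | add p q hp hq =>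
    simp only [map_add, mul_add, add_mul, hp, hq]
    abel
  | mul_X p j hp =>
    have hj : XDi k n i * pdDi k n j =
        pdDi k n j * XDi k n i - constCoeffOp k n (pderiv i (X j)) := by
      have h := pdDi_mul_mulOp (k := k) j (X i)
      rw [mulOp_X] at h
      rw [h]
      classical
      rcases eq_or_ne i j with rfl | hij
      · simp
      · simp [pderiv_X_of_ne hij, pderiv_X_of_ne hij.symm]
    rw [map_mul, constCoeffOp_X, ← mul_assoc, hp, sub_mul, mul_assoc, hj, pderiv_mul, map_add,
      map_mul, map_mul, constCoeffOp_X]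
    noncomm_ring

end Operators

section Symbol

variable {k : Type} [Field k] {n : ℕ}

open Classical in
/-- The coefficient of a polynomial at an integral exponent, zero unless the exponent is
nonnegative. -/
noncomputable def zcoeff (z : Fin n → ℤ) : MvPolynomial (Fin n) k →ₗ[k] k :=
  if ∀ i, 0 ≤ z i then lcoeff k (Finsupp.equivFunOnFinite.symm fun i => (z i).toNat) else 0

lemma zcoeff_natCast (m : Fin n →₀ ℕ) (f : MvPolynomial (Fin n) k) :
    zcoeff (fun i => (m i : ℤ)) f = coeff m f := by
  have : Finsupp.equivFunOnFinite.symm (fun i => (m i : ℤ).toNat) = m := by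
    ext i
    simp
  rw [zcoeff, if_pos (by simp), this, lcoeff_apply]

lemma zcoeff_of_neg {z : Fin n → ℤ} {i : Fin n} (h : z i < 0) (f : MvPolynomial (Fin n) k) :
    zcoeff z f = 0 := by
  rw [zcoeff, if_neg (fun h' => absurd (h' i) (by lia))]
  rfl

lemma exists_natCast_or_neg (z : Fin n → ℤ) :
    (∃ m : Fin n →₀ ℕ, z = fun i => (m i : ℤ)) ∨ ∃ i, z i < 0 := by
  by_cases h : ∃ i, z i < 0
  · exact Or.inr h
  · push Not at h
    refine Or.inl ⟨Finsupp.equivFunOnFinite.symm fun i => (z i).toNat, ?_⟩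
    ext i
    simp [h i]

lemma zcoeff_X_mul (z : Fin n → ℤ) (i : Fin n) (f : MvPolynomial (Fin n) k) :
    zcoeff z (X i * f) = zcoeff (z - Pi.single i 1) f := by
  rcases exists_natCast_or_neg (z - Pi.single i 1) with ⟨m, hm⟩ | ⟨j, hj⟩
  · have hz : z = fun j => ((m + Finsupp.single i 1 : Fin n →₀ ℕ) j : ℤ) := by
      rw [sub_eq_iff_eq_add] at hm
      rw [hm]
      ext j
      simp [Finsupp.single_apply, Pi.single_apply, eq_comm]
    rw [hm, hz, zcoeff_natCast, zcoeff_natCast, add_comm, coeff_X_mul]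
  · rw [zcoeff_of_neg hj]
    rcases exists_natCast_or_neg z with ⟨m, rfl⟩ | ⟨j', hj'⟩
    · rw [zcoeff_natCast, coeff_X_mul', if_neg]
      rcases eq_or_ne j i with rfl | h
      · simp at hj
        simp
        lia
      · simp [h] at hj
        lia
    · exact zcoeff_of_neg hj' _

lemma zcoeff_pderiv (z : Fin n → ℤ) (i : Fin n) (f : MvPolynomial (Fin n) k) :
    zcoeff z (pderiv i f) = (z i + 1 : k) * zcoeff (z + Pi.single i 1) f := by
  rcases exists_natCast_or_neg z with ⟨m, rfl⟩ | ⟨j, hj⟩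
  · have : (fun j => (m j : ℤ)) + Pi.single i 1 =
        fun j => ((m + Finsupp.single i 1 : Fin n →₀ ℕ) j : ℤ) := by
      ext j
      simp [Finsupp.single_apply, Pi.single_apply, eq_comm]
    rw [this, zcoeff_natCast, zcoeff_natCast, coeff_pderiv, mul_comm]
    simp
  · rw [zcoeff_of_neg hj]
    rcases eq_or_ne j i with rfl | h
    · by_cases h1 : z j = -1
      · simp [h1]
      · rw [zcoeff_of_neg (i := j) (by simp; lia), mul_zero]
    · rw [zcoeff_of_neg (i := j) (by simpa [h] using hj), mul_zero]

/-- `q` records the matrix coefficients of `P` in the monomial basis: the coefficient of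
`P x^a` at `a + b` is the value of `q b` at `a`. -/
def IsSymbol (P : WeylN k n) (q : (Fin n → ℤ) → MvPolynomial (Fin n) k) : Prop :=
  ∀ (a : Fin n →₀ ℕ) (b : Fin n → ℤ),
    zcoeff (fun i => a i + b i) (toEnd k n P (monomial a 1)) = eval (fun i => (a i : k)) (q b)

lemma IsSymbol.add {P Q : WeylN k n} {p q} (hP : IsSymbol P p) (hQ : IsSymbol Q q) :
    IsSymbol (P + Q) (p + q) := fun a b => by
  rw [map_add, LinearMap.add_apply, map_add, hP a b, hQ a b, Pi.add_apply, map_add]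

lemma IsSymbol.smul {P : WeylN k n} {p} (c : k) (hP : IsSymbol P p) :
    IsSymbol (c • P) (c • p) := fun a b => by
  rw [map_smul, LinearMap.smul_apply, map_smul, hP a b, Pi.smul_apply, smul_eval, smul_eq_mul]

lemma IsSymbol.XDi_mul {P : WeylN k n} {p} (i : Fin n) (hP : IsSymbol P p) :
    IsSymbol (XDi k n i * P) fun b => p (b - Pi.single i 1) := fun a b => by
  rw [map_mul, Module.End.mul_apply, toEnd_XDi, zcoeff_X_mul, ← hP]
  congr 2
  ext j
  simp
  ring

lemma IsSymbol.pdDi_mul {P : WeylN k n} {p} (i : Fin n) (hP : IsSymbol P p) :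
    IsSymbol (pdDi k n i * P) fun b => (X i + C (b i + 1 : k)) * p (b + Pi.single i 1) :=
  fun a b => by
  rw [map_mul, Module.End.mul_apply, toEnd_pdDi, zcoeff_pderiv, map_mul, ← hP]
  congr 1
  · simp
    ring
  · congr 2
    ext j
    simp
    ring

lemma isSymbol_one : IsSymbol (1 : WeylN k n) (Pi.single 0 1) := fun a b => by
  rw [map_one, Module.End.one_apply]
  rcases exists_natCast_or_neg (fun i => a i + b i) with ⟨m, hm⟩ | ⟨j, hj⟩
  · rw [hm, zcoeff_natCast, coeff_monomial]
    have : a = m ↔ b = 0 := by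
      simp only [DFunLike.ext_iff, funext_iff] at hm ⊢
      refine forall_congr' fun i => ?_
      have := hm i
      simp
      lia
    by_cases h : b = 0
    · rw [if_pos (this.2 h), h]
      simp
    · rw [if_neg (mt this.1 h), Pi.single_eq_of_ne h, map_zero]
  · rw [zcoeff_of_neg hj, Pi.single_eq_of_ne, map_zero]
    rintro rfl
    simp at hj
    lia

lemma exists_isSymbol (P : WeylN k n) : ∃ q, IsSymbol P q := by
  let N : Submodule k (WeylN k n) :=
    { carrier := {P | ∃ q, IsSymbol P q}
      add_mem' := fun ⟨p, hp⟩ ⟨q, hq⟩ => ⟨p + q, hp.add hq⟩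
      zero_mem' := ⟨0, fun a b => by simp⟩
      smul_mem' := fun c _ ⟨p, hp⟩ => ⟨c • p, hp.smul c⟩ }
  have h := smul_mem_of_generators N (fun i _ ⟨q, hq⟩ => ⟨_, hq.XDi_mul i⟩)
    (fun i _ ⟨q, hq⟩ => ⟨_, hq.pdDi_mul i⟩) P 1 ⟨_, isSymbol_one⟩
  rwa [smul_eq_mul, mul_one] at h

lemma eval_aeval (x : Fin n → k) (g : Fin n → MvPolynomial (Fin n) k)
    (q : MvPolynomial (Fin n) k) : eval x (aeval g q) = eval (fun j => eval x (g j)) q := by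
  induction q using MvPolynomial.induction_on <;> simp_all

end Symbol

section Residue

variable {k : Type} [Field k] [CharZero k] {n : ℕ}

lemma eq_zero_of_eval_natCast {q : MvPolynomial (Fin n) k}
    (h : ∀ a : Fin n →₀ ℕ, eval (fun i => (a i : k)) q = 0) : q = 0 := by
  refine funext_set (fun _ => Set.range ((↑) : ℕ → k))
    (fun _ => Set.infinite_range_of_injective Nat.cast_injective) fun x hx => ?_
  choose m hm using fun i => hx i (Set.mem_univ i)
  have := h (Finsupp.equivFunOnFinite.symm m)
  simp only [Finsupp.equivFunOnFinite_symm_apply_apply, hm] at this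
  simpa using this

lemma IsSymbol.unique {P : WeylN k n} {p q} (hp : IsSymbol P p) (hq : IsSymbol P q) : p = q := by
  ext1 b
  rw [← sub_eq_zero]
  refine eq_zero_of_eval_natCast fun a => ?_
  rw [map_sub, ← hp a b, ← hq a b, sub_self]

/-- The residue of an operator: the diagonal matrix coefficient, extrapolated to the
exponent `(-1, …, -1)`. -/
noncomputable def residue (k : Type) [Field k] [CharZero k] (n : ℕ) : WeylN k n →ₗ[k] k where
  toFun P := eval (fun _ => -1) ((exists_isSymbol P).choose 0)
  map_add' P Q := by
    rw [(exists_isSymbol (P + Q)).choose_spec.unique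
      ((exists_isSymbol P).choose_spec.add (exists_isSymbol Q).choose_spec), Pi.add_apply, map_add]
  map_smul' c P := by
    rw [(exists_isSymbol (c • P)).choose_spec.unique ((exists_isSymbol P).choose_spec.smul c),
      Pi.smul_apply, smul_eval, RingHom.id_apply, smul_eq_mul]

lemma IsSymbol.residue_eq {P : WeylN k n} {q} (hq : IsSymbol P q) :
    residue k n P = eval (fun _ => -1) (q 0) := by
  rw [← (exists_isSymbol P).choose_spec.unique hq]
  rfl

lemma residue_one : residue k n 1 = 1 := by
  simp [isSymbol_one.residue_eq]

lemma residue_pdDi_mul (i : Fin n) (P : WeylN k n) : residue k n (pdDi k n i * P) = 0 := by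
  obtain ⟨q, hq⟩ := exists_isSymbol P
  simp [(hq.pdDi_mul i).residue_eq]

lemma residue_mul_XDi (i : Fin n) (P : WeylN k n) : residue k n (P * XDi k n i) = 0 := by
  obtain ⟨q, hq⟩ := exists_isSymbol P
  obtain ⟨p, hp⟩ := exists_isSymbol (P * XDi k n i)
  have h₁ : p 0 = aeval (fun j => X j + C (Pi.single i 1 j)) (q (-Pi.single i 1)) := by
    rw [← sub_eq_zero]
    refine eq_zero_of_eval_natCast fun a => ?_
    have h := hq (Finsupp.single i 1 + a) (-Pi.single i 1)
    rw [map_sub, ← hp, sub_eq_zero, map_mul, Module.End.mul_apply, toEnd_XDi, X,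
      monomial_mul, one_mul, eval_aeval]
    convert h using 1
    · congr 2
      ext j
      simp [Finsupp.single_apply, Pi.single_apply, eq_comm]
    · congr 2
      ext j
      simp [Finsupp.single_apply, Pi.single_apply, eq_comm, add_comm]
  have h₂ : aeval (fun j => if j = i then 0 else X j) (q (-Pi.single i 1)) =
      (0 : MvPolynomial (Fin n) k) := by
    refine eq_zero_of_eval_natCast fun a => ?_
    have h := hq (a.erase i) (-Pi.single i 1)
    rw [zcoeff_of_neg (i := i) (by simp)] at h
    rw [eval_aeval, h]
    congr 2
    ext j
    rcases eq_or_ne j i with rfl | hj <;> simp [*]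
  have h₃ := congrArg (eval fun _ => (-1 : k)) h₂
  rw [eval_aeval, map_zero] at h₃
  rw [hp.residue_eq, h₁, eval_aeval, ← h₃]
  congr 2
  ext j
  rcases eq_or_ne j i with rfl | hj <;> simp [*]

end Residue

section LocalCohomology

variable {k : Type} [Field k] {n : ℕ}

/-- The class of `1` in `E_D`. -/
noncomputable def gen (k : Type) [Field k] (n : ℕ) : EDcar k n :=
  (Submodule.span (WeylN k n) (Set.range (XDi k n))).mkQ 1

lemma mk_eq_smul_gen (P : WeylN k n) :
    (Submodule.span (WeylN k n) (Set.range (XDi k n))).mkQ P = P • gen k n := by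
  conv_lhs => rw [← mul_one P, ← smul_eq_mul, map_smul]
  rfl

lemma exists_smul_gen (e : EDcar k n) : ∃ P : WeylN k n, P • gen k n = e := by
  obtain ⟨P, rfl⟩ := Submodule.mkQ_surjective _ e
  exact ⟨P, (mk_eq_smul_gen P).symm⟩

lemma XDi_smul_gen (i : Fin n) : XDi k n i • gen k n = 0 := by
  rw [← mk_eq_smul_gen]
  exact (Submodule.Quotient.mk_eq_zero _).2 (Submodule.subset_span ⟨i, rfl⟩)

/-- The `k`-linear map from polynomials to `E_D`, `g ↦ g(∂) · 1`. -/
noncomputable def ofPoly (k : Type) [Field k] (n : ℕ) :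
    MvPolynomial (Fin n) k →ₗ[k] EDcar k n :=
  (LinearMap.toSpanSingleton (WeylN k n) (EDcar k n) (gen k n)).restrictScalars k ∘ₗ
    (constCoeffOp k n).toLinearMap

lemma ofPoly_apply (g : MvPolynomial (Fin n) k) :
    ofPoly k n g = constCoeffOp k n g • gen k n := rfl

lemma pdDi_smul_ofPoly (i : Fin n) (g : MvPolynomial (Fin n) k) :
    pdDi k n i • ofPoly k n g = ofPoly k n (X i * g) := by
  rw [ofPoly_apply, ofPoly_apply, map_mul, constCoeffOp_X, mul_smul]

lemma XDi_smul_ofPoly (i : Fin n) (g : MvPolynomial (Fin n) k) :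
    XDi k n i • ofPoly k n g = -ofPoly k n (pderiv i g) := by
  rw [ofPoly_apply, ofPoly_apply, ← mul_smul, XDi_mul_constCoeffOp, sub_smul, mul_smul,
    XDi_smul_gen, smul_zero, zero_sub]

lemma ofPoly_surjective : Function.Surjective (ofPoly k n) := by
  intro e
  obtain ⟨P, rfl⟩ := exists_smul_gen e
  refine smul_mem_of_generators (LinearMap.range (ofPoly k n)) ?_ ?_ P (gen k n)
    ⟨1, by rw [ofPoly_apply, map_one, one_smul]⟩
  · rintro i _ ⟨g, rfl⟩
    exact ⟨-pderiv i g, by rw [XDi_smul_ofPoly, map_neg]⟩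
  · rintro i _ ⟨g, rfl⟩
    exact ⟨X i * g, (pdDi_smul_ofPoly i g).symm⟩

variable [CharZero k]

lemma residue_mul_eq_zero_of_mem {P : WeylN k n}
    (hP : P ∈ Submodule.span (WeylN k n) (Set.range (XDi k n))) (Q : WeylN k n) :
    residue k n (Q * P) = 0 := by
  induction hP using Submodule.span_induction generalizing Q with
  | mem x hx =>
    obtain ⟨i, rfl⟩ := hx
    exact residue_mul_XDi i Q
  | zero => rw [mul_zero, map_zero]
  | add x y _ _ hx hy => rw [mul_add, map_add, hx, hy, add_zero]
  | smul P x _ hx => rw [smul_eq_mul, ← mul_assoc, hx]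

/-- The residue functional on `E_D`. -/
noncomputable def res (k : Type) [Field k] [CharZero k] (n : ℕ) : EDcar k n →ₗ[k] k :=
  ((Submodule.span (WeylN k n) (Set.range (XDi k n))).restrictScalars k).liftQ (residue k n)
      (fun P hP => by simpa using residue_mul_eq_zero_of_mem hP 1) ∘ₗ
    (Submodule.Quotient.restrictScalarsEquiv k
      (Submodule.span (WeylN k n) (Set.range (XDi k n)))).symm.toLinearMap

lemma res_smul_gen (P : WeylN k n) : res k n (P • gen k n) = residue k n P := by
  rw [← mk_eq_smul_gen]
  rfl

lemma res_pdDi_smul (i : Fin n) (e : EDcar k n) : res k n (pdDi k n i • e) = 0 := by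
  obtain ⟨P, rfl⟩ := exists_smul_gen e
  rw [← mul_smul, res_smul_gen, residue_pdDi_mul]

lemma res_ofPoly (g : MvPolynomial (Fin n) k) : res k n (ofPoly k n g) = coeff 0 g := by
  induction g using MvPolynomial.induction_on with
  | C a =>
    rw [ofPoly_apply, res_smul_gen, ← MvPolynomial.algebraMap_eq, AlgHom.commutes,
      Algebra.algebraMap_eq_smul_one, map_smul, residue_one,
      MvPolynomial.algebraMap_eq, coeff_zero_C, smul_eq_mul, mul_one]
  | add p q hp hq => rw [map_add, map_add, hp, hq, coeff_add]
  | mul_X p i _ =>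
    rw [mul_comm, ← pdDi_smul_ofPoly, res_pdDi_smul, coeff_X_mul', if_neg (by simp)]

/-- Up to nonzero scalars, the residue pairing is the pairing of monomials with coefficients. -/
lemma exists_res_monomial (k : Type) [Field k] [CharZero k] {n : ℕ} (b : Fin n →₀ ℕ) :
    ∃ u : k, u ≠ 0 ∧ ∀ g,
      res k n (mulOp k n (monomial b 1) • ofPoly k n g) = u * coeff b g := by
  induction b using exponent_induction with
  | zero =>
    refine ⟨1, one_ne_zero, fun g => ?_⟩
    rw [← one_def, map_one, one_smul, res_ofPoly, one_mul]
  | add_single b i hb =>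
    obtain ⟨u, hu, hb⟩ := hb
    refine ⟨-u * (b i + 1), mul_ne_zero (neg_ne_zero.2 hu) (Nat.cast_add_one_ne_zero _),
      fun g => ?_⟩
    rw [monomial_add_single, pow_one, map_mul, mulOp_X, mul_smul, XDi_smul_ofPoly, smul_neg,
      map_neg, hb, coeff_pderiv]
    ring

/-- The residue pairing with polynomials separates the elements of `E_D`. -/
lemma eq_zero_of_res_eq_zero {e : EDcar k n}
    (h : ∀ f, res k n (mulOp k n f • e) = 0) : e = 0 := by
  obtain ⟨g, rfl⟩ := ofPoly_surjective e
  suffices g = 0 by rw [this, map_zero]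
  ext b
  obtain ⟨u, hu, hb⟩ := exists_res_monomial k b
  simpa [hb, hu] using h (monomial b 1)

/-- Every functional on polynomials vanishing on monomials of high degree is a residue
functional. -/
lemma exists_res_eq (ψ : MvPolynomial (Fin n) k →ₗ[k] k) (N : ℕ)
    (hψ : ∀ b : Fin n →₀ ℕ, N ≤ b.degree → ψ (monomial b 1) = 0) :
    ∃ e : EDcar k n, ∀ f, res k n (mulOp k n f • e) = ψ f := by
  choose u hu hres using exists_res_monomial k (n := n)
  have hfin : {b : Fin n →₀ ℕ | b.degree < N}.Finite := Finsupp.finite_of_degree_lt N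
  let g : MvPolynomial (Fin n) k :=
    ∑ b ∈ hfin.toFinset, monomial b ((u b)⁻¹ * ψ (monomial b 1))
  have hg : ∀ b, coeff b g = (u b)⁻¹ * ψ (monomial b 1) := fun b => by
    classical
    simp only [g, coeff_sum, coeff_monomial, Finset.sum_ite_eq']
    split_ifs with hb
    · rfl
    · rw [hψ b (by simpa using hb), mul_zero]
  refine ⟨ofPoly k n g, fun f => ?_⟩
  induction f using MvPolynomial.induction_on' with
  | monomial b a =>
    have : monomial b a = a • monomial b (1 : k) := by simp [smul_monomial]
    rw [this, map_smul ψ, map_smul (mulOp k n), smul_assoc, map_smul (res k n), hres, hg, mul_inv_cancel_left₀ (hu b)]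
  | add p q hp hq => rw [map_add, map_add, add_smul, map_add, hp, hq]

end LocalCohomology

section Grading

variable {k : Type} [Field k] {M : Type} [AddCommGroup M] [Module k M]

/-- The elements whose homogeneous components all have degree less than `L`. -/
def degLT (deg : ℤ → Submodule k M) [DirectSum.Decomposition deg] (L : ℤ) : Submodule k M where
  carrier := {m | ∀ l, L ≤ l → (DirectSum.decompose deg m l : M) = 0}
  zero_mem' l _ := by simp
  add_mem' {x y} hx hy l hl := by
    rw [DirectSum.decompose_add, DirectSum.add_apply, Submodule.coe_add, hx l hl, hy l hl,
      add_zero]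
  smul_mem' c x hx l hl := by
    rw [DirectSum.decompose_smul, DirectSum.smul_apply, Submodule.coe_smul, hx l hl, smul_zero]

lemma degLT_mono (deg : ℤ → Submodule k M) [DirectSum.Decomposition deg] :
    Monotone (degLT deg) := fun _ _ h _ hm l hl => hm l (h.trans hl)

lemma exists_mem_degLT (deg : ℤ → Submodule k M) [DirectSum.Decomposition deg] (m : M) :
    ∃ L, m ∈ degLT deg L := by
  induction m using DirectSum.Decomposition.inductionOn deg with
  | zero => exact ⟨0, Submodule.zero_mem _⟩
  | @homogeneous j m =>
    exact ⟨j + 1, fun l hl => DirectSum.decompose_of_mem_ne deg m.2 (by lia)⟩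
  | add x y hx hy =>
    obtain ⟨L₁, h₁⟩ := hx
    obtain ⟨L₂, h₂⟩ := hy
    exact ⟨max L₁ L₂, Submodule.add_mem _ (degLT_mono deg (le_max_left _ _) h₁)
      (degLT_mono deg (le_max_right _ _) h₂)⟩

lemma exists_sup_degLT_eq_top (deg : ℤ → Submodule k M) [DirectSum.Decomposition deg]
    (N : Submodule k M) [FiniteDimensional k (M ⧸ N)] : ∃ L, N ⊔ degLT deg L = ⊤ := by
  classical
  obtain ⟨s, hs⟩ := Module.Finite.fg_top (R := k) (M := M ⧸ N)
  choose L hL using fun x : M ⧸ N => exists_mem_degLT deg x.out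
  obtain ⟨B, hB⟩ := (s.image L).exists_le
  refine ⟨B, ?_⟩
  have hmap : (degLT deg B).map N.mkQ = ⊤ := by
    rw [eq_top_iff, ← hs, Submodule.span_le]
    exact fun x hx => ⟨x.out, degLT_mono deg (hB _ (Finset.mem_image_of_mem L hx)) (hL x),
      x.out_eq'⟩
  rw [← Submodule.comap_map_mkQ, hmap, Submodule.comap_top]

variable {n : ℕ} [Module (WeylN k n) M]

lemma mulOp_monomial_smul_mem {deg : ℤ → Submodule k M}
    (hX : ∀ (i : Fin n) (l : ℤ), ∀ m ∈ deg l, XDi k n i • m ∈ deg (l + 1))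
    (b : Fin n →₀ ℕ) : ∀ {l : ℤ}, ∀ m ∈ deg l,
      mulOp k n (monomial b 1) • m ∈ deg (l + b.degree) := by
  induction b using exponent_induction with
  | zero => simp [← one_def]
  | add_single b i hb =>
    intro l m hm
    rw [monomial_add_single, pow_one, map_mul, mulOp_X, mul_smul, map_add, Finsupp.degree_single]
    have := hb _ (hX i l m hm)
    convert this using 2
    push_cast
    ring

lemma decompose_pdDi_smul (deg : ℤ → Submodule k M) [DirectSum.Decomposition deg]
    (hpd : ∀ (i : Fin n) (l : ℤ), ∀ m ∈ deg l, pdDi k n i • m ∈ deg (l - 1))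
    (i : Fin n) (l : ℤ) (m : M) : (DirectSum.decompose deg (pdDi k n i • m) l : M) =
      pdDi k n i • (DirectSum.decompose deg m (l + 1) : M) := by
  induction m using DirectSum.Decomposition.inductionOn deg with
  | zero => simp
  | @homogeneous j m =>
    obtain ⟨m, hm⟩ := m
    rcases eq_or_ne j (l + 1) with rfl | hj
    · rw [DirectSum.decompose_of_mem_same deg hm, DirectSum.decompose_of_mem_same deg]
      simpa using hpd i _ m hm
    · rw [DirectSum.decompose_of_mem_ne deg hm hj,
        DirectSum.decompose_of_mem_ne deg (hpd i j m hm) (by lia), smul_zero]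
  | add x y hx hy =>
    simp only [smul_add, DirectSum.decompose_add, DirectSum.add_apply, Submodule.coe_add, hx, hy]

variable [IsScalarTower k (WeylN k n) M]

lemma decompose_mem_iSup_range (deg : ℤ → Submodule k M) [DirectSum.Decomposition deg]
    (hpd : ∀ (i : Fin n) (l : ℤ), ∀ m ∈ deg l, pdDi k n i • m ∈ deg (l - 1)) {m : M}
    (hm : m ∈ ⨆ i : Fin n, LinearMap.range (pdEnd k n M i)) (l : ℤ) :
    (DirectSum.decompose deg m l : M) ∈ ⨆ i : Fin n, LinearMap.range (pdEnd k n M i) := by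
  induction hm using Submodule.iSup_induction' with
  | mem i m hm =>
    obtain ⟨m, rfl⟩ := hm
    exact Submodule.mem_iSup_of_mem i ⟨_, (decompose_pdDi_smul deg hpd i l m).symm⟩
  | zero => simp
  | add x y _ _ hx hy =>
    rw [DirectSum.decompose_add, DirectSum.add_apply, Submodule.coe_add]
    exact Submodule.add_mem _ hx hy

/-- If the top de Rham cohomology of a graded module is finite dimensional, it vanishes in
high degrees. -/
lemma exists_deg_le_iSup_range {deg : ℤ → Submodule k M} (hint : DirectSum.IsInternal deg)
    (hpd : ∀ (i : Fin n) (l : ℤ), ∀ m ∈ deg l, pdDi k n i • m ∈ deg (l - 1))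
    [FiniteDimensional k (M ⧸ (⨆ i : Fin n, LinearMap.range (pdEnd k n M i)))] :
    ∃ L : ℤ, ∀ l, L ≤ l → deg l ≤ ⨆ i : Fin n, LinearMap.range (pdEnd k n M i) := by
  let _ := hint.chooseDecomposition
  obtain ⟨L, hL⟩ := exists_sup_degLT_eq_top deg (⨆ i : Fin n, LinearMap.range (pdEnd k n M i))
  refine ⟨L, fun l hl m hm => ?_⟩
  obtain ⟨x, hx, y, hy, rfl⟩ := Submodule.mem_sup.1 (hL.ge (Submodule.mem_top (x := m)))
  rw [← DirectSum.decompose_of_mem_same deg hm, DirectSum.decompose_add, DirectSum.add_apply,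
    Submodule.coe_add, hy l hl, add_zero]
  exact decompose_mem_iSup_range deg hpd hx l

end Grading

section DeRham

variable {k : Type} [Field k] [CharZero k] {n : ℕ} {M : Type} [AddCommGroup M] [Module k M]
  [Module (WeylN k n) M] [IsScalarTower k (WeylN k n) M]

/-- A functional on `M` vanishing on all `∂_i M`, and such that each element of `M` pairs to
zero with all monomials of high degree, comes from a unique `D`-linear map to `E_D`. -/
lemma exists_hom_res_eq (φ : M →ₗ[k] k) (hφ : ∀ i (m : M), φ (pdDi k n i • m) = 0)
    (hN : ∀ m : M, ∃ N : ℕ, ∀ b : Fin n →₀ ℕ, N ≤ b.degree →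
      φ (mulOp k n (monomial b 1) • m) = 0) :
    ∃ h : M →ₗ[WeylN k n] EDcar k n, ∀ m, res k n (h m) = φ m := by
  have hex : ∀ m : M, ∃ e : EDcar k n, ∀ f,
      res k n (mulOp k n f • e) = φ (mulOp k n f • m) := fun m => by
    obtain ⟨N, h⟩ := hN m
    exact exists_res_eq (φ ∘ₗ (LinearMap.toSpanSingleton (WeylN k n) M m).restrictScalars k ∘ₗ
      (mulOp k n).toLinearMap) N h
  choose h hh using hex
  have huniq : ∀ m e, (∀ f, res k n (mulOp k n f • e) = φ (mulOp k n f • m)) → h m = e :=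
    fun m e he => by
      rw [← sub_eq_zero]
      refine eq_zero_of_res_eq_zero fun f => ?_
      rw [smul_sub, map_sub, hh, he, sub_self]
  have hadd : ∀ m m', h (m + m') = h m + h m' := fun m m' =>
    huniq _ _ fun f => by simp only [smul_add, map_add, hh]
  have hmove : ∀ {V : Type} [AddCommGroup V] [Module k V] [Module (WeylN k n) V]
      (θ : V →ₗ[k] k), (∀ i (v : V), θ (pdDi k n i • v) = 0) → ∀ i f (v : V),
      θ (mulOp k n f • pdDi k n i • v) = -θ (mulOp k n (pderiv i f) • v) := by
    intro V _ _ _ θ hθ i f v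
    rw [← mul_smul, eq_sub_of_add_eq (pdDi_mul_mulOp i f).symm, sub_smul, map_sub, mul_smul, hθ,
      zero_sub]
  have hsmul : ∀ (P : WeylN k n) m, h (P • m) = P • h m := fun P => by
    induction P using WeylN.induction with
    | hX i =>
      refine fun m => huniq _ _ fun f => ?_
      rw [← mulOp_X, ← mul_smul, ← mul_smul, ← map_mul, hh]
    | hpd i =>
      refine fun m => huniq _ _ fun f => ?_
      rw [hmove _ res_pdDi_smul, hmove _ hφ, hh]
    | halg r =>
      refine fun m => huniq _ _ fun f => ?_
      simp only [← mul_smul, ← Algebra.commutes r]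
      simp only [mul_smul, algebraMap_smul, map_smul, hh]
    | hadd P Q hP hQ => exact fun m => by rw [add_smul, add_smul, hadd, hP, hQ]
    | hmul P Q hP hQ => exact fun m => by rw [mul_smul, mul_smul, hP, hQ]
  refine ⟨{ toFun := h, map_add' := hadd, map_smul' := hsmul }, fun m => ?_⟩
  simpa using hh m 1

/-- Composition with the residue, from `Hom_D(M, E_D)` to the dual of de Rham cohomology. -/
noncomputable def homToDual (k : Type) [Field k] [CharZero k] (n : ℕ) (M : Type)
    [AddCommGroup M] [Module k M] [Module (WeylN k n) M] [IsScalarTower k (WeylN k n) M] :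
    (M →ₗ[WeylN k n] EDcar k n) →ₗ[k]
      Module.Dual k (M ⧸ (⨆ i : Fin n, LinearMap.range (pdEnd k n M i))) where
  toFun h := (⨆ i : Fin n, LinearMap.range (pdEnd k n M i)).liftQ
    (res k n ∘ₗ h.restrictScalars k) <| iSup_le fun i => by
      rintro _ ⟨m, rfl⟩
      have : h (pdDi k n i • m) = pdDi k n i • h m := map_smul h _ _
      change res k n (h (pdDi k n i • m)) = 0
      rw [this, res_pdDi_smul]
  map_add' h h' := by
    ext m
    exact map_add (res k n) (h m) (h' m)
  map_smul' c h := by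
    ext m
    exact map_smul (res k n) c (h m)

lemma homToDual_mk (h : M →ₗ[WeylN k n] EDcar k n) (m : M) :
    homToDual k n M h (Submodule.mkQ _ m) = res k n (h m) := rfl

lemma homToDual_injective : Function.Injective (homToDual k n M) := by
  rw [injective_iff_map_eq_zero]
  refine fun h hh => LinearMap.ext fun m => eq_zero_of_res_eq_zero fun f => ?_
  rw [← map_smul, ← homToDual_mk, hh, LinearMap.zero_apply]

lemma homToDual_surjective {deg : ℤ → Submodule k M} (hint : DirectSum.IsInternal deg)
    (hX : ∀ (i : Fin n) (l : ℤ), ∀ m ∈ deg l, XDi k n i • m ∈ deg (l + 1))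
    (hpd : ∀ (i : Fin n) (l : ℤ), ∀ m ∈ deg l, pdDi k n i • m ∈ deg (l - 1))
    [FiniteDimensional k (M ⧸ (⨆ i : Fin n, LinearMap.range (pdEnd k n M i)))] :
    Function.Surjective (homToDual k n M) := by
  intro ψ
  have hψ : ∀ m ∈ ⨆ i : Fin n, LinearMap.range (pdEnd k n M i),
      ψ (Submodule.mkQ _ m) = 0 := fun m hm => by
    rw [Submodule.mkQ_apply, (Submodule.Quotient.mk_eq_zero _).2 hm, map_zero]
  obtain ⟨L, hL⟩ := exists_deg_le_iSup_range hint hpd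
  obtain ⟨h, hh⟩ := exists_hom_res_eq (n := n) (ψ ∘ₗ Submodule.mkQ _)
    (fun i m => hψ _ (Submodule.mem_iSup_of_mem i ⟨m, rfl⟩)) fun m => by
      have hm : m ∈ ⨆ l, deg l := by rw [hint.submodule_iSup_eq_top]; trivial
      induction hm using Submodule.iSup_induction' with
      | mem l m hm =>
        exact ⟨(L - l).toNat, fun b hb =>
          hψ _ (hL _ (by lia) (mulOp_monomial_smul_mem hX b m hm))⟩
      | zero => exact ⟨0, fun b _ => by rw [smul_zero, map_zero]⟩
      | add x y _ _ hx hy =>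
        obtain ⟨N₁, h₁⟩ := hx
        obtain ⟨N₂, h₂⟩ := hy
        refine ⟨max N₁ N₂, fun b hb => ?_⟩
        rw [smul_add, map_add, h₁ b (le_of_max_le_left hb), h₂ b (le_of_max_le_right hb),
          add_zero]
  refine ⟨h, ?_⟩
  ext m
  exact hh m

end DeRham

end WeylN

/-- Let `M` be a finitely generated graded left `D`-module
(`D` the Weyl algebra over a field `k` of characteristic zero) such that
`H^n_dR(M) = M/(∂₁·M + ⋯ + ∂ₙ·M)` is finite dimensional over `k`.  Then
`Hom_D(M, E_D)` is a finite dimensional `k`-space of the same dimension. -/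
theorem dim_Hom_D_to_ED_eq_dim_Hn
    (k : Type) [Field k] [CharZero k] (n : ℕ) (hn : 0 < n)
    (M : Type) [AddCommGroup M] [Module k M]
    [Module (WeylN k n) M] [IsScalarTower k (WeylN k n) M]
    [Module.Finite (WeylN k n) M]
    (deg : ℤ → Submodule k M)
    (hint : DirectSum.IsInternal deg)
    (hX : ∀ (i : Fin n) (l : ℤ), ∀ m ∈ deg l, XDi k n i • m ∈ deg (l + 1))
    (hpd : ∀ (i : Fin n) (l : ℤ), ∀ m ∈ deg l, pdDi k n i • m ∈ deg (l - 1))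
    (hfin : FiniteDimensional k
      (M ⧸ (⨆ i : Fin n, LinearMap.range (pdEnd k n M i)))) :
    FiniteDimensional k (M →ₗ[WeylN k n] EDcar k n) ∧
      Module.finrank k (M →ₗ[WeylN k n] EDcar k n) =
        Module.finrank k (M ⧸ (⨆ i : Fin n, LinearMap.range (pdEnd k n M i))) := by
  let Λ := LinearEquiv.ofBijective (WeylN.homToDual k n M)
    ⟨WeylN.homToDual_injective, WeylN.homToDual_surjective hint hX hpd⟩
  exact ⟨Module.Finite.equiv Λ.symm, Λ.finrank_eq.trans Subspace.dual_finrank_eq⟩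
end

section
/- Let D be the Weyl algebra in one variable over k and let M = D/(D·(X∘∂)) be the quotient of D by the left ideal generated by the operator X∘∂ (i.e., f ↦ x·f′). Then left multiplication by ∂ on M is bijective; equivalently, ker(∂ acting on M) = 0 and ∂·M = M. -/
open Polynomial

set_option maxHeartbeats 1000000
set_option synthInstance.maxHeartbeats 400000

/-- Multiplication by `x` on `k[x]`, as a `k`-linear endomorphism. -/
noncomputable def Xop (k : Type) [Field k] : Module.End k (Polynomial k) :=
  Algebra.lmul k (Polynomial k) Polynomial.X

/-- The derivative `∂ = d/dx` on `k[x]`, as a `k`-linear endomorphism. -/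
noncomputable def Dop (k : Type) [Field k] : Module.End k (Polynomial k) :=
  Polynomial.derivative

/-- The Weyl algebra in one variable: the `k`-subalgebra of `End_k(k[x])` generated by
the multiplication operator `X` and the derivative operator `∂`. -/
noncomputable def Weyl1 (k : Type) [Field k] : Type :=
  Algebra.adjoin k {Xop k, Dop k}

noncomputable instance (k : Type) [Field k] : Ring (Weyl1 k) :=
  inferInstanceAs (Ring ↥(Algebra.adjoin k {Xop k, Dop k}))

noncomputable instance (k : Type) [Field k] : Algebra k (Weyl1 k) :=
  inferInstanceAs (Algebra k ↥(Algebra.adjoin k {Xop k, Dop k}))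

/-- `X` as an element of the Weyl algebra. -/
noncomputable def XD (k : Type) [Field k] : Weyl1 k :=
  (⟨Xop k, Algebra.subset_adjoin (Set.mem_insert _ _)⟩ :
    ↥(Algebra.adjoin k {Xop k, Dop k}))

/-- `∂` as an element of the Weyl algebra. -/
noncomputable def dD (k : Type) [Field k] : Weyl1 k :=
  (⟨Dop k, Algebra.subset_adjoin (Set.mem_insert_of_mem _ rfl)⟩ :
    ↥(Algebra.adjoin k {Xop k, Dop k}))

/-- The inclusion of the Weyl algebra into the endomorphism algebra of `k[x]`. -/
noncomputable def Weyl1.val (k : Type) [Field k] : Weyl1 k →ₐ[k] Module.End k k[X] :=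
  (Algebra.adjoin k {Xop k, Dop k}).val

/-- A polynomial, viewed as a multiplication operator in the Weyl algebra. -/
noncomputable def Weyl1.ofPoly (k : Type) [Field k] : k[X] →ₐ[k] Weyl1 k :=
  Polynomial.aeval (XD k)

namespace Weyl1

variable {k : Type} [Field k]

lemma val_injective : Function.Injective (val k) := Subtype.val_injective

@[simp] lemma val_XD : val k (XD k) = Xop k := rfl

@[simp] lemma val_dD : val k (dD k) = Dop k := rfl

lemma ext_apply {P Q : Weyl1 k} (h : ∀ f, val k P f = val k Q f) : P = Q :=
  val_injective (LinearMap.ext h)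

@[simp] lemma val_ofPoly (q : k[X]) : val k (ofPoly k q) = Algebra.lmul k k[X] q := by
  rw [ofPoly, ← Polynomial.aeval_algHom_apply, val_XD, Xop, Polynomial.aeval_algHom_apply,
    Polynomial.aeval_X_left_apply]

lemma ofPoly_X : ofPoly k X = XD k := Polynomial.aeval_X _

lemma dD_mul_ofPoly (q : k[X]) :
    dD k * ofPoly k q = ofPoly k q * dD k + ofPoly k (derivative q) := by
  refine ext_apply fun f => ?_
  simp only [map_mul, map_add, val_dD, val_ofPoly, Module.End.mul_apply, LinearMap.add_apply,
    Dop, Algebra.coe_lmul_eq_mul,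
    LinearMap.mul_apply', Polynomial.derivative_mul]
  ring

lemma induction_on {p : Weyl1 k → Prop} (P : Weyl1 k) (X : p (XD k)) (d : p (dD k))
    (algebraMap : ∀ c, p (algebraMap k _ c)) (add : ∀ A B, p A → p B → p (A + B))
    (mul : ∀ A B, p A → p B → p (A * B)) : p P := by
  obtain ⟨P, hP⟩ := P
  induction hP using Algebra.adjoin_induction with
  | mem x hx =>
    rcases hx with rfl | rfl
    exacts [X, d]
  | algebraMap c => exact algebraMap c
  | add x y hx hy h1 h2 => exact add _ _ h1 h2
  | mul x y hx hy h1 h2 => exact mul _ _ h1 h2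

/-- The Weyl algebra is the sum of `∂ D` and `k[x]`. -/
lemma exists_eq_dD_mul_add_ofPoly (P : Weyl1 k) :
    ∃ Q q, P = dD k * Q + ofPoly k q := by
  suffices h : ∀ A : Weyl1 k, (∃ Q q, A = dD k * Q + ofPoly k q) →
      ∃ Q q, A * P = dD k * Q + ofPoly k q by
    simpa using h 1 ⟨0, 1, by simp⟩
  induction P using induction_on with
  | X =>
    rintro _ ⟨Q, q, rfl⟩
    exact ⟨Q * XD k, q * X, by rw [map_mul, ofPoly_X]; noncomm_ring⟩
  | d =>
    rintro _ ⟨Q, q, rfl⟩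
    refine ⟨Q * dD k + ofPoly k q, -derivative q, ?_⟩
    rw [mul_add, dD_mul_ofPoly, map_neg]
    noncomm_ring
  | algebraMap c =>
    rintro _ ⟨Q, q, rfl⟩
    exact ⟨c • Q, c • q, by simp [Algebra.algebraMap_eq_smul_one]⟩
  | add A B hA hB =>
    intro P hP
    obtain ⟨Q, q, h⟩ := hA P hP
    obtain ⟨Q', q', h'⟩ := hB P hP
    exact ⟨Q + Q', q + q', by rw [mul_add, h, h', map_add]; noncomm_ring⟩
  | mul A B hA hB =>
    intro P hP
    rw [← mul_assoc]
    exact hB _ (hA P hP)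

/-- The commutator with `∂`. -/
noncomputable def adD (k : Type) [Field k] : Module.End k (Weyl1 k) :=
  LinearMap.mulLeft k (dD k) - LinearMap.mulRight k (dD k)

lemma adD_apply (P : Weyl1 k) : adD k P = dD k * P - P * dD k := rfl

lemma adD_pow_XD_mul (n : ℕ) (A : Weyl1 k) :
    (adD k ^ (n + 1)) (XD k * A) =
      XD k * (adD k ^ (n + 1)) A + (n + 1) • (adD k ^ n) A := by
  have key : ∀ A : Weyl1 k, adD k (XD k * A) = XD k * adD k A + A := fun A => by
    have := dD_mul_ofPoly (k := k) X
    rw [ofPoly_X, derivative_X, map_one] at this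
    rw [adD_apply, adD_apply, ← mul_assoc, this]
    noncomm_ring
  induction n with
  | zero => simp [key]
  | succ n ih =>
    rw [pow_succ', Module.End.mul_apply, ih, map_add, key, map_nsmul,
      ← Module.End.mul_apply, ← Module.End.mul_apply, ← pow_succ', ← pow_succ',
      succ_nsmul _ (n + 1)]
    abel

lemma adD_pow_dD_mul (n : ℕ) (A : Weyl1 k) :
    (adD k ^ n) (dD k * A) = dD k * (adD k ^ n) A := by
  induction n with
  | zero => simp
  | succ n ih =>
    rw [pow_succ', Module.End.mul_apply, ih, Module.End.mul_apply, adD_apply, adD_apply]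
    noncomm_ring

/-- The commutator with `∂` is locally nilpotent. -/
lemma exists_adD_pow_eq_zero (P : Weyl1 k) : ∃ n, (adD k ^ n) P = 0 := by
  suffices h : ∀ A : Weyl1 k, A ∈ (adD k).maxGenEigenspace 0 →
      P * A ∈ (adD k).maxGenEigenspace 0 by
    have h1 : (1 : Weyl1 k) ∈ (adD k).maxGenEigenspace 0 := by
      rw [Module.End.mem_maxGenEigenspace]
      exact ⟨1, by simp [adD_apply]⟩
    simpa [Module.End.mem_maxGenEigenspace] using h 1 h1
  induction P using induction_on with
  | X =>
    simp only [Module.End.mem_maxGenEigenspace, zero_smul, sub_zero]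
    rintro A ⟨n, hn⟩
    refine ⟨n + 1, ?_⟩
    rw [adD_pow_XD_mul, pow_succ', Module.End.mul_apply, hn]
    simp
  | d =>
    simp only [Module.End.mem_maxGenEigenspace, zero_smul, sub_zero]
    rintro A ⟨n, hn⟩
    exact ⟨n, by rw [adD_pow_dD_mul, hn, mul_zero]⟩
  | algebraMap c =>
    intro A hA
    rw [← Algebra.smul_def]
    exact Submodule.smul_mem _ _ hA
  | add A B hA hB =>
    intro P hP
    rw [add_mul]
    exact add_mem (hA P hP) (hB P hP)
  | mul A B hA hB =>
    intro P hP
    rw [mul_assoc]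
    exact hA _ (hB P hP)

variable [CharZero k]

lemma exists_derivative_X_mul_eq (f : k[X]) : ∃ g : k[X], derivative (g * X) = f := by
  induction f using Polynomial.induction_on' with
  | add p q hp hq =>
    obtain ⟨g, rfl⟩ := hp
    obtain ⟨h, rfl⟩ := hq
    exact ⟨g + h, by rw [add_mul, derivative_add]⟩
  | monomial n a =>
    refine ⟨monomial n (a / (n + 1)), ?_⟩
    have : (n + 1 : k) ≠ 0 := Nat.cast_add_one_ne_zero n
    rw [monomial_mul_X, derivative_monomial]
    simp [div_mul_cancel₀ _ this]

/-- A right multiple of `∂` that is a multiplication operator vanishes. -/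
lemma eq_zero_of_dD_mul_eq_ofPoly {P : Weyl1 k} {q : k[X]} (h : dD k * P = ofPoly k q) :
    P = 0 := by
  obtain ⟨n, hn⟩ := exists_adD_pow_eq_zero P
  induction n generalizing P q with
  | zero => simpa using hn
  | succ n ih =>
    have hcomm : adD k P = 0 := by
      refine ih (q := derivative q) ?_ (by rwa [pow_succ, Module.End.mul_apply] at hn)
      rw [adD_apply, mul_sub, ← mul_assoc, ← mul_assoc, mul_assoc, h, dD_mul_ofPoly]
      abel
    rw [adD_apply, h, sub_eq_zero] at hcomm
    have hq : q = 0 := by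
      simpa [Dop] using congrArg (fun A => val k A 1) hcomm
    refine ext_apply fun f => ?_
    obtain ⟨g, rfl⟩ := exists_derivative_X_mul_eq f
    simpa [hq, Dop, -derivative_mul] using (congrArg (fun A => val k A (g * X)) hcomm).symm

end Weyl1

open Weyl1 in
/-- Let `D` be the Weyl algebra in one variable over a field `k` of
characteristic zero, and let `M = D/(D·(X∘∂))`.  Then left multiplication by `∂` on
`M` is bijective. -/
theorem d_bijective_on_D_mod_xd (k : Type) [Field k] [CharZero k] :
    Function.Bijective (fun m : Weyl1 k ⧸ (Submodule.span (Weyl1 k) {XD k * dD k}) =>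
      dD k • m) := by
  constructor
  · intro m m' hm
    obtain ⟨P, rfl⟩ := Submodule.Quotient.mk_surjective _ m
    obtain ⟨P', rfl⟩ := Submodule.Quotient.mk_surjective _ m'
    simp only [← Submodule.Quotient.mk_smul, Submodule.Quotient.eq, smul_eq_mul, ← mul_sub,
      Submodule.mem_span_singleton] at hm ⊢
    obtain ⟨A, hA⟩ := hm
    obtain ⟨Q, q, rfl⟩ := exists_eq_dD_mul_add_ofPoly A
    have hqX := dD_mul_ofPoly (q * X)
    have hqX' : ofPoly k q * (XD k * dD k) = ofPoly k (q * X) * dD k := by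
      rw [map_mul, ofPoly_X, mul_assoc]
    have h : dD k * (P - P' - Q * (XD k * dD k) - ofPoly k (q * X)) =
        ofPoly k (-derivative (q * X)) := by
      rw [mul_sub, mul_sub _ (P - P'), ← hA, hqX, add_mul, hqX', map_neg]
      noncomm_ring
    have h0 := eq_zero_of_dD_mul_eq_ofPoly h
    have hder : derivative (q * X) = 0 := by
      rw [h0, mul_zero] at h
      simpa [-derivative_mul] using (congrArg (fun B => val k B 1) h).symm
    have hq : q * X = 0 := by
      rw [eq_C_of_natDegree_eq_zero (derivative_eq_zero.mp hder)]
      simp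
    rw [hq, map_zero, sub_zero, sub_eq_zero] at h0
    exact ⟨Q, h0.symm⟩
  · intro m
    obtain ⟨P, rfl⟩ := Submodule.Quotient.mk_surjective _ m
    obtain ⟨Q, q, rfl⟩ := exists_eq_dD_mul_add_ofPoly P
    obtain ⟨g, rfl⟩ := exists_derivative_X_mul_eq q
    refine ⟨Submodule.Quotient.mk (Q + ofPoly k (g * X)), ?_⟩
    simp only [← Submodule.Quotient.mk_smul, Submodule.Quotient.eq, smul_eq_mul,
      Submodule.mem_span_singleton]
    refine ⟨ofPoly k g, ?_⟩
    rw [mul_add, dD_mul_ofPoly, map_mul, ofPoly_X]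
    noncomm_ring
end
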